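/- For each n = 1,…,m and j = 1,…,m, the eigenfunction w^n_k concentrates at x*_j if and only if c^n_j ≠ 0, i.e. there exist C > 0 and points κ_k → x*_j with |w^n_k(κ_k)| ≥ C for k ≫ 1 exactly when the j-th component of the limit vector c^n is nonzero. -/

import Mathlib

open MeasureTheory Real Filter Topology Metric Bornology
open scoped RealInnerProductSpace

noncomputable section

/-- The plane `ℝ²`. -/
abbrev E2 : Type := EuclideanSpace ℝ (Fin 2)

/-- The Laplacian of a function on the plane, as the sum of the second partial
derivatives in the coordinate directions. -/
def lap (f : E2 → ℝ) (x : E2) : ℝ :=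
  ∑ i : Fin 2,
    fderiv ℝ (fun y => fderiv ℝ f y (EuclideanSpace.single i 1)) x (EuclideanSpace.single i 1)

/-- `G` is the Dirichlet Green function of `-Δ` on `Ω`, with regular part `K`
(so that `x ↦ K x x` is the Robin function). -/
structure IsGreen (Ω : Set E2) (G K : E2 → E2 → ℝ) : Prop where
  symm : ∀ x y, G x y = G y x
  decomp : ∀ x ∈ Ω, ∀ y ∈ Ω, x ≠ y →
    G x y = -(1 / (2 * π)) * Real.log (dist x y) + K x y
  harmK : ∀ y ∈ Ω, ∀ x ∈ Ω, lap (fun z => K z y) x = 0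
  harmG : ∀ y ∈ Ω, ∀ x ∈ Ω, x ≠ y → lap (fun z => G z y) x = 0
  bdry : ∀ y ∈ Ω, ∀ x ∈ frontier Ω, G x y = 0
  contK : ContinuousOn (fun p : E2 × E2 => K p.1 p.2) (closure Ω ×ˢ Ω ∪ Ω ×ˢ closure Ω)

/-- The Hamiltonian `H^m_V` of the system of `m`-point vortices:
`H^m_V(x₁,…,x_m) = ½ Σᵢ R(xᵢ) + Σ_{i<j} G(xᵢ,xⱼ) + (1/8π) Σᵢ log V(xᵢ)`. -/
def Ham (m : ℕ) (G K : E2 → E2 → ℝ) (V : E2 → ℝ) (x : Fin m → E2) : ℝ :=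
  (1 / 2) * ∑ i, K (x i) (x i)
    + ∑ i, ∑ j, (if i < j then G (x i) (x j) else 0)
    + (1 / (8 * π)) * ∑ i, Real.log (V (x i))

/-- The standard bubble `U(x) = log (1/(1+|x|²/8)²)`. -/
def U (x : E2) : ℝ := Real.log (1 / (1 + ‖x‖ ^ 2 / 8) ^ 2)

/-- `Λ` lists the eigenvalues (with multiplicity, in nondecreasing order) of the real
symmetric matrix `M`, as witnessed by an orthonormal eigenbasis. -/
def IsEigList {N : ℕ} (M : Matrix (Fin N) (Fin N) ℝ) (Λ : Fin N → ℝ) : Prop :=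
  Monotone Λ ∧ ∃ b : Fin N → (Fin N → ℝ),
    (∀ i i', (∑ t, b i t * b i' t) = if i = i' then 1 else 0) ∧
    ∀ i, M.mulVec (b i) = Λ i • b i

/-- The standing setting: a family `v_k` of solutions of the Liouville–Gel'fand problem
`-Δv = λ_k V e^v` in `Ω`, `v = 0` on `∂Ω`, blowing up at the `m` interior points
`x*₁, …, x*_m`, with local maximum points `x_{j,k} → x*_j`. -/
structure Setting (m : ℕ) where
  /-- the bounded planar domain -/
  Ω : Set E2
  /-- the positive coefficient `V ∈ C¹(Ω̄)` -/
  V : E2 → ℝ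
  /-- the parameters `λ_k ↓ 0` -/
  lam : ℕ → ℝ
  /-- the blow-up solutions -/
  v : ℕ → E2 → ℝ
  /-- the Dirichlet Green function of `-Δ` on `Ω` -/
  G : E2 → E2 → ℝ
  /-- its regular part; `x ↦ K x x` is the Robin function -/
  K : E2 → E2 → ℝ
  /-- the blow-up points -/
  xstar : Fin m → E2
  /-- the local maximum points `x_{j,k}` -/
  xpt : Fin m → ℕ → E2
  /-- the fixed small radius -/
  R : ℝ
  hm : 0 < m
  hopen : IsOpen Ω
  hbd : IsBounded Ω
  hconn : IsConnected Ω
  hVpos : ∀ x ∈ closure Ω, 0 < V x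
  hVreg : ContDiffOn ℝ 1 V (closure Ω)
  hgreen : IsGreen Ω G K
  hlam_pos : ∀ k, 0 < lam k
  hlam_anti : StrictAnti lam
  hlam0 : Tendsto lam atTop (𝓝 0)
  hv_reg : ∀ k, ContDiffOn ℝ 2 (v k) Ω
  hv_cont : ∀ k, ContinuousOn (v k) (closure Ω)
  hPDE : ∀ k, ∀ x ∈ Ω, -lap (v k) x = lam k * V x * Real.exp (v k x)
  hBC : ∀ k, ∀ x ∈ frontier Ω, v k x = 0
  hblow : Tendsto (fun k => ⨆ x ∈ closure Ω, |v k x|) atTop atTop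
  hmass : Tendsto (fun k => ∫ x in Ω, lam k * V x * Real.exp (v k x)) atTop (𝓝 (8 * π * m))
  hx_mem : ∀ j, xstar j ∈ Ω
  hx_inj : Function.Injective xstar
  hS : {x ∈ closure Ω | ∃ z : ℕ → E2, (∀ k, z k ∈ Ω) ∧ Tendsto z atTop (𝓝 x) ∧
      Tendsto (fun k => v k (z k)) atTop atTop} = Set.range xstar
  hR : 0 < R
  hR2 : ∀ j, closedBall (xstar j) (2 * R) ⊆ Ω
  hRdisj : ∀ i j, i ≠ j → Disjoint (ball (xstar i) R) (ball (xstar j) R)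
  hxpt_lim : ∀ j, Tendsto (fun k => xpt j k) atTop (𝓝 (xstar j))
  hxpt_mem : ∀ j k, xpt j k ∈ ball (xstar j) R
  hxpt_max : ∀ j k, ∀ x ∈ ball (xpt j k) R, v k x ≤ v k (xpt j k)
  hxpt_blow : ∀ j, Tendsto (fun k => v k (xpt j k)) atTop atTop

namespace Setting

variable {m : ℕ}

/-- The scaling parameter `δ_{j,k} > 0`, defined by
`λ_k V(x_{j,k}) e^{v_k(x_{j,k})} δ_{j,k}² = 1`. -/
def delta (S : Setting m) (j : Fin m) (k : ℕ) : ℝ :=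
  (Real.sqrt (S.lam k * S.V (S.xpt j k) * Real.exp (S.v k (S.xpt j k))))⁻¹

/-- The local mass `σ_{j,k} = ∫_{B_R(x_{j,k})} λ_k V e^{v_k}`. -/
def sigmaLoc (S : Setting m) (j : Fin m) (k : ℕ) : ℝ :=
  ∫ x in ball (S.xpt j k) S.R, S.lam k * S.V x * Real.exp (S.v k x)

/-- The entries of the matrix `(h_{ij})`:
`h_{ii} = R(x*_i) + 2 Σ_{h ≠ i} G(x*_h, x*_i) + (1/4π) log V(x*_i)`,
`h_{ij} = -G(x*_i, x*_j)` for `i ≠ j`. -/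
def hEnt (S : Setting m) (i j : Fin m) : ℝ :=
  if i = j then
    S.K (S.xstar i) (S.xstar i)
      + 2 * ∑ h, (if h = i then 0 else S.G (S.xstar h) (S.xstar i))
      + 1 / (4 * π) * Real.log (S.V (S.xstar i))
  else -S.G (S.xstar i) (S.xstar j)

/-- The matrix `(h_{ij})`. -/
def hmat (S : Setting m) : Matrix (Fin m) (Fin m) ℝ := Matrix.of S.hEnt

end Setting

/-- The eigenpairs `(μⁿ_k, wⁿ_k)` of the linearized problem
`-Δw = μ λ_k V e^{v_k} w` in `Ω`, `w = 0` on `∂Ω`, indexed by `n = 1, 2, …`,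
normalized by `‖wⁿ_k‖_∞ = max wⁿ_k = 1`, ordered, and orthogonal in `H¹₀`. -/
structure EigenData {m : ℕ} (S : Setting m) where
  /-- the `n`-th eigenvalue `μⁿ_k` (`n ≥ 1`) -/
  mu : ℕ → ℕ → ℝ
  /-- the `n`-th eigenfunction `wⁿ_k` -/
  w : ℕ → ℕ → E2 → ℝ
  hw_reg : ∀ n k, ContDiffOn ℝ 2 (w n k) S.Ω
  hw_cont : ∀ n k, ContinuousOn (w n k) (closure S.Ω)
  hPDE : ∀ n k, ∀ x ∈ S.Ω,
    -lap (w n k) x = mu n k * S.lam k * S.V x * Real.exp (S.v k x) * w n k x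
  hBC : ∀ n k, ∀ x ∈ frontier S.Ω, w n k x = 0
  hbound : ∀ n k, ∀ x ∈ closure S.Ω, |w n k x| ≤ 1
  hmax : ∀ n k, ∃ x ∈ closure S.Ω, w n k x = 1
  hpos : ∀ k, 0 < mu 1 k
  hlt : ∀ k, mu 1 k < mu 2 k
  hmono : ∀ k n, 2 ≤ n → mu n k ≤ mu (n + 1) k
  hdiv : ∀ k, Tendsto (fun n => mu n k) atTop atTop
  horth : ∀ k n n', 1 ≤ n → 1 ≤ n' → n ≠ n' →
    (∫ x in S.Ω, ⟪gradient (w n k) x, gradient (w n' k) x⟫) = 0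

/-- `c = (c₁,…,c_m) ≠ 0` is the limit vector of the rescaled `n`-th eigenfunctions
`w̃ⁿ_{j,k}(x) = wⁿ_k(δ_{j,k} x + x_{j,k}) → c_j` locally uniformly in `ℝ²`,
along the subsequence `φ`. -/
def IsLimitVec {m : ℕ} (S : Setting m) (W : EigenData S) (φ : ℕ → ℕ) (n : ℕ)
    (c : Fin m → ℝ) : Prop :=
  c ≠ 0 ∧ ∀ j : Fin m,
    TendstoLocallyUniformly
      (fun k (x : E2) => W.w n (φ k) (S.delta j (φ k) • x + S.xpt j (φ k)))
      (fun _ => c j) atTop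

/-- A sequence of (eigen)functions `w_k` concentrates at `κ`: there are `C > 0`
and `κ_k → κ` in `Ω` with `|w_k(κ_k)| ≥ C` for `k ≫ 1`. -/
def ConcentratesAt {m : ℕ} (S : Setting m) (wk : ℕ → E2 → ℝ) (κ : E2) : Prop :=
  ∃ C > 0, ∃ z : ℕ → E2, (∀ k, z k ∈ S.Ω) ∧ Tendsto z atTop (𝓝 κ) ∧
    ∀ᶠ k in atTop, C ≤ |wk k (z k)|

/-- The index `j` of the coordinate pair to which the `i`-th coordinate of
`ℝ^{2m} ≃ (ℝ²)^m` belongs. -/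
def coordIdx {m : ℕ} (i : Fin (2 * m)) : Fin m := ⟨i.1 / 2, by have h := i.isLt; omega⟩

/-- The `i`-th coordinate direction of `(ℝ²)^m ≃ ℝ^{2m}`. -/
def coordBasis (m : ℕ) (i : Fin (2 * m)) : Fin m → E2 :=
  Pi.single (coordIdx i) (EuclideanSpace.single ⟨i.1 % 2, by omega⟩ 1)

/-- The Hessian of the Hamiltonian `H^m_V` at `x0`, as a `2m × 2m` array of second
directional derivatives. -/
def hessHam (m : ℕ) (G K : E2 → E2 → ℝ) (V : E2 → ℝ) (x0 : Fin m → E2)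
    (i j : Fin (2 * m)) : ℝ :=
  fderiv ℝ (fun x => fderiv ℝ (Ham m G K V) x (coordBasis m j)) x0 (coordBasis m i)

/-! ### Part 1: calculus on the complex plane and on the cylinder -/

/-- partial derivative in the real direction -/
def dx (u : ℂ → ℝ) (z : ℂ) : ℝ := fderiv ℝ u z 1
/-- partial derivative in the imaginary direction -/
def dy (u : ℂ → ℝ) (z : ℂ) : ℝ := fderiv ℝ u z Complex.I
/-- Laplacian on the complex plane -/
def LL (u : ℂ → ℝ) (z : ℂ) : ℝ := dx (dx u) z + dy (dy u) z
/-- the function in log-polar coordinates around `p` -/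
def cyl (u : ℂ → ℝ) (p : ℂ) (z : ℂ) : ℝ := u (p + Complex.exp z)
/-- the integral over a circle of the cylinder -/
def cint (G : ℂ → ℝ) (s : ℝ) : ℝ := ∫ θ in (-π)..π, G (s + θ * Complex.I)
/-- half plane -/
def hp (b : ℝ) : Set ℂ := {z | z.re < b}

lemma hp_open (b : ℝ) : IsOpen (hp b) := isOpen_lt Complex.continuous_re continuous_const

lemma mem_hp {b s : ℝ} (h : s < b) (θ : ℝ) : (s + θ * Complex.I : ℂ) ∈ hp b := by
  simp [hp, h]

lemma C1_dx {u : ℂ → ℝ} {O : Set ℂ} (hO : IsOpen O) (hu : ContDiffOn ℝ 2 u O) :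
    ContDiffOn ℝ 1 (dx u) O := by
  have h := hu.fderiv_of_isOpen (m := 1) hO (by norm_num)
  exact h.clm_apply contDiffOn_const

lemma C1_dy {u : ℂ → ℝ} {O : Set ℂ} (hO : IsOpen O) (hu : ContDiffOn ℝ 2 u O) :
    ContDiffOn ℝ 1 (dy u) O := by
  have h := hu.fderiv_of_isOpen (m := 1) hO (by norm_num)
  exact h.clm_apply contDiffOn_const

lemma cont_dx {u : ℂ → ℝ} {O : Set ℂ} (hO : IsOpen O) (hu : ContDiffOn ℝ 1 u O) :
    ContinuousOn (dx u) O := by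
  have h := hu.continuousOn_fderiv_of_isOpen hO (by norm_num)
  exact h.clm_apply continuousOn_const

lemma cont_dy {u : ℂ → ℝ} {O : Set ℂ} (hO : IsOpen O) (hu : ContDiffOn ℝ 1 u O) :
    ContinuousOn (dy u) O := by
  have h := hu.continuousOn_fderiv_of_isOpen hO (by norm_num)
  exact h.clm_apply continuousOn_const

lemma cont_LL {u : ℂ → ℝ} {O : Set ℂ} (hO : IsOpen O) (hu : ContDiffOn ℝ 2 u O) :
    ContinuousOn (LL u) O :=
  (cont_dx hO (C1_dx hO hu)).add (cont_dy hO (C1_dy hO hu))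

lemma diffAt_of {u : ℂ → ℝ} {O : Set ℂ} (hO : IsOpen O) (hu : ContDiffOn ℝ 1 u O) {z : ℂ}
    (hz : z ∈ O) : DifferentiableAt ℝ u z :=
  (hu.differentiableOn (by norm_num)).differentiableAt (hO.mem_nhds hz)

lemma dxdy_comm {u : ℂ → ℝ} {O : Set ℂ} (hO : IsOpen O) (hu : ContDiffOn ℝ 2 u O) {z : ℂ}
    (hz : z ∈ O) : dx (dy u) z = dy (dx u) z := by
  have h1 : ContDiffAt ℝ 2 u z := hu.contDiffAt (hO.mem_nhds hz)
  have hs := h1.isSymmSndFDerivAt (by simp)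
  have hd : DifferentiableAt ℝ (fderiv ℝ u) z :=
    (h1.fderiv_right (m := 1) (by norm_num)).differentiableAt (by norm_num)
  unfold dx dy
  rw [fderiv_clm_apply hd (by fun_prop), fderiv_clm_apply hd (by fun_prop)]
  simp
  exact hs 1 Complex.I

lemma dx_mul {u v : ℂ → ℝ} {z : ℂ} (hu : DifferentiableAt ℝ u z) (hv : DifferentiableAt ℝ v z) :
    dx (fun z => u z * v z) z = u z * dx v z + dx u z * v z := by
  unfold dx; rw [fderiv_fun_mul hu hv]; simp [mul_comm]

lemma dy_mul {u v : ℂ → ℝ} {z : ℂ} (hu : DifferentiableAt ℝ u z) (hv : DifferentiableAt ℝ v z) :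
    dy (fun z => u z * v z) z = u z * dy v z + dy u z * v z := by
  unfold dy; rw [fderiv_fun_mul hu hv]; simp [mul_comm]

lemma dx_sub {u v : ℂ → ℝ} {z : ℂ} (hu : DifferentiableAt ℝ u z) (hv : DifferentiableAt ℝ v z) :
    dx (fun z => u z - v z) z = dx u z - dx v z := by
  unfold dx; rw [fderiv_fun_sub hu hv]; simp

/-- continuity of slices -/
lemma slice_cont {G : ℂ → ℝ} {b s : ℝ} (hG : ContinuousOn G (hp b)) (hs : s < b) :
    Continuous fun θ : ℝ => G (s + θ * Complex.I) := by
  rw [← continuousOn_univ]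
  exact hG.comp (by fun_prop) (fun θ _ => mem_hp hs θ)

lemma slice_int {G : ℂ → ℝ} {b s : ℝ} (hG : ContinuousOn G (hp b)) (hs : s < b) (c d : ℝ) :
    IntervalIntegrable (fun θ : ℝ => G (s + θ * Complex.I)) volume c d :=
  (slice_cont hG hs).intervalIntegrable _ _

lemma slice_hasDeriv_re {G : ℂ → ℝ} {s θ : ℝ} (hG : DifferentiableAt ℝ G (s + θ * Complex.I)) :
    HasDerivAt (fun s : ℝ => G (s + θ * Complex.I)) (dx G (s + θ * Complex.I)) s := by
  have h1 : HasDerivAt (fun s : ℝ => (s + θ * Complex.I : ℂ)) 1 s :=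
    (Complex.ofRealCLM.hasDerivAt (x := s)).add_const _
  exact hG.hasFDerivAt.comp_hasDerivAt s h1

lemma slice_hasDeriv_im {G : ℂ → ℝ} {s θ : ℝ} (hG : DifferentiableAt ℝ G (s + θ * Complex.I)) :
    HasDerivAt (fun θ : ℝ => G (s + θ * Complex.I)) (dy G (s + θ * Complex.I)) θ := by
  have h1 : HasDerivAt (fun θ : ℝ => (s + θ * Complex.I : ℂ)) Complex.I θ := by
    have := ((Complex.ofRealCLM.hasDerivAt (x := θ)).mul_const Complex.I).const_add (s : ℂ)
    simpa using this
  exact hG.hasFDerivAt.comp_hasDerivAt θ h1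

lemma cint_deriv {G : ℂ → ℝ} {b s : ℝ} (hG : ContDiffOn ℝ 1 G (hp b)) (hs : s < b) :
    HasDerivAt (cint G) (cint (dx G) s) s := by
  obtain ⟨ε, hε, hεb⟩ : ∃ ε > 0, s + ε < b := ⟨(b - s) / 2, by linarith, by linarith⟩
  have hdc := cont_dx (hp_open b) hG
  let Kset : Set (ℝ × ℝ) := Set.Icc (s - ε) (s + ε) ×ˢ Set.Icc (-π) π
  have hK : IsCompact Kset := isCompact_Icc.prod isCompact_Icc
  have hcont : ContinuousOn (fun q : ℝ × ℝ => dx G (q.1 + q.2 * Complex.I)) Kset := by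
    refine hdc.comp (by fun_prop) ?_
    rintro ⟨a, t⟩ ⟨⟨_, h2⟩, _⟩
    exact mem_hp (by simp at h2; linarith) t
  obtain ⟨C, hC⟩ := hK.exists_bound_of_continuousOn hcont
  refine (intervalIntegral.hasDerivAt_integral_of_dominated_loc_of_deriv_le
    (F := fun (s θ : ℝ) => G (s + θ * Complex.I)) (F' := fun (s θ : ℝ) => dx G (s + θ * Complex.I))
    (bound := fun _ => C) (s := Set.Ioo (s - ε) (s + ε)) (Ioo_mem_nhds (by linarith) (by linarith))
    ?_ (slice_int hG.continuousOn hs _ _) ?_ ?_ (by simp) ?_).2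
  · filter_upwards [Iio_mem_nhds hs] with x hx
    exact (slice_cont hG.continuousOn hx).aestronglyMeasurable
  · exact (slice_cont hdc hs).aestronglyMeasurable
  · refine Eventually.of_forall fun t ht x hx => ?_
    rw [Set.uIoc_of_le (by linarith [pi_pos])] at ht
    exact hC (x, t) ⟨⟨hx.1.le, hx.2.le⟩, ⟨ht.1.le, ht.2⟩⟩
  · refine Eventually.of_forall fun t ht x hx => ?_
    exact slice_hasDeriv_re (diffAt_of (hp_open b) hG (mem_hp (by linarith [hx.2]) t))

/-- periodicity -/
def Per (G : ℂ → ℝ) : Prop := ∀ z, G (z + 2 * π * Complex.I) = G z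

lemma Per.dx {G : ℂ → ℝ} (h : Per G) : Per (dx G) := by
  intro z
  have h2 : (fun z => G (z + 2 * π * Complex.I)) = G := funext h
  have := fderiv_comp_add_right (𝕜 := ℝ) (f := G) (x := z) (2 * π * Complex.I)
  rw [h2] at this
  unfold _root_.dx; rw [this]

lemma Per.dy {G : ℂ → ℝ} (h : Per G) : Per (dy G) := by
  intro z
  have h2 : (fun z => G (z + 2 * π * Complex.I)) = G := funext h
  have := fderiv_comp_add_right (𝕜 := ℝ) (f := G) (x := z) (2 * π * Complex.I)
  rw [h2] at this
  unfold _root_.dy; rw [this]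

lemma Per.mul {G H : ℂ → ℝ} (h : Per G) (h2 : Per H) : Per (fun z => G z * H z) := by
  intro z; simp only [h z, h2 z]

lemma cyl_per (u : ℂ → ℝ) (p : ℂ) : Per (cyl u p) := by
  intro z; simp only [cyl]; rw [Complex.exp_periodic z]

lemma cint_dy {G : ℂ → ℝ} {b s : ℝ} (hG : ContDiffOn ℝ 1 G (hp b)) (hs : s < b) (hP : Per G) :
    cint (dy G) s = 0 := by
  unfold cint
  rw [intervalIntegral.integral_eq_sub_of_hasDerivAt
    (fun θ _ => slice_hasDeriv_im (diffAt_of (hp_open b) hG (mem_hp hs θ)))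
    (slice_int (cont_dy (hp_open b) hG) hs _ _)]
  have := hP (s + (-π : ℝ) * Complex.I)
  rw [← this]
  rw [sub_eq_zero]; congr 1; push_cast; ring

lemma cint_add {G H : ℂ → ℝ} {b s : ℝ} (hG : ContinuousOn G (hp b)) (hH : ContinuousOn H (hp b))
    (hs : s < b) : cint (fun z => G z + H z) s = cint G s + cint H s :=
  intervalIntegral.integral_add (slice_int hG hs _ _) (slice_int hH hs _ _)

lemma cint_sub {G H : ℂ → ℝ} {b s : ℝ} (hG : ContinuousOn G (hp b)) (hH : ContinuousOn H (hp b))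
    (hs : s < b) : cint (fun z => G z - H z) s = cint G s - cint H s :=
  intervalIntegral.integral_sub (slice_int hG hs _ _) (slice_int hH hs _ _)

lemma cint_mul (c : ℝ) (G : ℂ → ℝ) (s : ℝ) : cint (fun z => c * G z) s = c * cint G s :=
  intervalIntegral.integral_const_mul _ _

lemma cint_neg (G : ℂ → ℝ) (s : ℝ) : cint (fun z => - G z) s = - cint G s :=
  intervalIntegral.integral_neg

lemma cint_const (c : ℝ) (s : ℝ) : cint (fun _ => c) s = 2 * π * c := by
  simp only [cint, intervalIntegral.integral_const, smul_eq_mul]; ring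

lemma cint_congr {G H : ℂ → ℝ} {s : ℝ} (h : ∀ z : ℂ, z.re = s → G z = H z) :
    cint G s = cint H s := by
  unfold cint; congr 1; ext θ; exact h _ (by simp)

lemma cint_mono {G H : ℂ → ℝ} {b s : ℝ} (hG : ContinuousOn G (hp b)) (hH : ContinuousOn H (hp b))
    (hs : s < b) (h : ∀ z : ℂ, z.re = s → G z ≤ H z) : cint G s ≤ cint H s :=
  intervalIntegral.integral_mono_on (by linarith [pi_pos]) (slice_int hG hs _ _)
    (slice_int hH hs _ _) (fun θ _ => h _ (by simp))

lemma cint_nonneg {G : ℂ → ℝ} {s : ℝ} (h : ∀ z : ℂ, z.re = s → 0 ≤ G z) : 0 ≤ cint G s :=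
  intervalIntegral.integral_nonneg (by linarith [pi_pos]) (fun θ _ => h _ (by simp))

lemma cint_abs_le {G : ℂ → ℝ} {s c : ℝ} (h : ∀ z : ℂ, z.re = s → |G z| ≤ c) :
    |cint G s| ≤ 2 * π * c := by
  have := intervalIntegral.norm_integral_le_of_norm_le_const (a := -π) (b := π)
    (f := fun θ : ℝ => G (s + θ * Complex.I)) (C := c) (fun θ _ => h _ (by simp))
  rw [Real.norm_eq_abs] at this
  refine this.trans (le_of_eq ?_)
  rw [abs_of_pos (by linarith [pi_pos])]; ring

lemma cint_cont {G : ℂ → ℝ} {b : ℝ} (hG : ContinuousOn G (hp b)) :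
    ContinuousOn (cint G) (Set.Iio b) := by
  have h : ContinuousOn (Function.uncurry fun (s θ : ℝ) => G (s + θ * Complex.I))
      (Set.Iio b ×ˢ Set.univ) := by
    refine hG.comp (by fun_prop) ?_
    rintro ⟨a, t⟩ ⟨h1, _⟩
    exact mem_hp h1 t
  rw [continuousOn_iff_continuous_domRestrict]
  have : Continuous fun x : Set.Iio b => ∫ θ in (-π)..π, G ((x : ℝ) + θ * Complex.I) := by
    refine intervalIntegral.continuous_parametric_intervalIntegral_of_continuous' ?_ _ _
    rw [continuousOn_iff_continuous_domRestrict] at h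
    exact h.comp (f := fun q : Set.Iio b × ℝ => (⟨(q.1.1, q.2), ⟨q.1.2, trivial⟩⟩ :
      (Set.Iio b ×ˢ Set.univ : Set (ℝ × ℝ)))) (by fun_prop)
  exact this
/-! ### Part 2: log-polar coordinates, flux and mean values -/

lemma mono_of_deriv {b : ℝ} {f f' : ℝ → ℝ} (hf : ∀ s < b, HasDerivAt f (f' s) s)
    (hf' : ∀ s < b, 0 ≤ f' s) {s t : ℝ} (hst : s ≤ t) (ht : t < b) : f s ≤ f t := by
  have h : MonotoneOn f (Set.Iio b) := by
    refine monotoneOn_of_deriv_nonneg (convex_Iio b)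
      (fun s hs => (hf s hs).continuousAt.continuousWithinAt) ?_ ?_
    · intro s hs; rw [interior_Iio] at hs
      exact (hf s hs).differentiableAt.differentiableWithinAt
    · intro s hs; rw [interior_Iio] at hs
      rw [(hf s hs).deriv]; exact hf' s hs
  exact h (Set.mem_Iio.2 (lt_of_le_of_lt hst ht)) ht hst

lemma lim_le_of_deriv {b : ℝ} {f f' : ℝ → ℝ} {l : ℝ} (hf : ∀ s < b, HasDerivAt f (f' s) s)
    (hf' : ∀ s < b, 0 ≤ f' s) (hl : Tendsto f atBot (𝓝 l)) {s : ℝ} (hs : s < b) : l ≤ f s := by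
  refine le_of_tendsto hl ?_
  filter_upwards [eventually_le_atBot s] with t ht
  exact mono_of_deriv hf hf' ht hs

lemma eq_of_deriv_eq {b : ℝ} {f g f' : ℝ → ℝ} {l : ℝ} (hf : ∀ s < b, HasDerivAt f (f' s) s)
    (hg : ∀ s < b, HasDerivAt g (f' s) s) (hfl : Tendsto f atBot (𝓝 l))
    (hgl : Tendsto g atBot (𝓝 l)) {s : ℝ} (hs : s < b) : f s = g s := by
  have h1 := lim_le_of_deriv (f := fun s => f s - g s) (f' := fun _ => 0) (l := 0) (b := b)
    (fun s hs => by have := (hf s hs).fun_sub (hg s hs); rwa [sub_self] at this) (fun _ _ => le_rfl)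
    (by simpa using hfl.sub hgl) hs
  have h2 := lim_le_of_deriv (f := fun s => g s - f s) (f' := fun _ => 0) (l := 0) (b := b)
    (fun s hs => by have := (hg s hs).fun_sub (hf s hs); rwa [sub_self] at this) (fun _ _ => le_rfl)
    (by simpa using hgl.sub hfl) hs
  linarith

lemma psi_mem {p : ℂ} {b : ℝ} {z : ℂ} (hz : z ∈ hp b) :
    p + Complex.exp z ∈ ball p (Real.exp b) := by
  simp only [mem_ball, dist_self_add_left, Complex.norm_exp]
  exact Real.exp_lt_exp.2 hz

lemma cyl_contDiffOn {n : WithTop ℕ∞} {u : ℂ → ℝ} {p : ℂ} {b : ℝ}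
    (hu : ContDiffOn ℝ n u (ball p (Real.exp b))) :
    ContDiffOn ℝ n (cyl u p) (hp b) := by
  refine hu.comp ?_ (fun z hz => psi_mem hz)
  exact (contDiff_const.add (Complex.contDiff_exp)).contDiffOn

lemma cyl_continuousOn {u : ℂ → ℝ} {p : ℂ} {b : ℝ}
    (hu : ContinuousOn u (ball p (Real.exp b))) : ContinuousOn (cyl u p) (hp b) := by
  refine hu.comp ?_ (fun z hz => psi_mem hz)
  exact (continuous_const.add Complex.continuous_exp).continuousOn

lemma psi_hasFDerivAt (p z : ℂ) : HasFDerivAt (𝕜 := ℝ) (fun z => p + Complex.exp z)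
    (Complex.exp z • (1 : ℂ →L[ℝ] ℂ)) z := by
  have := ((Complex.hasDerivAt_exp z).complexToReal_fderiv).const_add p
  simpa using this

lemma fderiv_cyl {u : ℂ → ℝ} {p z : ℂ} (h : DifferentiableAt ℝ u (p + Complex.exp z)) (v : ℂ) :
    fderiv ℝ (cyl u p) z v = fderiv ℝ u (p + Complex.exp z) (Complex.exp z * v) := by
  have := h.hasFDerivAt.comp z (psi_hasFDerivAt p z)
  have h2 : fderiv ℝ (cyl u p) z = _ := this.fderiv
  rw [h2]; simp

lemma bilin_aux (B : ℂ →L[ℝ] ℂ →L[ℝ] ℝ) (e : ℂ) :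
    B e e + B (e * Complex.I) (e * Complex.I) =
      Complex.normSq e * (B 1 1 + B Complex.I Complex.I) := by
  have h1 : e = e.re • (1 : ℂ) + e.im • Complex.I := by
    apply Complex.ext <;> simp
  have h2 : e * Complex.I = (-e.im) • (1 : ℂ) + e.re • Complex.I := by
    apply Complex.ext <;> simp
  rw [h2, Complex.normSq_apply]
  generalize e.re = a at *
  generalize e.im = c at *
  rw [h1]
  simp only [map_add, map_smul, add_apply, smul_apply,
    smul_eq_mul]
  ring

lemma LL_cyl {u : ℂ → ℝ} {p : ℂ} {b : ℝ} (hu : ContDiffOn ℝ 2 u (ball p (Real.exp b))) {z : ℂ}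
    (hz : z ∈ hp b) :
    LL (cyl u p) z = Real.exp (2 * z.re) * LL u (p + Complex.exp z) := by
  have hmem : ∀ᶠ y in 𝓝 z, y ∈ hp b := (hp_open b).mem_nhds hz
  have hd : ∀ y ∈ hp b, DifferentiableAt ℝ u (p + Complex.exp y) := fun y hy =>
    diffAt_of isOpen_ball (hu.of_le (by norm_num)) (psi_mem hy)
  have hD : DifferentiableAt ℝ (fderiv ℝ u) (p + Complex.exp z) :=
    ((hu.contDiffAt (isOpen_ball.mem_nhds (psi_mem hz))).fderiv_right
      (m := 1) (by norm_num)).differentiableAt (by norm_num)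
  have hDc : HasFDerivAt (fun y => fderiv ℝ u (p + Complex.exp y))
    ((fderiv ℝ (fderiv ℝ u) (p + Complex.exp z)).comp (Complex.exp z • (1 : ℂ →L[ℝ] ℂ))) z :=
    hD.hasFDerivAt.comp z (psi_hasFDerivAt p z)
  have key : ∀ v : ℂ, fderiv ℝ (fun y => fderiv ℝ (cyl u p) y v) z v =
      fderiv ℝ (fderiv ℝ u) (p + Complex.exp z) (Complex.exp z * v) (Complex.exp z * v) +
      fderiv ℝ u (p + Complex.exp z) (Complex.exp z * v * v) := by
    intro v
    have he : (fun y => fderiv ℝ (cyl u p) y v) =ᶠ[𝓝 z]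
        fun y => fderiv ℝ u (p + Complex.exp y) (Complex.exp y * v) := by
      filter_upwards [hmem] with y hy using fderiv_cyl (hd y hy) v
    rw [he.fderiv_eq]
    have h2 : HasFDerivAt (𝕜 := ℝ) (fun y => Complex.exp y * v)
        ((Complex.exp z * v) • (1 : ℂ →L[ℝ] ℂ)) z := by
      have := ((Complex.hasDerivAt_exp z).mul_const v).complexToReal_fderiv
      simpa using this
    rw [(hDc.clm_apply h2).fderiv]
    simp
    ring
  have key2 : ∀ v : ℂ, fderiv ℝ (fun y => fderiv ℝ u y v) (p + Complex.exp z) v =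
      fderiv ℝ (fderiv ℝ u) (p + Complex.exp z) v v := by
    intro v
    rw [fderiv_clm_apply hD (by fun_prop)]
    simp
  have e1 : dx (dx (cyl u p)) z = _ := key 1
  have e2 : dy (dy (cyl u p)) z = _ := key Complex.I
  have e3 : dx (dx u) (p + Complex.exp z) = _ := key2 1
  have e4 : dy (dy u) (p + Complex.exp z) = _ := key2 Complex.I
  unfold LL
  rw [e1, e2, e3, e4]
  have hb := bilin_aux (fderiv ℝ (fderiv ℝ u) (p + Complex.exp z)) (Complex.exp z)
  have hn : Complex.normSq (Complex.exp z) = Real.exp (2 * z.re) := by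
    rw [Complex.normSq_eq_norm_sq, Complex.norm_exp, ← Real.exp_nat_mul]; norm_num
  rw [hn] at hb
  rw [← hb]
  have : Complex.exp z * Complex.I * Complex.I = - Complex.exp z := by
    rw [mul_assoc, Complex.I_mul_I]; ring
  rw [this]; simp; ring

/-- the end of the cylinder -/
def bot : Filter ℂ := comap Complex.re atBot

lemma exp_bot : Tendsto Complex.exp bot (𝓝 0) := Complex.tendsto_exp_comap_re_atBot

lemma cint_bot {G : ℂ → ℝ} {b g : ℝ} (hG : ContinuousOn G (hp b)) (h : Tendsto G bot (𝓝 g)) :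
    Tendsto (cint G) atBot (𝓝 (2 * π * g)) := by
  rw [Metric.tendsto_nhds]
  intro ε hε
  have h1 := (Metric.tendsto_nhds.1 h) (ε / (4 * π)) (by positivity)
  rw [bot, eventually_comap] at h1
  filter_upwards [h1, eventually_lt_atBot b] with s hs hsb
  rw [← cint_const g s, Real.dist_eq, ← cint_sub hG continuousOn_const hsb]
  have := cint_abs_le (G := fun z => G z - g) (s := s) (c := ε / (4 * π)) (fun z hz => by
    have := hs z hz; rw [Real.dist_eq] at this; exact this.le)
  refine lt_of_le_of_lt this ?_
  have : 2 * π * (ε / (4 * π)) = ε / 2 := by field_simp; ring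
  linarith

lemma cyl_bot {u : ℂ → ℝ} {p : ℂ} (hu : ContinuousAt u p) : Tendsto (cyl u p) bot (𝓝 (u p)) := by
  have h : Tendsto (fun z => p + Complex.exp z) bot (𝓝 p) := by
    simpa using (tendsto_const_nhds (x := p)).add exp_bot
  exact Tendsto.comp hu h

lemma bot_mem (b : ℝ) : ∀ᶠ z in bot, z ∈ hp b := by
  rw [bot, eventually_comap]
  filter_upwards [eventually_lt_atBot b] with s hs z hz
  simpa [hp, hz] using hs

lemma dcyl_bot {u : ℂ → ℝ} {p : ℂ} {b : ℝ} (hu : ContDiffOn ℝ 1 u (ball p (Real.exp b))) (v : ℂ) :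
    Tendsto (fun z => fderiv ℝ (cyl u p) z v) bot (𝓝 0) := by
  have hc : ContinuousAt (fderiv ℝ u) p :=
    (hu.continuousOn_fderiv_of_isOpen isOpen_ball (by norm_num)).continuousAt
      (isOpen_ball.mem_nhds (mem_ball_self (Real.exp_pos b)))
  have h : Tendsto (fun z => p + Complex.exp z) bot (𝓝 p) := by
    simpa using (tendsto_const_nhds (x := p)).add exp_bot
  have h2 : Tendsto (fun z => fderiv ℝ u (p + Complex.exp z)) bot (𝓝 (fderiv ℝ u p)) :=
    Tendsto.comp hc h
  have h3 : Tendsto (fun z => fderiv ℝ u (p + Complex.exp z) (Complex.exp z * v)) bot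
      (𝓝 (fderiv ℝ u p (0 * v))) :=
    (isBoundedBilinearMap_apply.continuous.tendsto (fderiv ℝ u p, 0 * v)).comp
      (h2.prodMk_nhds (exp_bot.mul_const v))
  simp only [zero_mul, map_zero] at h3
  refine h3.congr' ?_
  filter_upwards [bot_mem b] with z hz
  exact (fderiv_cyl (diffAt_of isOpen_ball hu (psi_mem hz)) v).symm

lemma cint_dxdx {F : ℂ → ℝ} {b s : ℝ} (hF : ContDiffOn ℝ 2 F (hp b)) (hs : s < b) (hP : Per F) :
    cint (dx (dx F)) s = cint (LL F) s := by
  have h1 := cint_dy (C1_dy (hp_open b) hF) hs hP.dy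
  have h2 := cint_add (cont_dx (hp_open b) (C1_dx (hp_open b) hF))
    (cont_dy (hp_open b) (C1_dy (hp_open b) hF)) hs
  have h3 : cint (LL F) s = cint (fun z => dx (dx F) z + dy (dy F) z) s := rfl
  rw [h3, h2, h1, add_zero]

/-- radial profile of a function around `p` -/
def rad (g : ℂ → ℝ) (p : ℂ) (t : ℝ) : ℝ :=
  ∫ θ in (-π)..π, t * g (p + t * Complex.exp (θ * Complex.I))

lemma rad_cont {g : ℂ → ℝ} {p : ℂ} {r : ℝ} (hg : ContinuousOn g (ball p r)) :
    ContinuousOn (rad g p) (Set.Ioo (-r) r) := by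
  have h : ContinuousOn (Function.uncurry fun (t θ : ℝ) =>
      t * g (p + t * Complex.exp (θ * Complex.I))) (Set.Ioo (-r) r ×ˢ Set.univ) := by
    refine ContinuousOn.mul (by fun_prop) (hg.comp (by fun_prop) ?_)
    rintro ⟨a, t⟩ ⟨h1, _⟩
    simpa [Complex.norm_exp_ofReal_mul_I, abs_lt] using h1
  rw [continuousOn_iff_continuous_domRestrict]
  have : Continuous fun x : Set.Ioo (-r) r => ∫ θ in (-π)..π,
      (x : ℝ) * g (p + (x : ℝ) * Complex.exp (θ * Complex.I)) := by
    refine intervalIntegral.continuous_parametric_intervalIntegral_of_continuous' ?_ _ _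
    rw [continuousOn_iff_continuous_domRestrict] at h
    exact h.comp (f := fun q : Set.Ioo (-r) r × ℝ => (⟨(q.1.1, q.2), ⟨q.1.2, trivial⟩⟩ :
      (Set.Ioo (-r) r ×ˢ Set.univ : Set (ℝ × ℝ)))) (by fun_prop)
  exact this

lemma ball_polar {g : ℂ → ℝ} {p : ℂ} {r r' : ℝ} (hg : ContinuousOn g (ball p r')) (h0 : 0 < r)
    (hr : r < r') : ∫ x in ball p r, g x = ∫ t in (0 : ℝ)..r, rad g p t := by
  rw [← integral_indicator measurableSet_ball]
  rw [← integral_add_left_eq_self (μ := volume) _ p]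
  rw [← Complex.integral_comp_polarCoord_symm]
  have ht : polarCoord.target = Set.Ioi (0 : ℝ) ×ˢ Set.Ioo (-π) π := rfl
  have hsymm : ∀ q : ℝ × ℝ, Complex.polarCoord.symm q = q.1 * Complex.exp (q.2 * Complex.I) := by
    intro q
    rw [Complex.polarCoord_symm_apply, Complex.exp_mul_I]
    push_cast; ring
  rw [ht]
  have hint : IntegrableOn (fun q : ℝ × ℝ => q.1 * g (p + q.1 * Complex.exp (q.2 * Complex.I)))
      (Set.Ioo 0 r ×ˢ Set.Ioo (-π) π) (volume.prod volume) := by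
    have hc : ContinuousOn (fun q : ℝ × ℝ => q.1 * g (p + q.1 * Complex.exp (q.2 * Complex.I)))
        (Set.Icc 0 r ×ˢ Set.Icc (-π) π) := by
      refine ContinuousOn.mul (by fun_prop) (hg.comp (by fun_prop) ?_)
      rintro ⟨a, t⟩ ⟨h1, _⟩
      have h2 : 0 ≤ a ∧ a ≤ r := h1
      simp [Complex.norm_exp_ofReal_mul_I, abs_of_nonneg h2.1]; linarith [h2.2]
    exact (hc.integrableOn_compact (isCompact_Icc.prod isCompact_Icc)).mono_set
      (Set.prod_mono Set.Ioo_subset_Icc_self Set.Ioo_subset_Icc_self)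
  have hstep : ∫ q in Set.Ioi (0 : ℝ) ×ˢ Set.Ioo (-π) π,
      q.1 • (ball p r).indicator g (p + Complex.polarCoord.symm q) =
      ∫ q in Set.Ioo (0 : ℝ) r ×ˢ Set.Ioo (-π) π,
        q.1 * g (p + q.1 * Complex.exp (q.2 * Complex.I)) := by
    have hsub : Set.Ioo (0 : ℝ) r ×ˢ Set.Ioo (-π) π ⊆ Set.Ioi (0 : ℝ) ×ˢ Set.Ioo (-π) π :=
      Set.prod_mono (fun x hx => hx.1) subset_rfl
    refine (setIntegral_eq_of_subset_of_forall_sdiff_eq_zero (μ := volume)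
      (f := fun q : ℝ × ℝ => q.1 • (ball p r).indicator g (p + Complex.polarCoord.symm q))
      (measurableSet_Ioi.prod measurableSet_Ioo) hsub ?_).trans ?_
    rotate_left
    · refine setIntegral_congr_fun (measurableSet_Ioo.prod measurableSet_Ioo) ?_
      rintro ⟨a, t⟩ ⟨h1, _⟩
      have h2 : 0 < a ∧ a < r := h1
      simp only [hsymm, smul_eq_mul]
      rw [Set.indicator_of_mem]
      simp [Complex.norm_exp_ofReal_mul_I, abs_of_pos h2.1, h2.2]
    · rintro ⟨a, t⟩ ⟨⟨h1, h3⟩, h2⟩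
      have h1' : 0 < a := h1
      have h2' : r ≤ a := by
        by_contra hcon
        exact h2 ⟨⟨h1', not_le.1 hcon⟩, h3⟩
      simp only [hsymm]
      rw [Set.indicator_of_notMem, smul_zero]
      simp [Complex.norm_exp_ofReal_mul_I, abs_of_pos h1', h2']
  rw [hstep, Measure.volume_eq_prod, setIntegral_prod _ hint,
    intervalIntegral.integral_of_le h0.le, integral_Ioc_eq_integral_Ioo]
  refine setIntegral_congr_fun measurableSet_Ioo ?_
  intro t _
  simp only [rad]
  rw [intervalIntegral.integral_of_le (by linarith [pi_pos]), integral_Ioc_eq_integral_Ioo]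

lemma ball_deriv {g : ℂ → ℝ} {p : ℂ} {b : ℝ} (hg : ContinuousOn g (ball p (Real.exp b))) {s : ℝ}
    (hs : s < b) : HasDerivAt (fun s => ∫ x in ball p (Real.exp s), g x)
      (Real.exp (2 * s) * cint (cyl g p) s) s := by
  have hc := rad_cont hg
  have hes : Real.exp s < Real.exp b := Real.exp_lt_exp.2 hs
  have hp0 := Real.exp_pos s
  have h1 : HasDerivAt (fun r => ∫ t in (0 : ℝ)..r, rad g p t) (rad g p (Real.exp s))
      (Real.exp s) := by
    have hopen : Set.Ioo (-Real.exp b) (Real.exp b) ∈ 𝓝 (Real.exp s) :=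
      Ioo_mem_nhds (by linarith) hes
    refine intervalIntegral.integral_hasDerivAt_right ?_ ?_ (hc.continuousAt hopen)
    · refine (hc.mono ?_).intervalIntegrable
      rw [Set.uIcc_of_le hp0.le]
      exact fun x hx => ⟨by linarith [hx.1], by linarith [hx.2]⟩
    · exact hc.stronglyMeasurableAtFilter isOpen_Ioo _ ⟨by linarith, hes⟩
  have h2 := h1.comp s (Real.hasDerivAt_exp s)
  have h3 : rad g p (Real.exp s) * Real.exp s = Real.exp (2 * s) * cint (cyl g p) s := by
    unfold rad cint cyl
    rw [intervalIntegral.integral_const_mul, two_mul, Real.exp_add]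
    have : ∀ θ : ℝ, (Real.exp s : ℂ) * Complex.exp (θ * Complex.I) =
        Complex.exp (s + θ * Complex.I) := by
      intro θ; rw [Complex.exp_add]; push_cast; rfl
    simp only [this]; ring
  rw [← h3]
  refine h2.congr_of_eventuallyEq ?_
  filter_upwards [Iio_mem_nhds hs] with t ht
  exact ball_polar hg (Real.exp_pos t) (Real.exp_lt_exp.2 ht)

lemma ball_bot {g : ℂ → ℝ} {p : ℂ} {b : ℝ} (hg : ContinuousOn g (ball p (Real.exp b))) :
    Tendsto (fun s => ∫ x in ball p (Real.exp s), g x) atBot (𝓝 0) := by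
  have hc := rad_cont hg
  have hb0 := Real.exp_pos b
  have h1 : ContinuousAt (fun r => ∫ t in (0 : ℝ)..r, rad g p t) 0 := by
    have hopen : Set.Ioo (-Real.exp b) (Real.exp b) ∈ 𝓝 (0 : ℝ) :=
      Ioo_mem_nhds (by linarith) hb0
    exact (intervalIntegral.integral_hasDerivAt_right (by simp)
      (hc.stronglyMeasurableAtFilter isOpen_Ioo _ ⟨by linarith, hb0⟩)
      (hc.continuousAt hopen)).continuousAt
  have h2 : Tendsto (fun s => ∫ t in (0 : ℝ)..Real.exp s, rad g p t) atBot (𝓝 0) := by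
    have := h1.tendsto.comp Real.tendsto_exp_atBot
    simpa [Function.comp_def] using this
  refine h2.congr' ?_
  filter_upwards [eventually_lt_atBot b] with t ht
  exact (ball_polar hg (Real.exp_pos t) (Real.exp_lt_exp.2 ht)).symm

lemma cint_LL_cyl {u : ℂ → ℝ} {p : ℂ} {b s : ℝ} (hu : ContDiffOn ℝ 2 u (ball p (Real.exp b)))
    (hs : s < b) : cint (LL (cyl u p)) s = Real.exp (2 * s) * cint (cyl (LL u) p) s := by
  rw [← cint_mul]
  refine cint_congr fun z hz => ?_
  rw [LL_cyl hu (by simp [hp, hz, hs]), hz]; rfl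

lemma flux_deriv {u : ℂ → ℝ} {p : ℂ} {b s : ℝ} (hu : ContDiffOn ℝ 2 u (ball p (Real.exp b)))
    (hs : s < b) : HasDerivAt (cint (dx (cyl u p))) (cint (LL (cyl u p)) s) s := by
  have h := cyl_contDiffOn hu
  rw [← cint_dxdx h hs (cyl_per u p)]
  exact cint_deriv (C1_dx (hp_open b) h) hs

lemma flux_bot {u : ℂ → ℝ} {p : ℂ} {b : ℝ} (hu : ContDiffOn ℝ 2 u (ball p (Real.exp b))) :
    Tendsto (cint (dx (cyl u p))) atBot (𝓝 0) := by
  have h := cint_bot (cont_dx (hp_open b) ((cyl_contDiffOn hu).of_le (by norm_num)))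
    (dcyl_bot (hu.of_le (by norm_num)) 1)
  simpa using h

lemma flux_eq {u : ℂ → ℝ} {p : ℂ} {b s : ℝ} (hu : ContDiffOn ℝ 2 u (ball p (Real.exp b)))
    (hs : s < b) : cint (dx (cyl u p)) s = ∫ x in ball p (Real.exp s), LL u x := by
  refine eq_of_deriv_eq (b := b) (fun s hs => flux_deriv hu hs) (fun s hs => ?_) (flux_bot hu)
    (ball_bot (cont_LL isOpen_ball hu)) hs
  rw [cint_LL_cyl hu hs]
  exact ball_deriv (cont_LL isOpen_ball hu) hs

/-- circle mean value inequality -/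
lemma mv_circle {u : ℂ → ℝ} {p : ℂ} {b κ : ℝ} (hu : ContDiffOn ℝ 2 u (ball p (Real.exp b)))
    (hL : ∀ x ∈ ball p (Real.exp b), -κ ≤ LL u x) {s : ℝ} (hs : s < b) :
    2 * π * u p ≤ cint (cyl u p) s + π / 2 * κ * Real.exp (2 * s) := by
  have hexp : ∀ s : ℝ, HasDerivAt (fun s : ℝ => Real.exp (2 * s)) (2 * Real.exp (2 * s)) s := by
    intro s
    have := ((hasDerivAt_id s).const_mul 2).exp
    simpa [mul_comm] using this
  have hexp0 : Tendsto (fun s : ℝ => Real.exp (2 * s)) atBot (𝓝 0) :=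
    Real.tendsto_exp_atBot.comp (tendsto_id.const_mul_atBot (by norm_num))
  have hc := cyl_contDiffOn hu
  have hZ : ∀ s < b, 0 ≤ cint (dx (cyl u p)) s + π * κ * Real.exp (2 * s) := by
    intro s hs
    refine lim_le_of_deriv (b := b) (f := fun s => cint (dx (cyl u p)) s + π * κ * Real.exp (2 * s))
      (f' := fun s => cint (LL (cyl u p)) s + π * κ * (2 * Real.exp (2 * s)))
      (fun s hs => (flux_deriv hu hs).add ((hexp s).const_mul _)) ?_ ?_ hs
    · intro s hs
      rw [cint_LL_cyl hu hs]
      have h1 : cint (fun _ => -κ) s ≤ cint (cyl (LL u) p) s := by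
        refine cint_mono continuousOn_const (cyl_continuousOn (cont_LL isOpen_ball hu)) hs ?_
        intro z hz
        exact hL _ (psi_mem (by simp [hp, hz, hs]))
      rw [cint_const] at h1
      nlinarith [Real.exp_pos (2 * s)]
    · simpa using (flux_bot hu).add (hexp0.const_mul (π * κ))
  have h := lim_le_of_deriv (b := b) (f := fun s => cint (cyl u p) s + π / 2 * κ * Real.exp (2 * s))
      (f' := fun s => cint (dx (cyl u p)) s + π / 2 * κ * (2 * Real.exp (2 * s)))
      (l := 2 * π * u p)
      (fun s hs => (cint_deriv (hc.of_le (by norm_num)) hs).add ((hexp s).const_mul _)) ?_ ?_ hs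
  · exact h
  · intro s hs; have := hZ s hs; linarith
  · have h1 := cint_bot hc.continuousOn (cyl_bot (u := u) (p := p)
      (hu.continuousOn.continuousAt (isOpen_ball.mem_nhds (mem_ball_self (Real.exp_pos b)))))
    simpa using h1.add (hexp0.const_mul (π / 2 * κ))

/-- disc mean value inequality -/
lemma mv_disc {u : ℂ → ℝ} {p : ℂ} {b κ : ℝ} (hu : ContDiffOn ℝ 2 u (ball p (Real.exp b)))
    (hL : ∀ x ∈ ball p (Real.exp b), -κ ≤ LL u x) {s : ℝ} (hs : s < b) :
    π * Real.exp (2 * s) * u p ≤ (∫ x in ball p (Real.exp s), u x) +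
      π / 8 * κ * Real.exp (4 * s) := by
  have hexp : ∀ (c s : ℝ), HasDerivAt (fun s : ℝ => Real.exp (c * s)) (c * Real.exp (c * s)) s := by
    intro c s
    have := ((hasDerivAt_id s).const_mul c).exp
    simpa [mul_comm] using this
  have hexp0 : ∀ c : ℝ, 0 < c → Tendsto (fun s : ℝ => Real.exp (c * s)) atBot (𝓝 0) := fun c hc =>
    Real.tendsto_exp_atBot.comp (tendsto_id.const_mul_atBot hc)
  have h := lim_le_of_deriv (b := b) (f := fun s => (∫ x in ball p (Real.exp s), u x) +
      π / 8 * κ * Real.exp (4 * s) - π * u p * Real.exp (2 * s))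
      (f' := fun s => Real.exp (2 * s) * cint (cyl u p) s + π / 8 * κ * (4 * Real.exp (4 * s))
        - π * u p * (2 * Real.exp (2 * s)))
      (l := 0)
      (fun s hs => ((ball_deriv hu.continuousOn hs).add ((hexp 4 s).const_mul _)).sub
        ((hexp 2 s).const_mul _)) ?_ ?_ hs
  · linarith
  · intro s hs
    have h1 := mv_circle hu hL hs
    have h4 : Real.exp (4 * s) = Real.exp (2 * s) * Real.exp (2 * s) := by
      rw [← Real.exp_add]; ring_nf
    rw [h4]
    nlinarith [Real.exp_pos (2 * s)]
  · simpa using ((ball_bot hu.continuousOn).add ((hexp0 4 (by norm_num)).const_mul _)).sub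
      ((hexp0 2 (by norm_num)).const_mul (π * u p))
/-! ### Part 3: energies on the cylinder -/

lemma dx_sq {u : ℂ → ℝ} {z : ℂ} (hu : DifferentiableAt ℝ u z) :
    dx (fun z => u z ^ 2) z = 2 * (u z * dx u z) := by
  have := dx_mul hu hu
  simp only [pow_two]; rw [this]; ring

lemma dy_sq {u : ℂ → ℝ} {z : ℂ} (hu : DifferentiableAt ℝ u z) :
    dy (fun z => u z ^ 2) z = 2 * (u z * dy u z) := by
  have := dy_mul hu hu
  simp only [pow_two]; rw [this]; ring

lemma pohozaev {F : ℂ → ℝ} {b s : ℝ} (hF : ContDiffOn ℝ 2 F (hp b)) (hs : s < b) (hP : Per F) :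
    HasDerivAt (cint fun z => dx F z ^ 2 - dy F z ^ 2) (2 * cint (fun z => dx F z * LL F z) s) s := by
  have hx := C1_dx (hp_open b) hF
  have hy := C1_dy (hp_open b) hF
  have h := cint_deriv ((hx.pow 2).sub (hy.pow 2)) hs
  convert h using 1
  have hxy : ContDiffOn ℝ 1 (fun z => dx F z * dy F z) (hp b) := hx.mul hy
  have h0 := cint_dy hxy hs (hP.dx.mul hP.dy)
  have e1 : cint (dx fun z => dx F z ^ 2 - dy F z ^ 2) s =
      cint (fun z => 2 * (dx F z * LL F z) - 2 * dy (fun z => dx F z * dy F z) z) s := by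
    refine cint_congr fun z hz => ?_
    have hz' : z ∈ hp b := by simp [hp, hz, hs]
    have d1 := diffAt_of (hp_open b) hx hz'
    have d2 := diffAt_of (hp_open b) hy hz'
    rw [dx_sub (u := fun z => dx F z ^ 2) (v := fun z => dy F z ^ 2) (d1.fun_pow 2) (d2.fun_pow 2), dx_sq d1, dx_sq d2, dy_mul d1 d2,
      dxdy_comm (hp_open b) hF hz', LL]
    ring
  have hc := hx.continuousOn.mul (cont_LL (hp_open b) hF)
  have e2 := cint_sub (G := fun z => 2 * (dx F z * LL F z))
    (H := fun z => 2 * dy (fun z => dx F z * dy F z) z)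
    (continuousOn_const.mul hc) (continuousOn_const.mul (cont_dy (hp_open b) hxy)) hs
  refine Eq.trans ?_ e1.symm
  rw [e2, cint_mul, cint_mul, h0]; ring

lemma cint_var {G : ℂ → ℝ} {b s : ℝ} (hG : ContinuousOn G (hp b)) (hs : s < b) (c : ℝ) :
    cint (fun z => (G z - c) ^ 2) s = cint (fun z => G z ^ 2) s - 2 * c * cint G s
      + 2 * π * c ^ 2 := by
  have h1 : cint (fun z => (G z - c) ^ 2) s =
      cint (fun z => (G z ^ 2 - 2 * c * G z) + c ^ 2) s := cint_congr fun z _ => by ring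
  have h2 : ContinuousOn (fun z => G z ^ 2) (hp b) := hG.pow 2
  have h3 : ContinuousOn (fun z => 2 * c * G z) (hp b) := continuousOn_const.mul hG
  rw [h1, cint_add (G := fun z => G z ^ 2 - 2 * c * G z) (h2.sub h3) continuousOn_const hs,
    cint_sub h2 h3 hs, cint_mul, cint_const]

/-- variance on circles -/
def EE (F : ℂ → ℝ) (s : ℝ) : ℝ := cint (fun z => F z ^ 2) s - cint F s ^ 2 / (2 * π)
def EE1 (F : ℂ → ℝ) (s : ℝ) : ℝ := 2 * cint (fun z => F z * dx F z) s - cint F s * cint (dx F) s / π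
def EE2 (F : ℂ → ℝ) (s : ℝ) : ℝ :=
  2 * (cint (fun z => dx F z ^ 2) s + cint (fun z => dy F z ^ 2) s + cint (fun z => F z * LL F z) s)
    - (cint (dx F) s ^ 2 + cint F s * cint (LL F) s) / π

lemma EE_eq {G : ℂ → ℝ} {b s : ℝ} (hG : ContinuousOn G (hp b)) (hs : s < b) :
    EE G s = cint (fun z => (G z - cint G s / (2 * π)) ^ 2) s := by
  rw [cint_var hG hs, EE]; field_simp; ring

lemma EE_nonneg {G : ℂ → ℝ} {b s : ℝ} (hG : ContinuousOn G (hp b)) (hs : s < b) : 0 ≤ EE G s := by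
  rw [EE_eq hG hs]; exact cint_nonneg fun z _ => sq_nonneg _

lemma EE_le {G : ℂ → ℝ} {b s : ℝ} (hG : ContinuousOn G (hp b)) (hs : s < b) (c : ℝ) :
    EE G s ≤ cint (fun z => (G z - c) ^ 2) s := by
  rw [cint_var hG hs, EE]
  have : 0 ≤ (cint G s - 2 * π * c) ^ 2 / (2 * π) := by positivity
  have e : (cint G s - 2 * π * c) ^ 2 / (2 * π) =
    cint G s ^ 2 / (2 * π) - 2 * c * cint G s + 2 * π * c ^ 2 := by field_simp; ring
  linarith

lemma EE_deriv {F : ℂ → ℝ} {b s : ℝ} (hF : ContDiffOn ℝ 2 F (hp b)) (hs : s < b) :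
    HasDerivAt (EE F) (EE1 F s) s := by
  have h1 : ContDiffOn ℝ 1 F (hp b) := hF.of_le (by norm_num)
  have hd := ((cint_deriv (h1.pow 2) hs).fun_sub (((cint_deriv h1 hs).fun_pow 2).div_const (2 * π)))
  have e : cint (dx fun z => F z ^ 2) s = 2 * cint (fun z => F z * dx F z) s := by
    rw [← cint_mul]
    exact cint_congr fun z hz => dx_sq (diffAt_of (hp_open b) h1 (by simp [hp, hz, hs]))
  have hd' := hd.congr_deriv (g' := EE1 F s) (by
    rw [EE1, ← e]; simp only [pow_one, Nat.cast_ofNat, Nat.add_one_sub_one]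
    field_simp
    try ring)
  exact hd'

lemma EE1_deriv {F : ℂ → ℝ} {b s : ℝ} (hF : ContDiffOn ℝ 2 F (hp b)) (hs : s < b) (hP : Per F) :
    HasDerivAt (EE1 F) (EE2 F s) s := by
  have h1 : ContDiffOn ℝ 1 F (hp b) := hF.of_le (by norm_num)
  have hx := C1_dx (hp_open b) hF
  have hy := C1_dy (hp_open b) hF
  have hd := (((cint_deriv (h1.mul hx) hs).const_mul 2).fun_sub
    (((cint_deriv h1 hs).fun_mul (cint_deriv hx hs)).div_const π))
  have hFy : ContDiffOn ℝ 1 (fun z => F z * dy F z) (hp b) := h1.mul hy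
  have h0 := cint_dy hFy hs (hP.mul hP.dy)
  have hcx : ContinuousOn (fun z => dx F z ^ 2) (hp b) := hx.continuousOn.pow 2
  have hcy : ContinuousOn (fun z => dy F z ^ 2) (hp b) := hy.continuousOn.pow 2
  have hcL : ContinuousOn (fun z => F z * LL F z) (hp b) :=
    h1.continuousOn.mul (cont_LL (hp_open b) hF)
  have e : cint (dx fun z => F z * dx F z) s = cint (fun z => dx F z ^ 2) s
      + cint (fun z => dy F z ^ 2) s + cint (fun z => F z * LL F z) s := by
    have e1 : cint (dx fun z => F z * dx F z) s =
        cint (fun z => dx F z ^ 2 + dy F z ^ 2 + F z * LL F z - dy (fun z => F z * dy F z) z) s := by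
      refine cint_congr fun z hz => ?_
      have hz' : z ∈ hp b := by simp [hp, hz, hs]
      have d0 := diffAt_of (hp_open b) h1 hz'
      rw [dx_mul d0 (diffAt_of (hp_open b) hx hz'), dy_mul d0 (diffAt_of (hp_open b) hy hz'), LL]
      ring
    rw [e1, cint_sub (G := fun z => dx F z ^ 2 + dy F z ^ 2 + F z * LL F z) ((hcx.add hcy).add hcL)
      (cont_dy (hp_open b) hFy) hs, h0,
      cint_add (G := fun z => dx F z ^ 2 + dy F z ^ 2) (hcx.add hcy) hcL hs,
      cint_add hcx hcy hs]; ring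
  refine hd.congr_deriv ?_
  rw [e, cint_dxdx hF hs hP, EE2]; ring

lemma poincare {F : ℂ → ℝ} {b s : ℝ} (hF : ContDiffOn ℝ 1 F (hp b)) (hs : s < b) :
    EE F s ≤ 4 * π ^ 2 * cint (fun z => dy F z ^ 2) s := by
  have hc := hF.continuousOn
  have hy := cont_dy (hp_open b) hF
  refine (EE_le hc hs (F (s + ((-π : ℝ) : ℂ) * Complex.I))).trans ?_
  have hcs := EE_nonneg (G := fun z => |dy F z|) hy.abs hs
  have hB : 0 ≤ cint (fun z => |dy F z|) s := cint_nonneg fun z _ => abs_nonneg _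
  simp only [EE, sq_abs] at hcs
  have hcs' : cint (fun z => |dy F z|) s ^ 2 ≤ 2 * π * cint (fun z => dy F z ^ 2) s := by
    have := pi_pos
    rw [sub_nonneg, div_le_iff₀ (by positivity)] at hcs; linarith
  have key : ∀ θ ∈ Set.Icc (-π) π, (F (s + θ * Complex.I) - F (s + ((-π : ℝ) : ℂ) * Complex.I)) ^ 2 ≤
      2 * π * cint (fun z => dy F z ^ 2) s := by
    intro θ hθ
    have h1 := intervalIntegral.integral_eq_sub_of_hasDerivAt (a := -π) (b := θ)
      (fun θ _ => slice_hasDeriv_im (diffAt_of (hp_open b) hF (mem_hp hs θ))) (slice_int hy hs _ _)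
    refine le_trans ?_ hcs'
    rw [← h1, ← sq_abs]
    gcongr
    refine (intervalIntegral.abs_integral_le_integral_abs hθ.1).trans ?_
    refine intervalIntegral.integral_mono_interval le_rfl hθ.1 hθ.2 ?_ (slice_int hy.abs hs _ _)
    exact Eventually.of_forall fun _ => abs_nonneg _
  have hmono : cint (fun z => (F z - F (s + ((-π : ℝ) : ℂ) * Complex.I)) ^ 2) s ≤
      cint (fun _ => 2 * π * cint (fun z => dy F z ^ 2) s) s :=
    intervalIntegral.integral_mono_on (by linarith [pi_pos])
      (slice_int ((hc.sub continuousOn_const).pow 2) hs _ _) (by simp) key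
  rw [cint_const] at hmono
  linarith

/-- the defect in `dx` -/
def DD (F : ℂ → ℝ) (s : ℝ) : ℝ := EE (dx F) s

lemma EE2_lower {F : ℂ → ℝ} {b s κ : ℝ} (hF : ContDiffOn ℝ 2 F (hp b)) (hs : s < b)
    (hκ : ∀ z : ℂ, z.re = s → |LL F z| ≤ κ) :
    2 * DD F s + cint (fun z => dy F z ^ 2) s - 8 * π ^ 3 * κ ^ 2 ≤ EE2 F s := by
  have h1 : ContDiffOn ℝ 1 F (hp b) := hF.of_le (by norm_num)
  have hpo := poincare h1 hs
  have hc := h1.continuousOn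
  have hL := cont_LL (hp_open b) hF
  set A := cint F s / (2 * π) with hA
  have hpi := pi_pos
  have hFL : ContinuousOn (fun z => F z * LL F z) (hp b) := hc.mul hL
  have e : cint (fun z => (F z - A) * LL F z) s = cint (fun z => F z * LL F z) s
      - A * cint (LL F) s := by
    rw [← cint_mul, ← cint_sub (H := fun z => A * LL F z) hFL (continuousOn_const.mul hL) hs]
    exact cint_congr fun z _ => by ring
  have hlow : cint (fun z => (-(1 / (4 * π ^ 2))) * (F z - A) ^ 2 - 4 * π ^ 2 * κ ^ 2) s ≤
      cint (fun z => 2 * ((F z - A) * LL F z)) s := by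
    have hs2 : ContinuousOn (fun z => (F z - A) ^ 2) (hp b) := (hc.sub continuousOn_const).pow 2
    refine cint_mono ((continuousOn_const.mul hs2).sub continuousOn_const)
      (continuousOn_const.mul ((hc.sub continuousOn_const).mul hL)) hs fun z hz => ?_
    have hk := hκ z hz
    have hk2 : LL F z ^ 2 ≤ κ ^ 2 := by
      rw [← sq_abs]; gcongr
    have : 0 ≤ ((F z - A) / (2 * π) + 2 * π * LL F z) ^ 2 := sq_nonneg _
    have e2 : ((F z - A) / (2 * π) + 2 * π * LL F z) ^ 2 = 1 / (4 * π ^ 2) * (F z - A) ^ 2 +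
      2 * ((F z - A) * LL F z) + 4 * π ^ 2 * LL F z ^ 2 := by field_simp; ring
    have : 4 * π ^ 2 * LL F z ^ 2 ≤ 4 * π ^ 2 * κ ^ 2 := by gcongr
    linarith
  have hs2 : ContinuousOn (fun z => (-(1 / (4 * π ^ 2))) * (F z - A) ^ 2) (hp b) :=
    continuousOn_const.mul ((hc.sub continuousOn_const).pow 2)
  rw [cint_sub hs2 continuousOn_const hs, cint_mul, cint_const, cint_mul 2, ← EE_eq hc hs, e] at hlow
  have h3 : 1 / (4 * π ^ 2) * EE F s ≤ cint (fun z => dy F z ^ 2) s := by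
    rw [div_mul_eq_mul_div, one_mul, div_le_iff₀ (by positivity)]; linarith
  have e4 : EE2 F s = 2 * DD F s + 2 * cint (fun z => dy F z ^ 2) s
      + 2 * (cint (fun z => F z * LL F z) s - A * cint (LL F) s) := by
    rw [EE2, DD, EE, hA]; field_simp; ring
  rw [e4]; linarith

lemma DD_nonneg {F : ℂ → ℝ} {b s : ℝ} (hF : ContDiffOn ℝ 1 F (hp b)) (hs : s < b) :
    0 ≤ DD F s := EE_nonneg (cont_dx (hp_open b) hF) hs

lemma EE2_lower2 {F : ℂ → ℝ} {b s κ : ℝ} (hF : ContDiffOn ℝ 2 F (hp b)) (hs : s < b)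
    (hκ : ∀ z : ℂ, z.re = s → |LL F z| ≤ κ) :
    (1 / (2 * π)) ^ 2 * EE F s - 8 * π ^ 3 * κ ^ 2 ≤ EE2 F s := by
  have h1 : ContDiffOn ℝ 1 F (hp b) := hF.of_le (by norm_num)
  have h := EE2_lower hF hs hκ
  have hpo := poincare h1 hs
  have hD := DD_nonneg h1 hs
  have h3 : (1 / (2 * π)) ^ 2 * EE F s ≤ cint (fun z => dy F z ^ 2) s := by
    have hpi := pi_pos
    have : (1 / (2 * π)) ^ 2 * EE F s = EE F s / (4 * π ^ 2) := by field_simp; ring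
    rw [this, div_le_iff₀ (by positivity)]; linarith
  linarith

lemma no_neg_min {g g1 g2 : ℝ → ℝ} {x : ℝ} (h1 : ∀ᶠ s in 𝓝 x, HasDerivAt g (g1 s) s)
    (h2 : HasDerivAt g1 (g2 x) x) (hmin : IsLocalMin g x) : 0 ≤ g2 x := by
  by_contra hcon
  push Not at hcon
  have e1 : deriv g =ᶠ[𝓝 x] g1 := h1.mono fun s hs => hs.deriv
  have e2 : deriv (deriv g) x = g2 x := by rw [e1.deriv_eq]; exact h2.deriv
  have e0 : deriv g x = 0 := hmin.deriv_eq_zero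
  have hmax : IsLocalMax g x := isLocalMax_of_deriv_deriv_neg (by rw [e2]; exact hcon) e0
    h1.self_of_nhds.continuousAt
  have hc : g =ᶠ[𝓝 x] fun _ => g x := by
    filter_upwards [hmin, hmax] with y h1 h2 using le_antisymm h2 h1
  have hc2 : deriv g =ᶠ[𝓝 x] fun _ => 0 := by
    refine hc.deriv.trans ?_
    simp
  have : deriv (deriv g) x = 0 := by rw [hc2.deriv_eq]; simp
  linarith

lemma comparison {E E1 E2 : ℝ → ℝ} {a b c K : ℝ}
    (h1 : ∀ s ∈ Set.Icc a b, HasDerivAt E (E1 s) s) (h2 : ∀ s ∈ Set.Icc a b, HasDerivAt E1 (E2 s) s)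
    (hE : ∀ s ∈ Set.Icc a b, c ^ 2 * E s - K ≤ E2 s) (hK : 0 ≤ K) (hc : 0 < c) (ha : 0 ≤ E a)
    (hb : 0 ≤ E b) {s : ℝ} (hs : s ∈ Set.Icc a b) :
    E s ≤ K / c ^ 2 + E a * Real.exp (-c * (s - a)) + E b * Real.exp (-c * (b - s)) := by
  have hab : a ≤ b := hs.1.trans hs.2
  let h : ℝ → ℝ := fun s => K / c ^ 2 + E a * Real.exp (-c * (s - a)) + E b * Real.exp (-c * (b - s))
  let hd : ℝ → ℝ := fun s => E a * (Real.exp (-c * (s - a)) * (-c)) + E b * (Real.exp (-c * (b - s)) * c)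
  let hdd : ℝ → ℝ := fun s => E a * (Real.exp (-c * (s - a)) * (-c) * (-c)) +
    E b * (Real.exp (-c * (b - s)) * c * c)
  have x1 : ∀ s, HasDerivAt (fun s => Real.exp (-c * (s - a))) (Real.exp (-c * (s - a)) * (-c)) s := by
    intro s
    have := (((hasDerivAt_id s).sub_const a).const_mul (-c)).exp
    simpa using this
  have x2 : ∀ s, HasDerivAt (fun s => Real.exp (-c * (b - s))) (Real.exp (-c * (b - s)) * c) s := by
    intro s
    have := (((hasDerivAt_id s).const_sub b).const_mul (-c)).exp
    simpa using this
  have y1 : ∀ s, HasDerivAt h (hd s) s := by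
    intro s
    exact (((x1 s).const_mul (E a)).const_add (K / c ^ 2)).fun_add ((x2 s).const_mul (E b))
  have y2 : ∀ s, HasDerivAt hd (hdd s) s := by
    intro s
    exact (((x1 s).mul_const (-c)).const_mul (E a)).fun_add (((x2 s).mul_const c).const_mul (E b))
  obtain ⟨x, hx, hxm⟩ := isCompact_Icc.exists_isMinOn ⟨s, hs⟩
    (f := fun s => h s - E s) (fun s hs => ((y1 s).fun_sub (h1 s hs)).continuousAt.continuousWithinAt)
  suffices hsuff : 0 ≤ h x - E x by
    have := hxm hs
    simp only [Set.mem_ofPred_eq] at this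
    have h5 : 0 ≤ h s - E s := hsuff.trans this
    simpa [h] using h5
  by_contra hcon
  push Not at hcon
  have hKc : 0 ≤ K / c ^ 2 := by positivity
  have hxa : a < x := by
    refine lt_of_le_of_ne hx.1 ?_
    rintro rfl
    have : 0 ≤ E b * Real.exp (-c * (b - a)) := by positivity
    simp only [h, sub_self, mul_zero, Real.exp_zero, mul_one] at hcon; linarith
  have hxb : x < b := by
    refine lt_of_le_of_ne hx.2 ?_
    rintro rfl
    have : 0 ≤ E a * Real.exp (-c * (x - a)) := by positivity
    simp only [h, sub_self, mul_zero, Real.exp_zero, mul_one] at hcon; linarith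
  have hnh : Set.Icc a b ∈ 𝓝 x := Icc_mem_nhds hxa hxb
  have h7 := no_neg_min (g := fun s => h s - E s) (g1 := fun s => hd s - E1 s)
    (g2 := fun s => hdd s - E2 s) (x := x)
    (by filter_upwards [hnh] with s hs using (y1 s).fun_sub (h1 s hs))
    ((y2 x).fun_sub (h2 x hx)) (hxm.isLocalMin hnh)
  have e : hdd x = c ^ 2 * h x - K := by
    simp only [hdd, h]; field_simp; ring
  have := hE x hx
  rw [e] at h7
  nlinarith [sq_nonneg c, pow_pos hc 2]

lemma exists_small_second {E E1 E2 : ℝ → ℝ} {m B τ : ℝ}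
    (h1 : ∀ s ∈ Set.Icc (m - 1) (m + 1), HasDerivAt E (E1 s) s)
    (h2 : ∀ s ∈ Set.Icc (m - 1) (m + 1), HasDerivAt E1 (E2 s) s)
    (h0 : 0 ≤ E m) (hB : ∀ s ∈ Set.Icc (m - 1) (m + 1), E s ≤ B) (hτ : 0 < τ) :
    ∃ s ∈ Set.Icc (m - 1) (m + 1), E2 s ≤ 2 * B + τ := by
  by_contra hcon
  push Not at hcon
  let q : ℝ := 2 * B + τ
  have x1 : ∀ s ∈ Set.Icc (m - 1) (m + 1),
      HasDerivAt (fun s => E s - q / 2 * (s - m) ^ 2) (E1 s - q * (s - m)) s := by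
    intro s hs
    have := ((((hasDerivAt_id s).sub_const m).fun_pow 2).const_mul (q / 2))
    refine ((h1 s hs).fun_sub this).congr_deriv ?_
    simp; ring
  have x2 : ∀ s ∈ Set.Icc (m - 1) (m + 1),
      HasDerivAt (fun s => E1 s - q * (s - m)) (E2 s - q) s := by
    intro s hs
    have := (((hasDerivAt_id s).sub_const m).const_mul q)
    refine ((h2 s hs).fun_sub this).congr_deriv ?_
    simp
  have hmono : MonotoneOn (fun s => E1 s - q * (s - m)) (Set.Icc (m - 1) (m + 1)) := by
    refine monotoneOn_of_deriv_nonneg (convex_Icc _ _)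
      (fun s hs => (x2 s hs).continuousAt.continuousWithinAt)
      (fun s hs => (x2 s (interior_subset hs)).differentiableAt.differentiableWithinAt) ?_
    intro s hs
    rw [(x2 s (interior_subset hs)).deriv]
    linarith [hcon s (interior_subset hs)]
  have hconv : ConvexOn ℝ (Set.Icc (m - 1) (m + 1)) (fun s => E s - q / 2 * (s - m) ^ 2) := by
    refine MonotoneOn.convexOn_of_deriv (convex_Icc _ _)
      (fun s hs => (x1 s hs).continuousAt.continuousWithinAt)
      (fun s hs => (x1 s (interior_subset hs)).differentiableAt.differentiableWithinAt) ?_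
    intro s hs t ht hst
    rw [(x1 s (interior_subset hs)).deriv, (x1 t (interior_subset ht)).deriv]
    exact hmono (interior_subset hs) (interior_subset ht) hst
  have hl : m - 1 ∈ Set.Icc (m - 1) (m + 1) := ⟨le_rfl, by linarith⟩
  have hr : m + 1 ∈ Set.Icc (m - 1) (m + 1) := ⟨by linarith, le_rfl⟩
  have := hconv.2 hl hr (show (0 : ℝ) ≤ 1 / 2 by norm_num) (show (0 : ℝ) ≤ 1 / 2 by norm_num)
    (by norm_num)
  have e : (1 / 2 : ℝ) • (m - 1) + (1 / 2 : ℝ) • (m + 1) = m := by simp; ring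
  rw [e] at this
  simp at this
  have hq : q = 2 * B + τ := rfl
  linarith [hB _ hl, hB _ hr]
/-! ### Part 4: mean values on strips and epsilon regularity -/

lemma strip_int {G : ℂ → ℝ} {b : ℝ} {z0 : ℂ} (hG : ContinuousOn G (hp b)) (hP : Per G)
    (h0 : ∀ z ∈ hp b, 0 ≤ G z) (hs : z0.re + 1 < b) :
    ∫ z in ball z0 1, G z ≤ ∫ s in (z0.re - 1)..(z0.re + 1), cint G s := by
  have hpi := pi_gt_three
  let e := Complex.measurableEquivRealProd
  let Q : Set (ℝ × ℝ) := Set.Ioc (z0.re - 1) (z0.re + 1) ×ˢ Set.Ioc (z0.im - π) (z0.im - π + 2 * π)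
  have hsub : ball z0 1 ⊆ e ⁻¹' Q := by
    intro z hz
    have h1 : ‖z - z0‖ < 1 := by simpa [dist_eq_norm] using hz
    have hre := abs_lt.1 ((Complex.abs_re_le_norm (z - z0)).trans_lt h1)
    have him := abs_lt.1 ((Complex.abs_im_le_norm (z - z0)).trans_lt h1)
    simp only [Complex.sub_re, Complex.sub_im] at hre him
    refine ⟨⟨?_, ?_⟩, ⟨?_, ?_⟩⟩ <;> simp [e, Complex.measurableEquivRealProd_apply] <;> linarith
  have hmp := Complex.volume_preserving_equiv_real_prod
  have hsymm : ∀ q : ℝ × ℝ, e.symm q = q.1 + q.2 * Complex.I := by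
    intro q; apply Complex.ext <;> simp [e]
  have hGe : ∀ z : ℂ, G z = (fun q : ℝ × ℝ => G (q.1 + q.2 * Complex.I)) (e z) := by
    intro z; simp [e, Complex.re_add_im]
  have hint : IntegrableOn (fun q : ℝ × ℝ => G (q.1 + q.2 * Complex.I)) Q (volume.prod volume) := by
    have hc : ContinuousOn (fun q : ℝ × ℝ => G (q.1 + q.2 * Complex.I))
        (Set.Icc (z0.re - 1) (z0.re + 1) ×ˢ Set.Icc (z0.im - π) (z0.im - π + 2 * π)) := by
      refine hG.comp (by fun_prop) ?_
      rintro ⟨a, t⟩ ⟨h1, _⟩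
      exact mem_hp (lt_of_le_of_lt h1.2 hs) t
    exact (hc.integrableOn_compact (isCompact_Icc.prod isCompact_Icc)).mono_set
      (Set.prod_mono Set.Ioc_subset_Icc_self Set.Ioc_subset_Icc_self)
  have hQm : MeasurableSet Q := measurableSet_Ioc.prod measurableSet_Ioc
  have e1 : ∫ z in e ⁻¹' Q, G z = ∫ q in Q, G (q.1 + q.2 * Complex.I) := by
    rw [← hmp.setIntegral_preimage_emb e.measurableEmbedding]
    refine setIntegral_congr_fun (e.measurable hQm) ?_
    intro z _; exact hGe z
  have hint2 : IntegrableOn G (e ⁻¹' Q) := by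
    have := (hmp.integrableOn_comp_preimage e.measurableEmbedding
      (f := fun q : ℝ × ℝ => G (q.1 + q.2 * Complex.I)) (s := Q)).2 hint
    refine this.congr_fun ?_ (e.measurable hQm)
    intro z _; exact (hGe z).symm
  have e2 : ∫ z in ball z0 1, G z ≤ ∫ z in e ⁻¹' Q, G z := by
    refine setIntegral_mono_set hint2 ?_ (Eventually.of_forall hsub)
    refine (ae_restrict_iff' (e.measurable hQm)).2 (Eventually.of_forall ?_)
    intro z hz
    refine h0 z ?_
    have : z.re ≤ z0.re + 1 := hz.1.2
    simp [hp]; linarith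
  refine e2.trans (le_of_eq ?_)
  rw [e1, Measure.volume_eq_prod, setIntegral_prod _ hint,
    intervalIntegral.integral_of_le (by linarith)]
  refine setIntegral_congr_fun measurableSet_Ioc ?_
  intro s hs'
  have hper : Function.Periodic (fun θ : ℝ => G (s + θ * Complex.I)) (2 * π) := by
    intro θ
    have := hP (s + θ * Complex.I)
    refine Eq.trans ?_ this
    simp only []
    congr 1; push_cast; ring
  have := hper.intervalIntegral_add_eq (z0.im - π) (-π)
  simp only [cint]
  rw [← intervalIntegral.integral_of_le (by linarith), this]
  congr 1; ring

lemma strip_mv {G : ℂ → ℝ} {b κ : ℝ} {z0 : ℂ} (hG : ContDiffOn ℝ 2 G (hp b)) (hP : Per G)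
    (h0 : ∀ z ∈ hp b, 0 ≤ G z) (hs : z0.re + 2 ≤ b)
    (hL : ∀ z : ℂ, |z.re - z0.re| < 2 → -κ ≤ LL G z) :
    π * G z0 ≤ (∫ s in (z0.re - 1)..(z0.re + 1), cint G s) + π / 8 * κ := by
  have hsub : ball z0 (Real.exp (Real.log 2)) ⊆ hp b := by
    rw [Real.exp_log (by norm_num)]
    intro z hz
    have h1 : ‖z - z0‖ < 2 := by simpa [dist_eq_norm] using hz
    have hre := abs_lt.1 ((Complex.abs_re_le_norm (z - z0)).trans_lt h1)
    simp only [Complex.sub_re] at hre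
    simp [hp]; linarith
  have h := mv_disc (hG.mono hsub) (κ := κ) (fun z hz => hL z ?_) (s := 0) (Real.log_pos (by norm_num))
  · have h2 := strip_int hG.continuousOn hP h0 (z0 := z0) (by linarith)
    simp at h
    linarith
  · rw [Real.exp_log (by norm_num)] at hz
    have h1 : ‖z - z0‖ < 2 := by simpa [dist_eq_norm] using hz
    simpa using (Complex.abs_re_le_norm (z - z0)).trans_lt h1

lemma strip_mv_sup {G : ℂ → ℝ} {b κ c : ℝ} {z0 : ℂ} (hG : ContDiffOn ℝ 2 G (hp b)) (hP : Per G)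
    (h0 : ∀ z ∈ hp b, 0 ≤ G z) (hs : z0.re + 2 ≤ b)
    (hL : ∀ z : ℂ, |z.re - z0.re| < 2 → -κ ≤ LL G z)
    (hc : ∀ s ∈ Set.Icc (z0.re - 1) (z0.re + 1), cint G s ≤ c) :
    π * G z0 ≤ 2 * c + π / 8 * κ := by
  have h := strip_mv hG hP h0 hs hL
  have h2 : ∫ s in (z0.re - 1)..(z0.re + 1), cint G s ≤ ∫ s in (z0.re - 1)..(z0.re + 1), c := by
    refine intervalIntegral.integral_mono_on (by linarith) ?_ (by simp) hc
    refine ((cint_cont hG.continuousOn).mono ?_).intervalIntegrable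
    rw [Set.uIcc_of_le (by linarith)]
    intro x hx
    exact lt_of_le_of_lt hx.2 (by linarith)
  simp at h2
  linarith

lemma eps_reg {q : ℂ → ℝ} {O : Set ℂ} {p : ℂ} {K I : ℝ} (hO : closedBall p 1 ⊆ O)
    (hq : ContDiffOn ℝ 2 q O) (hpos : ∀ z ∈ O, 0 < q z) (hK : 0 < K)
    (hL : ∀ z ∈ O, -(K * q z ^ 2) ≤ LL q z) (hI : ∫ z in ball p 1, q z ≤ I)
    (hsmall : I < π / (8 * K)) : q p ≤ 8 * I / π := by
  have hpi := pi_pos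
  have hcont : ContinuousOn (fun y => (1 - dist y p) ^ 2 * q y) (closedBall p 1) :=
    ContinuousOn.mul (by fun_prop) (hq.continuousOn.mono hO)
  obtain ⟨y, hy, hmax⟩ := (isCompact_closedBall p 1).exists_isMaxOn
    ⟨p, mem_closedBall_self zero_le_one⟩ hcont
  have hqp := hpos p (hO (mem_closedBall_self zero_le_one))
  have hm0 : q p ≤ (1 - dist y p) ^ 2 * q y := by
    have := hmax (mem_closedBall_self (x := p) zero_le_one)
    simpa using this
  have hqy := hpos y (hO hy)
  set σ := (1 - dist y p) / 2 with hσ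
  have hd : dist y p ≤ 1 := hy
  have hσpos : 0 < σ := by
    rcases hd.lt_or_eq with h | h
    · rw [hσ]; linarith
    · rw [h] at hm0; simp at hm0; linarith
  have hsub : ball y σ ⊆ ball p 1 := by
    refine ball_subset_ball' ?_
    rw [hσ]; linarith
  have hsubO : ball y σ ⊆ O := hsub.trans (ball_subset_closedBall.trans hO)
  have hq4 : ∀ x ∈ ball y σ, q x ≤ 4 * q y := by
    intro x hx
    have h1 := hmax (ball_subset_closedBall (hsub hx))
    simp only [Set.mem_ofPred_eq] at h1
    have h2 : σ ≤ 1 - dist x p := by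
      have := dist_triangle x y p
      have hx' : dist x y < σ := hx
      rw [hσ] at hx' ⊢; linarith
    have h3 : σ ^ 2 * q x ≤ (1 - dist x p) ^ 2 * q x := by
      have := (hpos x (hsubO hx)).le
      gcongr
    have h4 : (1 - dist y p) ^ 2 = 4 * σ ^ 2 := by rw [hσ]; ring
    rw [h4] at h1
    have h5 : 0 < σ ^ 2 := by positivity
    have h6 : σ ^ 2 * q x ≤ σ ^ 2 * (4 * q y) := by linarith
    exact le_of_mul_le_mul_left h6 h5
  have hmv : ∀ τ, 0 < τ → τ < σ → π * τ ^ 2 * q y ≤ I + 2 * π * K * q y ^ 2 * τ ^ 4 := by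
    intro τ hτ hτσ
    have hball : ball y (Real.exp (Real.log σ)) = ball y σ := by rw [Real.exp_log hσpos]
    have h := mv_disc (u := q) (p := y) (b := Real.log σ) (κ := 16 * K * q y ^ 2)
      (by rw [hball]; exact hq.mono hsubO) ?_ (s := Real.log τ) (Real.log_lt_log hτ hτσ)
    · have e2 : Real.exp (2 * Real.log τ) = τ ^ 2 := by
        rw [mul_comm, Real.exp_mul, Real.exp_log hτ]; norm_cast
      have e4 : Real.exp (4 * Real.log τ) = τ ^ 4 := by
        rw [mul_comm, Real.exp_mul, Real.exp_log hτ]; norm_cast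
      rw [e2, e4, Real.exp_log hτ] at h
      have h7 : ∫ x in ball y τ, q x ≤ ∫ x in ball p 1, q x := by
        refine setIntegral_mono_set ?_ ?_ (Eventually.of_forall ?_)
        · exact ((hq.continuousOn.mono hO).integrableOn_compact
            (isCompact_closedBall p 1)).mono_set ball_subset_closedBall
        · refine (ae_restrict_iff' measurableSet_ball).2 (Eventually.of_forall ?_)
          intro z hz
          exact (hpos z (hO (ball_subset_closedBall hz))).le
        · exact (ball_subset_ball hτσ.le).trans hsub
      have e5 : π / 8 * (16 * K * q y ^ 2) * τ ^ 4 = 2 * π * K * q y ^ 2 * τ ^ 4 := by ring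
      linarith
    · intro x hx
      rw [hball] at hx
      have h1 := hL x (hsubO hx)
      have h2 : q x ^ 2 ≤ (4 * q y) ^ 2 := by
        have := (hpos x (hsubO hx)).le
        have := hq4 x hx
        gcongr
      have h3 : K * q x ^ 2 ≤ K * (4 * q y) ^ 2 := by gcongr
      have h4 : K * (4 * q y) ^ 2 = 16 * K * q y ^ 2 := by ring
      linarith
  by_cases hcase : 1 < 4 * K * q y * σ ^ 2
  · exfalso
    set τ := Real.sqrt (1 / (4 * K * q y)) with hτ
    have ht2 : τ ^ 2 = 1 / (4 * K * q y) := Real.sq_sqrt (by positivity)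
    have htpos : 0 < τ := Real.sqrt_pos.2 (by positivity)
    have hts : τ < σ := by
      refine lt_of_pow_lt_pow_left₀ 2 hσpos.le ?_
      rw [ht2, div_lt_iff₀ (by positivity)]; linarith
    have := hmv τ htpos hts
    have h4 : τ ^ 4 = (1 / (4 * K * q y)) ^ 2 := by rw [← ht2]; ring
    rw [ht2, h4] at this
    have e1 : π * (1 / (4 * K * q y)) * q y = 2 * (π / (8 * K)) := by field_simp; norm_num
    have e2 : 2 * π * K * q y ^ 2 * (1 / (4 * K * q y)) ^ 2 = π / (8 * K) := by
      field_simp; norm_num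
    rw [e1, e2] at this
    linarith
  · push Not at hcase
    have h1 : ∀ τ, 0 < τ → τ < σ → π / 2 * q y * τ ^ 2 ≤ I := by
      intro τ h0 hτ
      have := hmv τ h0 hτ
      have h2 : 4 * K * q y * τ ^ 2 ≤ 1 := by
        refine le_trans ?_ hcase
        gcongr
      have h3 : 2 * π * K * q y ^ 2 * τ ^ 4 = (π / 2 * q y * τ ^ 2) * (4 * K * q y * τ ^ 2) := by ring
      have h4 : (π / 2 * q y * τ ^ 2) * (4 * K * q y * τ ^ 2) ≤ (π / 2 * q y * τ ^ 2) * 1 := by gcongr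
      rw [h3] at this
      linarith
    have h2 : π / 2 * q y * σ ^ 2 ≤ I := by
      have ht : Tendsto (fun τ : ℝ => π / 2 * q y * τ ^ 2) (𝓝[<] σ) (𝓝 (π / 2 * q y * σ ^ 2)) := by
        refine Tendsto.mono_left ?_ nhdsWithin_le_nhds
        exact (Continuous.tendsto (by fun_prop) σ)
      refine le_of_tendsto ht ?_
      filter_upwards [Ioo_mem_nhdsLT hσpos] with τ hτ
      exact h1 τ hτ.1 hτ.2
    have h4 : (1 - dist y p) ^ 2 = 4 * σ ^ 2 := by rw [hσ]; ring
    rw [h4] at hm0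
    rw [le_div_iff₀ hpi]
    nlinarith
/-! ### Part 5: local analysis of the nonlinear equation -/

/-- local data for the Liouville equation around `p` -/
structure LD (v V : ℂ → ℝ) (lam : ℝ) (p : ℂ) (b Vm Vp s0 Mt : ℝ) : Prop where
  hv : ContDiffOn ℝ 2 v (ball p (Real.exp b))
  hV : ContDiffOn ℝ 1 V (ball p (Real.exp b))
  hVm : 0 < Vm
  hVl : ∀ x ∈ ball p (Real.exp b), Vm ≤ V x
  hVu : ∀ x ∈ ball p (Real.exp b), V x ≤ Vp
  hlam : 0 < lam
  hpde : ∀ x ∈ ball p (Real.exp b), LL v x = -(lam * V x * Real.exp (v x))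
  hmax : ∀ x ∈ ball p (Real.exp b), v x ≤ v p
  hs0 : lam * V p * Real.exp (v p) * Real.exp (2 * s0) = 1
  hMt : ∀ s < b, ∫ x in ball p (Real.exp s), lam * V x * Real.exp (v x) ≤ Mt

/-- cylinder density -/
def ff (v V : ℂ → ℝ) (lam : ℝ) (p z : ℂ) : ℝ :=
  Real.exp (2 * z.re) * (lam * cyl V p z * Real.exp (cyl v p z))

/-- mass -/
def MM (v V : ℂ → ℝ) (lam : ℝ) (p : ℂ) (s : ℝ) : ℝ :=
  ∫ x in ball p (Real.exp s), lam * V x * Real.exp (v x)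

section LDsec
variable {v V : ℂ → ℝ} {lam : ℝ} {p : ℂ} {b Vm Vp s0 Mt : ℝ}

lemma hasDerivAt_exp2 (a s : ℝ) :
    HasDerivAt (fun s : ℝ => Real.exp (2 * (s - a))) (2 * Real.exp (2 * (s - a))) s := by
  have := (((hasDerivAt_id s).sub_const a).const_mul 2).exp
  simpa [mul_comm] using this

lemma tendsto_exp2 (a : ℝ) : Tendsto (fun s : ℝ => Real.exp (2 * (s - a))) atBot (𝓝 0) := by
  refine Real.tendsto_exp_atBot.comp ?_
  exact (tendsto_atBot_add_const_right _ (-a) tendsto_id).const_mul_atBot (by norm_num)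

lemma LD.pmem (_h : LD v V lam p b Vm Vp s0 Mt) : p ∈ ball p (Real.exp b) :=
  mem_ball_self (Real.exp_pos b)

lemma LD.lam1 (h : LD v V lam p b Vm Vp s0 Mt) : 1 ≤ Vp / Vm := by
  rw [le_div_iff₀ h.hVm, one_mul]
  exact (h.hVl p h.pmem).trans (h.hVu p h.pmem)

lemma LD.Vppos (h : LD v V lam p b Vm Vp s0 Mt) : 0 < Vp :=
  h.hVm.trans_le ((h.hVl p h.pmem).trans (h.hVu p h.pmem))

lemma LD.rho_le (h : LD v V lam p b Vm Vp s0 Mt) {x : ℂ} (hx : x ∈ ball p (Real.exp b)) :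
    lam * V x * Real.exp (v x) ≤ Vp / Vm * Real.exp (-(2 * s0)) := by
  have h1 : Real.exp (-(2 * s0)) = lam * V p * Real.exp (v p) := by
    rw [Real.exp_neg]
    exact inv_eq_of_mul_eq_one_left h.hs0
  rw [h1]
  have h2 := Real.exp_le_exp.2 (h.hmax x hx)
  have h3 := h.hVl p h.pmem
  have h4 := h.hVu x hx
  have h5 := h.hVl x hx
  have hl := h.hlam
  have hm := h.hVm
  have hp := h.Vppos
  calc lam * V x * Real.exp (v x) ≤ lam * Vp * Real.exp (v p) := by gcongr
    _ = Vp / Vm * (lam * Vm * Real.exp (v p)) := by field_simp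
    _ ≤ _ := by gcongr

lemma LD.F2 (h : LD v V lam p b Vm Vp s0 Mt) : ContDiffOn ℝ 2 (cyl v p) (hp b) :=
  cyl_contDiffOn h.hv
lemma LD.F1 (h : LD v V lam p b Vm Vp s0 Mt) : ContDiffOn ℝ 1 (cyl v p) (hp b) :=
  h.F2.of_le (by norm_num)
lemma LD.V1 (h : LD v V lam p b Vm Vp s0 Mt) : ContDiffOn ℝ 1 (cyl V p) (hp b) :=
  cyl_contDiffOn h.hV

lemma LD.ff1 (h : LD v V lam p b Vm Vp s0 Mt) : ContDiffOn ℝ 1 (ff v V lam p) (hp b) := by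
  have h1 : ContDiff ℝ 1 (fun z : ℂ => Real.exp (2 * z.re)) :=
    (contDiff_const.mul Complex.reCLM.contDiff).exp
  exact h1.contDiffOn.mul ((contDiffOn_const.mul h.V1).mul h.F1.exp)

lemma LD.ffc (h : LD v V lam p b Vm Vp s0 Mt) : ContinuousOn (ff v V lam p) (hp b) :=
  h.ff1.continuousOn

lemma LD.rhoc (h : LD v V lam p b Vm Vp s0 Mt) :
    ContinuousOn (fun x => lam * V x * Real.exp (v x)) (ball p (Real.exp b)) :=
  (continuousOn_const.mul h.hV.continuousOn).mul h.hv.continuousOn.rexp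

lemma ff_per : Per (ff v V lam p) := by
  intro z
  simp only [ff, cyl_per V p z, cyl_per v p z]
  simp

lemma LD.LLF (h : LD v V lam p b Vm Vp s0 Mt) {z : ℂ} (hz : z ∈ hp b) :
    LL (cyl v p) z = - ff v V lam p z := by
  rw [LL_cyl h.hv hz, h.hpde _ (psi_mem hz), ff]; simp only [cyl]; ring

lemma LD.ff_pos (h : LD v V lam p b Vm Vp s0 Mt) {z : ℂ} (hz : z ∈ hp b) : 0 < ff v V lam p z := by
  have h1 := h.hVm.trans_le (h.hVl _ (psi_mem hz))
  have h2 := h.hlam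
  simp only [ff, cyl]; positivity

lemma LD.ff_le (h : LD v V lam p b Vm Vp s0 Mt) {z : ℂ} (hz : z ∈ hp b) :
    ff v V lam p z ≤ Vp / Vm * Real.exp (2 * (z.re - s0)) := by
  have := h.rho_le (psi_mem hz)
  have e : Real.exp (2 * (z.re - s0)) = Real.exp (2 * z.re) * Real.exp (-(2 * s0)) := by
    rw [← Real.exp_add]; ring_nf
  rw [e]
  simp only [ff, cyl]
  nlinarith [Real.exp_pos (2 * z.re)]

lemma LD.MM_deriv (h : LD v V lam p b Vm Vp s0 Mt) {s : ℝ} (hs : s < b) :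
    HasDerivAt (MM v V lam p) (cint (ff v V lam p) s) s := by
  have := ball_deriv h.rhoc hs
  refine this.congr_deriv ?_
  rw [← cint_mul]
  refine cint_congr fun z hz => ?_
  simp only [ff, cyl, hz]

lemma LD.MM_bot (h : LD v V lam p b Vm Vp s0 Mt) : Tendsto (MM v V lam p) atBot (𝓝 0) :=
  ball_bot h.rhoc

lemma LD.ffint_nonneg (h : LD v V lam p b Vm Vp s0 Mt) {s : ℝ} (hs : s < b) :
    0 ≤ cint (ff v V lam p) s :=
  cint_nonneg fun z hz => (h.ff_pos (by simp [hp, hz, hs])).le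

lemma LD.MM_mono (h : LD v V lam p b Vm Vp s0 Mt) {s t : ℝ} (hst : s ≤ t) (ht : t < b) :
    MM v V lam p s ≤ MM v V lam p t :=
  mono_of_deriv (fun _ hs => h.MM_deriv hs) (fun _ hs => h.ffint_nonneg hs) hst ht

lemma LD.MM_nonneg (h : LD v V lam p b Vm Vp s0 Mt) {s : ℝ} (hs : s < b) : 0 ≤ MM v V lam p s :=
  lim_le_of_deriv (fun _ hs => h.MM_deriv hs) (fun _ hs => h.ffint_nonneg hs) h.MM_bot hs

lemma LD.MM_le (h : LD v V lam p b Vm Vp s0 Mt) {s : ℝ} (hs : s < b) : MM v V lam p s ≤ Mt :=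
  h.hMt s hs

lemma LD.flux (h : LD v V lam p b Vm Vp s0 Mt) {s : ℝ} (hs : s < b) :
    cint (dx (cyl v p)) s = - MM v V lam p s := by
  rw [flux_eq h.hv hs, MM, ← integral_neg]
  refine setIntegral_congr_fun measurableSet_ball ?_
  intro x hx
  exact h.hpde x (ball_subset_ball (Real.exp_le_exp.2 hs.le) hx)

lemma LD.A_deriv (h : LD v V lam p b Vm Vp s0 Mt) {s : ℝ} (hs : s < b) :
    HasDerivAt (cint (cyl v p)) (- MM v V lam p s) s := by
  rw [← h.flux hs]; exact cint_deriv h.F1 hs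

lemma LD.MM_small (h : LD v V lam p b Vm Vp s0 Mt) {s : ℝ} (hs : s < b) :
    MM v V lam p s ≤ π * (Vp / Vm) * Real.exp (2 * (s - s0)) := by
  have := lim_le_of_deriv (b := b) (l := 0)
    (f := fun s => π * (Vp / Vm) * Real.exp (2 * (s - s0)) - MM v V lam p s)
    (f' := fun s => π * (Vp / Vm) * (2 * Real.exp (2 * (s - s0))) - cint (ff v V lam p) s)
    (fun s hs => ((hasDerivAt_exp2 s0 s).const_mul _).fun_sub (h.MM_deriv hs)) ?_ ?_ hs
  · linarith
  · intro s hs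
    have h1 : cint (ff v V lam p) s ≤ cint (fun _ => Vp / Vm * Real.exp (2 * (s - s0))) s := by
      refine cint_mono h.ffc continuousOn_const hs fun z hz => ?_
      have := h.ff_le (z := z) (by simp [hp, hz, hs])
      rwa [hz] at this
    rw [cint_const] at h1
    linarith
  · simpa using ((tendsto_exp2 s0).const_mul (π * (Vp / Vm))).sub h.MM_bot

lemma LD.A_bot (h : LD v V lam p b Vm Vp s0 Mt) :
    Tendsto (cint (cyl v p)) atBot (𝓝 (2 * π * v p)) :=
  cint_bot h.F1.continuousOn (cyl_bot
    (h.hv.continuousOn.continuousAt (isOpen_ball.mem_nhds h.pmem)))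

lemma LD.A_lower (h : LD v V lam p b Vm Vp s0 Mt) {s : ℝ} (hs : s < b) :
    2 * π * v p - π / 2 * (Vp / Vm) * Real.exp (2 * (s - s0)) ≤ cint (cyl v p) s := by
  have := lim_le_of_deriv (b := b) (l := 2 * π * v p)
    (f := fun s => cint (cyl v p) s + π / 2 * (Vp / Vm) * Real.exp (2 * (s - s0)))
    (f' := fun s => - MM v V lam p s + π / 2 * (Vp / Vm) * (2 * Real.exp (2 * (s - s0))))
    (fun s hs => (h.A_deriv hs).fun_add ((hasDerivAt_exp2 s0 s).const_mul _)) ?_ ?_ hs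
  · linarith
  · intro s hs; linarith [h.MM_small hs]
  · simpa using h.A_bot.add ((tendsto_exp2 s0).const_mul (π / 2 * (Vp / Vm)))

/-- general lower bound for the averages -/
lemma LD.A_lower2 (h : LD v V lam p b Vm Vp s0 Mt) {s : ℝ} (hs : s < b) :
    2 * π * v p - π / 2 * (Vp / Vm) - Mt * max (s - s0) 0 ≤ cint (cyl v p) s := by
  have hl := h.lam1
  have hpi := pi_pos
  rcases le_total s s0 with h1 | h1
  · have := h.A_lower hs
    have h2 : Real.exp (2 * (s - s0)) ≤ 1 := Real.exp_le_one_iff.2 (by linarith)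
    rw [max_eq_right (by linarith), mul_zero]
    have : π / 2 * (Vp / Vm) * Real.exp (2 * (s - s0)) ≤ π / 2 * (Vp / Vm) * 1 := by gcongr
    linarith
  · have h2 := h.A_lower (s := s0) (lt_of_le_of_lt h1 hs)
    simp only [sub_self, mul_zero, Real.exp_zero, mul_one] at h2
    rw [max_eq_left (by linarith)]
    have := mono_of_deriv (b := b) (f := fun s => cint (cyl v p) s + Mt * s)
      (f' := fun s => - MM v V lam p s + Mt * 1)
      (fun s hs => (h.A_deriv hs).fun_add ((hasDerivAt_id s).const_mul Mt))
      (fun s hs => by linarith [h.MM_le hs]) h1 hs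
    linarith

/-- lower bound for the mass of the bubble -/
lemma LD.MM_s0 (h : LD v V lam p b Vm Vp s0 Mt) (hs : s0 < b) :
    π / (Vp / Vm) * Real.exp (-((Vp / Vm) / 8)) ≤ MM v V lam p s0 := by
  set Λ := Vp / Vm with hΛ
  have hl : 1 ≤ Λ := h.lam1
  have hpi := pi_pos
  have hmv := mv_disc (κ := Λ * Real.exp (-(2 * s0))) h.hv (fun x hx => by
    rw [h.hpde x hx]; linarith [h.rho_le hx]) hs
  have e4 : Real.exp (4 * s0) = Real.exp (2 * s0) * Real.exp (2 * s0) := by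
    rw [← Real.exp_add]; ring_nf
  have e5 : Real.exp (-(2 * s0)) * Real.exp (2 * s0) = 1 := by
    rw [← Real.exp_add]; simp
  have hmv' : π * Real.exp (2 * s0) * (v p - Λ / 8) ≤ ∫ x in ball p (Real.exp s0), v x := by
    have : π / 8 * (Λ * Real.exp (-(2 * s0))) * Real.exp (4 * s0) =
        π * Real.exp (2 * s0) * (Λ / 8) := by
      rw [e4]
      linear_combination (π / 8 * Λ * Real.exp (2 * s0)) * e5
    rw [this] at hmv; linarith
  have hsub : closedBall p (Real.exp s0) ⊆ ball p (Real.exp b) :=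
    closedBall_subset_ball (Real.exp_lt_exp.2 hs)
  have hint : ∀ g : ℂ → ℝ, ContinuousOn g (ball p (Real.exp b)) →
      IntegrableOn g (ball p (Real.exp s0)) := fun g hg =>
    ((hg.mono hsub).integrableOn_compact (isCompact_closedBall _ _)).mono_set ball_subset_closedBall
  set a := v p - Λ / 8 with ha
  have hle : ∫ x in ball p (Real.exp s0), lam * Vm * Real.exp a * ((1 - a) + v x) ≤
      MM v V lam p s0 := by
    refine setIntegral_mono_on (hint _ ?_) (hint _ h.rhoc) measurableSet_ball ?_
    · exact continuousOn_const.mul (continuousOn_const.add h.hv.continuousOn)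
    · intro x hx
      have hx' := hsub (ball_subset_closedBall hx)
      have h1 : Real.exp a * ((1 - a) + v x) ≤ Real.exp (v x) := by
        have h2 := Real.add_one_le_exp (v x - a)
        have h3 : Real.exp (v x) = Real.exp a * Real.exp (v x - a) := by
          rw [← Real.exp_add]; ring_nf
        rw [h3]
        gcongr; linarith
      have h4 := h.hVl x hx'
      have h5 := h.hVm
      have h6 := h.hlam
      calc lam * Vm * Real.exp a * ((1 - a) + v x) = lam * Vm * (Real.exp a * ((1 - a) + v x)) := by
            ring
        _ ≤ lam * Vm * Real.exp (v x) := by gcongr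
        _ ≤ _ := by gcongr
  have hvol : volume.real (ball p (Real.exp s0)) = π * Real.exp (2 * s0) := by
    rw [Measure.real, Complex.volume_ball]
    have : (NNReal.pi : ENNReal).toReal = π := rfl
    simp [this, ← Real.exp_nat_mul, mul_comm, Real.exp_nonneg]
  rw [integral_const_mul, integral_add (hint (fun _ => 1 - a) continuousOn_const) (hint _ h.hv.continuousOn), setIntegral_const,
    hvol, smul_eq_mul] at hle
  have h6 := h.hlam
  have h5 := h.hVm
  have h7 : lam * Vm * Real.exp a * (π * Real.exp (2 * s0)) ≤ MM v V lam p s0 := by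
    refine le_trans ?_ hle
    gcongr
    linarith
  refine le_trans ?_ h7
  have e6 : Real.exp a = Real.exp (v p) * Real.exp (-(Λ / 8)) := by
    rw [← Real.exp_add, ha]; ring_nf
  rw [e6]
  have h8 : 1 / Λ ≤ lam * Vm * Real.exp (v p) * Real.exp (2 * s0) := by
    rw [hΛ, one_div_div, div_le_iff₀ h.Vppos]
    have h9 := h.hVu p h.pmem
    calc Vm = Vm * (lam * V p * Real.exp (v p) * Real.exp (2 * s0)) := by rw [h.hs0, mul_one]
      _ = lam * Vm * Real.exp (v p) * Real.exp (2 * s0) * V p := by ring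
      _ ≤ _ := by gcongr
  calc π / Λ * Real.exp (-(Λ / 8)) = π * Real.exp (-(Λ / 8)) * (1 / Λ) := by ring
    _ ≤ π * Real.exp (-(Λ / 8)) * (lam * Vm * Real.exp (v p) * Real.exp (2 * s0)) := by gcongr
    _ = _ := by ring

end LDsec
/-! ### Part 6: pointwise bounds, epsilon regularity and Pohozaev -/

lemma dx_congr {u w : ℂ → ℝ} {z : ℂ} (h : u =ᶠ[𝓝 z] w) : dx u z = dx w z := by
  unfold dx; rw [h.fderiv_eq]
lemma dy_congr {u w : ℂ → ℝ} {z : ℂ} (h : u =ᶠ[𝓝 z] w) : dy u z = dy w z := by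
  unfold dy; rw [h.fderiv_eq]

lemma dx_exp {H : ℂ → ℝ} {z : ℂ} (h : DifferentiableAt ℝ H z) :
    dx (fun z => Real.exp (H z)) z = Real.exp (H z) * dx H z := by
  unfold dx; rw [fderiv_exp h]; simp
lemma dy_exp {H : ℂ → ℝ} {z : ℂ} (h : DifferentiableAt ℝ H z) :
    dy (fun z => Real.exp (H z)) z = Real.exp (H z) * dy H z := by
  unfold dy; rw [fderiv_exp h]; simp

lemma LL_exp {H : ℂ → ℝ} {O : Set ℂ} (hO : IsOpen O) (hH : ContDiffOn ℝ 2 H O) {z : ℂ} (hz : z ∈ O) :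
    LL (fun z => Real.exp (H z)) z = Real.exp (H z) * (LL H z + dx H z ^ 2 + dy H z ^ 2) := by
  have h1 : ContDiffOn ℝ 1 H O := hH.of_le (by norm_num)
  have hd : ∀ y ∈ O, DifferentiableAt ℝ H y := fun y hy => diffAt_of hO h1 hy
  have e1 : dx (fun z => Real.exp (H z)) =ᶠ[𝓝 z] fun z => Real.exp (H z) * dx H z := by
    filter_upwards [hO.mem_nhds hz] with y hy using dx_exp (hd y hy)
  have e2 : dy (fun z => Real.exp (H z)) =ᶠ[𝓝 z] fun z => Real.exp (H z) * dy H z := by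
    filter_upwards [hO.mem_nhds hz] with y hy using dy_exp (hd y hy)
  unfold LL
  rw [dx_congr e1, dy_congr e2, dx_mul (hd z hz).exp (diffAt_of hO (C1_dx hO hH) hz),
    dy_mul (hd z hz).exp (diffAt_of hO (C1_dy hO hH) hz), dx_exp (hd z hz), dy_exp (hd z hz)]
  ring

lemma dx_aff {F : ℂ → ℝ} {z : ℂ} (h : DifferentiableAt ℝ F z) (c : ℝ) :
    dx (fun z => F z + (c + 2 * z.re)) z = dx F z + 2 := by
  have : HasFDerivAt (fun z : ℂ => c + 2 * z.re) ((2 : ℝ) • Complex.reCLM) z :=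
    (Complex.reCLM.hasFDerivAt.const_mul 2).const_add c
  have h2 := (h.hasFDerivAt.add this).fderiv
  have h3 : fderiv ℝ (fun z => F z + (c + 2 * z.re)) z = _ := h2
  unfold dx; rw [h3]; simp
lemma dy_aff {F : ℂ → ℝ} {z : ℂ} (h : DifferentiableAt ℝ F z) (c : ℝ) :
    dy (fun z => F z + (c + 2 * z.re)) z = dy F z := by
  have : HasFDerivAt (fun z : ℂ => c + 2 * z.re) ((2 : ℝ) • Complex.reCLM) z :=
    (Complex.reCLM.hasFDerivAt.const_mul 2).const_add c
  have h2 := (h.hasFDerivAt.add this).fderiv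
  have h3 : fderiv ℝ (fun z => F z + (c + 2 * z.re)) z = _ := h2
  unfold dy; rw [h3]; simp

lemma LL_aff {F : ℂ → ℝ} {O : Set ℂ} (hO : IsOpen O) (hF : ContDiffOn ℝ 2 F O) {z : ℂ} (hz : z ∈ O)
    (c : ℝ) : LL (fun z => F z + (c + 2 * z.re)) z = LL F z := by
  have h1 : ContDiffOn ℝ 1 F O := hF.of_le (by norm_num)
  have e1 : dx (fun z => F z + (c + 2 * z.re)) =ᶠ[𝓝 z] fun z => dx F z + 2 := by
    filter_upwards [hO.mem_nhds hz] with y hy using dx_aff (diffAt_of hO h1 hy) c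
  have e2 : dy (fun z => F z + (c + 2 * z.re)) =ᶠ[𝓝 z] dy F := by
    filter_upwards [hO.mem_nhds hz] with y hy using dy_aff (diffAt_of hO h1 hy) c
  unfold LL
  rw [dx_congr e1, dy_congr e2]
  congr 1
  unfold dx; simp

lemma LL_const_sub (c : ℝ) (F : ℂ → ℝ) (z : ℂ) : LL (fun z => c - F z) z = - LL F z := by
  have e1 : dx (fun z => c - F z) = fun z => - dx F z := by
    ext z; unfold dx; rw [fderiv_const_sub]; simp
  have e2 : dy (fun z => c - F z) = fun z => - dy F z := by
    ext z; unfold dy; rw [fderiv_const_sub]; simp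
  unfold LL
  rw [e1, e2]
  have e3 : dx (fun z => - dx F z) z = - dx (dx F) z := by
    conv_lhs => unfold dx
    rw [fderiv_fun_neg]; simp; rfl
  have e4 : dy (fun z => - dy F z) z = - dy (dy F) z := by
    conv_lhs => unfold dy
    rw [fderiv_fun_neg]; simp; rfl
  rw [e3, e4]; ring

section LDsec2
variable {v V : ℂ → ℝ} {lam : ℝ} {p : ℂ} {b Vm Vp s0 Mt : ℝ}

lemma LD.G_nonneg (h : LD v V lam p b Vm Vp s0 Mt) {z : ℂ} (hz : z ∈ hp b) :
    0 ≤ v p - cyl v p z := sub_nonneg.2 (h.hmax _ (psi_mem hz))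

lemma LD.Mt_nonneg (h : LD v V lam p b Vm Vp s0 Mt) : 0 ≤ Mt :=
  (h.MM_nonneg (s := b - 1) (by linarith)).trans (h.MM_le (by linarith))

lemma LD.G_le (h : LD v V lam p b Vm Vp s0 Mt) {z : ℂ} {t : ℝ} (hz : z.re ≤ t) (ht : z.re + 2 ≤ b)
    (hs0 : s0 ≤ t + 1) : v p - cyl v p z ≤ Vp / Vm + 2 * Mt / π * (t + 1 - s0) := by
  have hpi := pi_pos
  have hM := h.Mt_nonneg
  have hmv := strip_mv_sup (G := fun z => v p - cyl v p z) (b := b) (κ := 0) (z0 := z)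
    (c := π / 2 * (Vp / Vm) + Mt * (t + 1 - s0)) (contDiffOn_const.sub h.F2)
    (fun z => by simp only [cyl_per v p z]) (fun z hz => h.G_nonneg hz) ht ?_ ?_
  · simp only [mul_zero, add_zero] at hmv
    have : v p - cyl v p z ≤ (2 * (π / 2 * (Vp / Vm) + Mt * (t + 1 - s0))) / π := by
      rw [le_div_iff₀ hpi]; linarith
    refine this.trans (le_of_eq ?_)
    field_simp
  · intro y hy
    have hy2 := abs_lt.1 hy
    have hyb : y ∈ hp b := by simp [hp]; linarith
    rw [LL_const_sub, h.LLF hyb]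
    linarith [h.ff_pos hyb]
  · intro s hs
    have hsb : s < b := by linarith [hs.2]
    rw [cint_sub continuousOn_const h.F1.continuousOn hsb, cint_const]
    have h1 := h.A_lower2 hsb
    have h2 : max (s - s0) 0 ≤ t + 1 - s0 := max_le (by linarith [hs.2]) (by linarith)
    have h3 : Mt * max (s - s0) 0 ≤ Mt * (t + 1 - s0) := by gcongr
    linarith

/-- normalized density -/
def qq (v : ℂ → ℝ) (lam : ℝ) (p z : ℂ) : ℝ := Real.exp (cyl v p z + (Real.log lam + 2 * z.re))

lemma LD.ff_eq (h : LD v V lam p b Vm Vp s0 Mt) (z : ℂ) :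
    ff v V lam p z = cyl V p z * qq v lam p z := by
  rw [ff, qq, Real.exp_add, Real.exp_add, Real.exp_log h.hlam]; ring

lemma LD.H2 (h : LD v V lam p b Vm Vp s0 Mt) :
    ContDiffOn ℝ 2 (fun z => cyl v p z + (Real.log lam + 2 * z.re)) (hp b) := by
  refine h.F2.add ?_
  have h1 : ContDiff ℝ 2 (fun z : ℂ => Real.log lam + 2 * z.re) :=
    contDiff_const.add (contDiff_const.mul Complex.reCLM.contDiff)
  exact h1.contDiffOn

lemma qq_per : Per (qq v lam p) := by
  intro z
  simp only [qq, cyl_per v p z]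
  simp

lemma LD.cint_qq (h : LD v V lam p b Vm Vp s0 Mt) {s : ℝ} (hs : s < b) :
    cint (qq v lam p) s ≤ 1 / Vm * cint (ff v V lam p) s := by
  rw [← cint_mul]
  have hm := h.hVm
  refine cint_mono h.H2.exp.continuousOn (continuousOn_const.mul h.ffc) hs fun z hz => ?_
  have hz' : z ∈ hp b := by simp [hp, hz, hs]
  have h1 : Vm ≤ cyl V p z := h.hVl _ (psi_mem hz')
  have hq : 0 < qq v lam p z := Real.exp_pos _
  rw [h.ff_eq, one_div, le_inv_mul_iff₀ hm]
  gcongr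

lemma LD.eps (h : LD v V lam p b Vm Vp s0 Mt) {z : ℂ} {η : ℝ} (hz : z.re + 1 < b)
    (hη : MM v V lam p (z.re + 1) - MM v V lam p (z.re - 1) ≤ η) (hsm : η < π / (8 * (Vp / Vm))) :
    ff v V lam p z ≤ 8 * (Vp / Vm) * η / π := by
  have hm := h.hVm
  have hpi := pi_pos
  have hVp := h.Vppos
  have hI : ∫ y in ball z 1, qq v lam p y ≤ η / Vm := by
    refine (strip_int h.H2.exp.continuousOn qq_per (fun y _ => (Real.exp_pos _).le) hz).trans ?_
    have hcont : ∀ {G : ℂ → ℝ}, ContinuousOn G (hp b) →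
        IntervalIntegrable (cint G) volume (z.re - 1) (z.re + 1) := by
      intro G hG
      refine ((cint_cont hG).mono ?_).intervalIntegrable
      rw [Set.uIcc_of_le (by linarith)]
      intro x hx
      exact lt_of_le_of_lt hx.2 hz
    have h1 : ∫ s in (z.re - 1)..(z.re + 1), cint (qq v lam p) s ≤
        ∫ s in (z.re - 1)..(z.re + 1), 1 / Vm * cint (ff v V lam p) s := by
      refine intervalIntegral.integral_mono_on (by linarith) (hcont h.H2.exp.continuousOn)
        ((hcont h.ffc).const_mul _) ?_
      intro s hs
      exact h.cint_qq (lt_of_le_of_lt hs.2 hz)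
    refine h1.trans ?_
    rw [intervalIntegral.integral_const_mul, intervalIntegral.integral_eq_sub_of_hasDerivAt
      (f := MM v V lam p) ?_ (hcont h.ffc)]
    · rw [div_eq_mul_one_div η, mul_comm η]; gcongr
    · intro x hx
      rw [Set.uIcc_of_le (by linarith)] at hx
      exact h.MM_deriv (lt_of_le_of_lt hx.2 hz)
  have hcl : closedBall z 1 ⊆ hp b := by
    intro y hy
    have h1 : ‖y - z‖ ≤ 1 := by simpa [dist_eq_norm] using hy
    have hre := abs_le.1 ((Complex.abs_re_le_norm (y - z)).trans h1)
    simp only [Complex.sub_re] at hre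
    simp [hp]; linarith
  have hq := eps_reg (q := qq v lam p) (K := Vp) (I := η / Vm) hcl h.H2.exp
    (fun y _ => Real.exp_pos _) hVp ?_ hI ?_
  · have hz' : z ∈ hp b := by simp [hp]; linarith
    have h1 : cyl V p z ≤ Vp := h.hVu _ (psi_mem hz')
    rw [h.ff_eq]
    have hq0 : 0 < qq v lam p z := Real.exp_pos _
    calc cyl V p z * qq v lam p z ≤ Vp * (8 * (η / Vm) / π) := by gcongr
      _ = _ := by field_simp
  · intro y hy
    have e1 : LL (qq v lam p) y = qq v lam p y * _ := LL_exp (hp_open b) h.H2 hy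
    rw [e1, LL_aff (hp_open b) h.F2 hy, h.LLF hy, h.ff_eq]
    have h1 : cyl V p y ≤ Vp := h.hVu _ (psi_mem hy)
    have hq0 : 0 < qq v lam p y := Real.exp_pos _
    have h2 : cyl V p y * qq v lam p y ^ 2 ≤ Vp * qq v lam p y ^ 2 := by gcongr
    have h3 : 0 ≤ qq v lam p y * (dx (fun z => cyl v p z + (Real.log lam + 2 * z.re)) y ^ 2 +
      dy (fun z => cyl v p z + (Real.log lam + 2 * z.re)) y ^ 2) := by positivity
    linarith
  · rw [div_lt_iff₀ hm]
    refine hsm.trans_le (le_of_eq ?_)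
    field_simp

lemma LD.poho (h : LD v V lam p b Vm Vp s0 Mt) {s1 η : ℝ} (hs1 : s1 ≤ b)
    (hη : ∀ z ∈ hp s1, |dx (cyl V p) z| ≤ η * cyl V p z) {s : ℝ} (hs : s < s1) :
    (2 - η) * MM v V lam p s ≤
      1 / 2 * cint (fun z => dx (cyl v p) z ^ 2 - dy (cyl v p) z ^ 2) s + cint (ff v V lam p) s := by
  have hbb : ∀ {s}, s < s1 → s < b := fun hs => lt_of_lt_of_le hs hs1
  have hdF := cont_dx (hp_open b) h.F1
  have := lim_le_of_deriv (b := s1) (l := 0)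
    (f := fun s => 1 / 2 * cint (fun z => dx (cyl v p) z ^ 2 - dy (cyl v p) z ^ 2) s
      + cint (ff v V lam p) s - (2 - η) * MM v V lam p s)
    (f' := fun s => 1 / 2 * (2 * cint (fun z => dx (cyl v p) z * LL (cyl v p) z) s)
      + cint (dx (ff v V lam p)) s - (2 - η) * cint (ff v V lam p) s)
    (fun s hs => (((pohozaev h.F2 (hbb hs) (cyl_per v p)).const_mul _).fun_add
      (cint_deriv h.ff1 (hbb hs))).fun_sub ((h.MM_deriv (hbb hs)).const_mul _)) ?_ ?_ hs
  · linarith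
  · intro s hs
    have e1 : cint (fun z => dx (cyl v p) z * LL (cyl v p) z) s =
        - cint (fun z => dx (cyl v p) z * ff v V lam p z) s := by
      rw [← cint_neg]
      refine cint_congr fun z hz => ?_
      rw [h.LLF (by simp [hp, hz, hbb hs])]; ring
    have hc1 : ContinuousOn (fun z => dx (cyl v p) z * ff v V lam p z) (hp b) := hdF.mul h.ffc
    have hc2 : ContinuousOn (fun z => (2 - η) * ff v V lam p z) (hp b) :=
      continuousOn_const.mul h.ffc
    have e2 : cint (fun z => dx (cyl v p) z * ff v V lam p z + (2 - η) * ff v V lam p z) s ≤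
        cint (dx (ff v V lam p)) s := by
      refine cint_mono (hc1.add hc2) (cont_dx (hp_open b) h.ff1) (hbb hs) fun z hz => ?_
      have hz' : z ∈ hp b := by simp [hp, hz, hbb hs]
      have e3 : ff v V lam p = fun z => cyl V p z * qq v lam p z := funext h.ff_eq
      have dF := diffAt_of (hp_open b) h.F1 hz'
      have dH := diffAt_of (hp_open b) (h.H2.of_le (by norm_num)) hz'
      have e4 : dx (qq v lam p) z = qq v lam p z * (dx (cyl v p) z + 2) := by
        have : dx (qq v lam p) z = qq v lam p z * _ := dx_exp dH
        rw [this, dx_aff dF]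
      have e5 : dx (ff v V lam p) z = cyl V p z * (qq v lam p z * (dx (cyl v p) z + 2)) +
          dx (cyl V p) z * qq v lam p z := by
        have hq : DifferentiableAt ℝ (qq v lam p) z := dH.exp
        rw [e3, dx_mul (diffAt_of (hp_open b) h.V1 hz') hq, e4]; try ring
      rw [e5, h.ff_eq]
      have h1 := (abs_le.1 (hη z (by simp [hp, hz, hs]))).1
      have hq0 : 0 < qq v lam p z := Real.exp_pos _
      nlinarith
    rw [cint_add hc1 hc2 (hbb hs), cint_mul] at e2
    rw [e1]; linarith
  · have t1 : Tendsto (cint fun z => dx (cyl v p) z ^ 2 - dy (cyl v p) z ^ 2) atBot (𝓝 0) := by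
      have hv1 : ContDiffOn ℝ 1 v (ball p (Real.exp b)) := h.hv.of_le (by norm_num)
      have a1 : Tendsto (dx (cyl v p)) bot (𝓝 0) := dcyl_bot hv1 1
      have a2 : Tendsto (dy (cyl v p)) bot (𝓝 0) := dcyl_bot hv1 Complex.I
      have := cint_bot (b := b) (G := fun z => dx (cyl v p) z ^ 2 - dy (cyl v p) z ^ 2) ((hdF.pow 2).sub ((cont_dy (hp_open b) h.F1).pow 2))
        ((a1.pow 2).sub (a2.pow 2))
      simpa using this
    have t2 : Tendsto (cint (ff v V lam p)) atBot (𝓝 0) := by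
      refine squeeze_zero' (g := fun s => 2 * π * (Vp / Vm) * Real.exp (2 * (s - s0))) ?_ ?_ ?_
      · filter_upwards [eventually_lt_atBot b] with s hs using h.ffint_nonneg hs
      · filter_upwards [eventually_lt_atBot b] with s hs
        have h1 : cint (ff v V lam p) s ≤ cint (fun _ => Vp / Vm * Real.exp (2 * (s - s0))) s := by
          refine cint_mono h.ffc continuousOn_const hs fun z hz => ?_
          have := h.ff_le (z := z) (by simp [hp, hz, hs])
          rwa [hz] at this
        rw [cint_const] at h1
        linarith
      · simpa using (tendsto_exp2 s0).const_mul (2 * π * (Vp / Vm))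
    have h3 := ((t1.const_mul (1 / 2)).add t2).sub (h.MM_bot.const_mul (2 - η))
    simp only [mul_zero, add_zero, sub_zero] at h3
    exact h3

end LDsec2

section LDsec3
variable {v V : ℂ → ℝ} {lam : ℝ} {p : ℂ} {b Vm Vp s0 Mt : ℝ}

lemma LD.A_window (h : LD v V lam p b Vm Vp s0 Mt) {a T η η0 κ B s1 : ℝ} (ha : s0 ≤ a) (hT : 4 ≤ T)
    (hb : a + T + 2 ≤ b) (hs1 : s1 ≤ b) (hTs : a + T < s1)
    (hη : ∀ z ∈ hp s1, |dx (cyl V p) z| ≤ η * cyl V p z)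
    (hη0 : 0 < η0) (hM : MM v V lam p (a + T) - MM v V lam p a ≤ η0)
    (hsm : η0 < π / (8 * (Vp / Vm))) (hκ : κ = 8 * (Vp / Vm) * η0 / π)
    (hB : ∀ z : ℂ, z.re ≤ a + T → v p - cyl v p z ≤ B) :
    8 * π - 4 * π * η - 4 * π / (π / (Vp / Vm) * Real.exp (-((Vp / Vm) / 8))) *
      ((2 * (32 * π ^ 5 * κ ^ 2 + 4 * π * B ^ 2 * Real.exp (-(1 / (2 * π)) * (T / 2 - 2)))
        + κ ^ 2 + 8 * π ^ 3 * κ ^ 2) / 4 + 2 * π * κ) ≤ MM v V lam p (a + T) := by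
  have hpi := pi_pos
  have hΛ := h.lam1
  have hκ0 : 0 < κ := by rw [hκ]; positivity
  set X := Real.exp (-(1 / (2 * π)) * (T / 2 - 2)) with hX
  have hffκ : ∀ z : ℂ, a + 1 ≤ z.re → z.re ≤ a + T - 1 → ff v V lam p z ≤ κ := by
    intro z h1 h2
    rw [hκ]
    refine h.eps (by linarith) ?_ hsm
    have e1 := h.MM_mono (s := z.re + 1) (t := a + T) (by linarith) (by linarith)
    have e2 := h.MM_mono (s := a) (t := z.re - 1) (by linarith) (by linarith)
    linarith
  have hLL : ∀ z : ℂ, a + 1 ≤ z.re → z.re ≤ a + T - 1 → |LL (cyl v p) z| ≤ κ := by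
    intro z h1 h2
    have hz : z ∈ hp b := by simp only [hp, Set.mem_ofPred_eq]; linarith
    rw [h.LLF hz, abs_neg, abs_of_pos (h.ff_pos hz)]
    exact hffκ z h1 h2
  have hEB : ∀ s, s ≤ a + T → EE (cyl v p) s ≤ 2 * π * B ^ 2 := by
    intro s hs
    have hsb : s < b := by linarith
    refine (EE_le h.F1.continuousOn hsb (v p)).trans ?_
    rw [← cint_const (B ^ 2) s]
    refine cint_mono (b := b) ((h.F1.continuousOn.sub continuousOn_const).pow 2)
      continuousOn_const hsb fun z hz => ?_
    have h1 := h.G_nonneg (z := z) (by simp [hp, hz, hsb])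
    have h2 := hB z (by linarith)
    nlinarith
  have hE0 : ∀ s, s ≤ a + T → 0 ≤ EE (cyl v p) s := fun s hs =>
    EE_nonneg h.F1.continuousOn (by linarith : s < b)
  have hEm : ∀ s ∈ Set.Icc (a + T / 2 - 1) (a + T / 2 + 1), EE (cyl v p) s ≤
      32 * π ^ 5 * κ ^ 2 + 4 * π * B ^ 2 * X := by
    intro s hs
    have := comparison (E := EE (cyl v p)) (E1 := EE1 (cyl v p)) (E2 := EE2 (cyl v p))
      (a := a + 1) (b := a + T - 1) (c := 1 / (2 * π)) (K := 8 * π ^ 3 * κ ^ 2)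
      (fun s hs => EE_deriv h.F2 (by linarith [hs.2])) 
      (fun s hs => EE1_deriv h.F2 (by linarith [hs.2]) (cyl_per v p))
      (fun s hs => EE2_lower2 h.F2 (by linarith [hs.2]) fun z hz => hLL z (by linarith [hs.1])
        (by linarith [hs.2])) (by positivity) (by positivity) (hE0 _ (by linarith))
      (hE0 _ (by linarith)) (s := s) ⟨by linarith [hs.1], by linarith [hs.2]⟩
    have e1 : 8 * π ^ 3 * κ ^ 2 / (1 / (2 * π)) ^ 2 = 32 * π ^ 5 * κ ^ 2 := by
      field_simp; ring
    have hc0 : 0 < 1 / (2 * π) := by positivity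
    have e2 : Real.exp (-(1 / (2 * π)) * (s - (a + 1))) ≤ X :=
      Real.exp_le_exp.2 (by nlinarith [hs.1])
    have e3 : Real.exp (-(1 / (2 * π)) * (a + T - 1 - s)) ≤ X :=
      Real.exp_le_exp.2 (by nlinarith [hs.2])
    rw [e1] at this
    have e4 := mul_le_mul (hEB (a + 1) (by linarith)) e2 (Real.exp_pos _).le (by positivity)
    have e5 := mul_le_mul (hEB (a + T - 1) (by linarith)) e3 (Real.exp_pos _).le (by positivity)
    linarith
  obtain ⟨s, hs, hs2⟩ := exists_small_second (E := EE (cyl v p)) (E1 := EE1 (cyl v p))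
    (E2 := EE2 (cyl v p)) (m := a + T / 2) (τ := κ ^ 2)
    (fun s hs => EE_deriv h.F2 (by linarith [hs.2]))
    (fun s hs => EE1_deriv h.F2 (by linarith [hs.2]) (cyl_per v p))
    (hE0 _ (by linarith)) hEm (by positivity)
  have hsb : s < b := by linarith [hs.2]
  have hlow := EE2_lower h.F2 hsb (fun z hz => hLL z (by linarith [hs.1]) (by linarith [hs.2]))
  have hcdx := cont_dx (hp_open b) h.F1
  have hcdy := cont_dy (hp_open b) h.F1
  have hdy0 : 0 ≤ cint (fun z => dy (cyl v p) z ^ 2) s := cint_nonneg fun z _ => sq_nonneg _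
  have hp1 := h.poho hs1 hη (s := s) (by linarith [hs.2])
  rw [cint_sub (G := fun z => dx (cyl v p) z ^ 2) (H := fun z => dy (cyl v p) z ^ 2)
    (hcdx.pow 2) (hcdy.pow 2) hsb] at hp1
  have hDD : DD (cyl v p) s = cint (fun z => dx (cyl v p) z ^ 2) s -
      (cint (dx (cyl v p)) s) ^ 2 / (2 * π) := rfl
  rw [h.flux hsb] at hDD
  have hff : cint (ff v V lam p) s ≤ 2 * π * κ := by
    rw [← cint_const κ s]
    exact cint_mono h.ffc continuousOn_const hsb fun z hz =>
      hffκ z (by linarith [hs.1]) (by linarith [hs.2])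
  set c0 := π / (Vp / Vm) * Real.exp (-((Vp / Vm) / 8)) with hc0
  have hc0p : 0 < c0 := by positivity
  have hM0 : c0 ≤ MM v V lam p s := (h.MM_s0 (by linarith)).trans
    (h.MM_mono (by linarith [hs.1]) hsb)
  refine le_trans ?_ (h.MM_mono (s := s) (t := a + T) (by linarith [hs.2]) (by linarith))
  set M := MM v V lam p s with hMdef
  set Z := (2 * (32 * π ^ 5 * κ ^ 2 + 4 * π * B ^ 2 * X) + κ ^ 2 + 8 * π ^ 3 * κ ^ 2) / 4 + 2 * π * κ
    with hZ
  have hX0 : 0 < X := Real.exp_pos _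
  have hZ0 : 0 ≤ Z := by positivity
  have hq : (-M) ^ 2 / (2 * π) = 2 * (M * (M / (4 * π))) := by field_simp; ring
  have key : M * (2 - η - M / (4 * π)) ≤ Z := by
    rw [hq] at hDD
    have : M * (2 - η - M / (4 * π)) = (2 - η) * M - M * (M / (4 * π)) := by ring
    rw [this]
    linarith
  by_contra hlt
  push Not at hlt
  have e1 : Z / c0 < 2 - η - M / (4 * π) := by
    have : 4 * π / c0 * Z = 4 * π * (Z / c0) := by ring
    rw [this] at hlt
    have e2 : M / (4 * π) < 2 - η - Z / c0 := by
      rw [div_lt_iff₀ (by positivity)]; linarith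
    linarith
  have e3 : c0 * (Z / c0) = Z := by field_simp
  have e4 : 0 ≤ Z / c0 := by positivity
  nlinarith

/-- Pigeonhole. -/
lemma pigeon {M : ℕ → ℝ} {N : ℕ} {Mt : ℝ} (hN : 0 < N) (h0 : 0 ≤ M 0) (h1 : M N ≤ Mt) :
    ∃ i < N, M (i + 1) - M i ≤ Mt / N := by
  by_contra hc
  push Not at hc
  have h2 : ∑ i ∈ Finset.range N, Mt / N < ∑ i ∈ Finset.range N, (M (i + 1) - M i) :=
    Finset.sum_lt_sum_of_nonempty (by simpa using hN.ne') fun i hi => hc i (Finset.mem_range.1 hi)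
  rw [Finset.sum_range_sub, Finset.sum_const, Finset.card_range, nsmul_eq_mul,
    mul_div_cancel₀ _ (by exact_mod_cast hN.ne')] at h2
  linarith

lemma LD.A_step (h : LD v V lam p b Vm Vp s0 Mt) {N : ℕ} {T η s1 : ℝ} (hN : 0 < N) (hT : 4 ≤ T)
    (hb : s0 + N * T + 2 ≤ b) (hs1 : s1 ≤ b) (hTs : s0 + N * T < s1)
    (hη : ∀ z ∈ hp s1, |dx (cyl V p) z| ≤ η * cyl V p z) (hMt : 0 < Mt)
    (hsm : Mt / N < π / (8 * (Vp / Vm))) :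
    8 * π - 4 * π * η - 4 * π / (π / (Vp / Vm) * Real.exp (-((Vp / Vm) / 8))) *
      ((2 * (32 * π ^ 5 * (8 * (Vp / Vm) * (Mt / N) / π) ^ 2 +
        4 * π * (Vp / Vm + 2 * Mt / π * (N * T + 1)) ^ 2 * Real.exp (-(1 / (2 * π)) * (T / 2 - 2)))
        + (8 * (Vp / Vm) * (Mt / N) / π) ^ 2 + 8 * π ^ 3 * (8 * (Vp / Vm) * (Mt / N) / π) ^ 2) / 4
        + 2 * π * (8 * (Vp / Vm) * (Mt / N) / π)) ≤ MM v V lam p (s0 + N * T) := by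
  have hN' : (0:ℝ) < N := by exact_mod_cast hN
  obtain ⟨i, hi, hM⟩ := pigeon (M := fun i => MM v V lam p (s0 + i * T)) (N := N) (Mt := Mt) hN
    (h.MM_nonneg (by simp; nlinarith)) (h.MM_le (by linarith))
  have hi' : (i:ℝ) + 1 ≤ N := by exact_mod_cast hi
  have hle : s0 + i * T + T ≤ s0 + N * T := by nlinarith
  have e : s0 + ((i + 1 : ℕ) : ℝ) * T = s0 + i * T + T := by push_cast; ring
  simp only [e] at hM
  have hi0 : (0:ℝ) ≤ i := by positivity
  refine (h.A_window (a := s0 + i * T) (T := T) (η := η) (η0 := Mt / N) (s1 := s1)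
    (by nlinarith) hT (by linarith) hs1 (by linarith) hη (by positivity) hM hsm rfl
    (B := Vp / Vm + 2 * Mt / π * (N * T + 1)) ?_).trans
    (h.MM_mono hle (by linarith))
  intro z hz
  have := h.G_le (z := z) (t := s0 + N * T) (by linarith) (by linarith) (by nlinarith)
  have e2 : s0 + N * T + 1 - s0 = N * T + 1 := by ring
  rwa [e2] at this

end LDsec3

lemma A_params {Λ Mt ε : ℝ} (hΛ : 0 < Λ) (hε : 0 < ε) :
    ∃ (N : ℕ) (T : ℝ), 0 < N ∧ 4 ≤ T ∧ Mt / N < π / (8 * Λ) ∧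
    4 * π / (π / Λ * Real.exp (-(Λ / 8))) *
      ((2 * (32 * π ^ 5 * (8 * Λ * (Mt / N) / π) ^ 2 +
        4 * π * (Λ + 2 * Mt / π * (N * T + 1)) ^ 2 * Real.exp (-(1 / (2 * π)) * (T / 2 - 2)))
        + (8 * Λ * (Mt / N) / π) ^ 2 + 8 * π ^ 3 * (8 * Λ * (Mt / N) / π) ^ 2) / 4
        + 2 * π * (8 * Λ * (Mt / N) / π)) < ε := by
  have hpi := pi_pos
  have t0 : Tendsto (fun N : ℕ => Mt / (N:ℝ)) atTop (𝓝 0) :=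
    tendsto_const_nhds.div_atTop tendsto_natCast_atTop_atTop
  set C := 4 * π / (π / Λ * Real.exp (-(Λ / 8))) with hC
  have t1 : Tendsto (fun N : ℕ => C *
      ((2 * (32 * π ^ 5 * (8 * Λ * (Mt / N) / π) ^ 2 + 0)
        + (8 * Λ * (Mt / N) / π) ^ 2 + 8 * π ^ 3 * (8 * Λ * (Mt / N) / π) ^ 2) / 4
        + 2 * π * (8 * Λ * (Mt / N) / π))) atTop (𝓝 0) := by
    have hc : Continuous fun x : ℝ => C *
      ((2 * (32 * π ^ 5 * (8 * Λ * x / π) ^ 2 + 0)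
        + (8 * Λ * x / π) ^ 2 + 8 * π ^ 3 * (8 * Λ * x / π) ^ 2) / 4
        + 2 * π * (8 * Λ * x / π)) := by fun_prop
    have := (hc.tendsto 0).comp t0
    simpa [Function.comp_def] using this
  obtain ⟨N, hN1, hN2, hN3⟩ := ((t1.eventually_lt_const hε).and
    ((t0.eventually_lt_const (show 0 < π / (8 * Λ) by positivity)).and
      (eventually_gt_atTop 0))).exists
  have t2 : Tendsto (fun T : ℝ => (Λ + 2 * Mt / π * (N * T + 1)) ^ 2 *
      Real.exp (-(1 / (2 * π)) * (T / 2 - 2))) atTop (𝓝 0) := by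
    have a0 := fun n : ℕ => Real.tendsto_pow_mul_exp_neg_atTop_nhds_zero n
    have sc : Tendsto (fun T : ℝ => T / (4 * π)) atTop atTop :=
      tendsto_id.atTop_div_const (by positivity)
    have b0 := (a0 0).comp sc
    have b1 := (a0 1).comp sc
    have b2 := (a0 2).comp sc
    have := (((b0.const_mul ((Λ + 2 * Mt / π) ^ 2)).add
      (b1.const_mul (2 * (Λ + 2 * Mt / π) * (2 * Mt / π * N) * (4 * π)))).add
      (b2.const_mul ((2 * Mt / π * N * (4 * π)) ^ 2))).const_mul (Real.exp (1 / π))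
    simp only [mul_zero, add_zero] at this
    refine this.congr fun T => ?_
    have e : Real.exp (-(1 / (2 * π)) * (T / 2 - 2)) = Real.exp (1 / π) * Real.exp (-(T / (4 * π))) := by
      rw [← Real.exp_add]; congr 1; field_simp; ring
    rw [e]
    simp only [Function.comp]
    have e2 : T = T / (4 * π) * (4 * π) := by field_simp
    set y := T / (4 * π)
    rw [e2]; ring
  have t3 : Tendsto (fun T : ℝ => C *
      ((2 * (32 * π ^ 5 * (8 * Λ * (Mt / N) / π) ^ 2 +
        4 * π * (Λ + 2 * Mt / π * (N * T + 1)) ^ 2 * Real.exp (-(1 / (2 * π)) * (T / 2 - 2)))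
        + (8 * Λ * (Mt / N) / π) ^ 2 + 8 * π ^ 3 * (8 * Λ * (Mt / N) / π) ^ 2) / 4
        + 2 * π * (8 * Λ * (Mt / N) / π))) atTop (𝓝 (C *
      ((2 * (32 * π ^ 5 * (8 * Λ * (Mt / N) / π) ^ 2 + 0)
        + (8 * Λ * (Mt / N) / π) ^ 2 + 8 * π ^ 3 * (8 * Λ * (Mt / N) / π) ^ 2) / 4
        + 2 * π * (8 * Λ * (Mt / N) / π)))) := by
    have t4 : Tendsto (fun T : ℝ => 4 * π * (Λ + 2 * Mt / π * (N * T + 1)) ^ 2 *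
        Real.exp (-(1 / (2 * π)) * (T / 2 - 2))) atTop (𝓝 0) := by
      have := t2.const_mul (4 * π)
      rw [mul_zero] at this
      exact this.congr fun T => by ring
    exact (((((t4.const_add _).const_mul 2).add_const _).add_const _).div_const 4 |>.add_const _).const_mul C
  obtain ⟨T, hT1, hT2⟩ := ((t3.eventually_lt_const hN1).and (eventually_ge_atTop 4)).exists
  exact ⟨N, T, hN3, hT2, hN2, hT1⟩

/-- Lemma A: concentration of mass `8π`. -/
lemma lemA {Vm Vp Mt ε : ℝ} (hVm : 0 < Vm) (hVp : 0 < Vp) (hMt : 0 < Mt) (hε : 0 < ε) :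
    ∃ S : ℝ, 0 < S ∧ ∀ (v V : ℂ → ℝ) (lam : ℝ) (p : ℂ) (b s0 s1 : ℝ),
      LD v V lam p b Vm Vp s0 Mt → s0 + S + 2 ≤ b → s1 ≤ b → s0 + S < s1 →
      (∀ z ∈ hp s1, |dx (cyl V p) z| ≤ ε / (8 * π) * cyl V p z) →
      8 * π - ε ≤ MM v V lam p (s0 + S) := by
  obtain ⟨N, T, hN, hT, h1, h2⟩ := A_params (Λ := Vp / Vm) (Mt := Mt) (ε := ε / 2) (by positivity)
    (by positivity)
  have hpi := pi_pos
  have hN' : (0:ℝ) < N := by exact_mod_cast hN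
  refine ⟨N * T, by nlinarith, fun v V lam p b s0 s1 h hb hs1 hTs hη => ?_⟩
  have := h.A_step hN hT hb hs1 hTs hη hMt h1
  have e : 4 * π * (ε / (8 * π)) = ε / 2 := by field_simp; ring
  linarith

lemma LL_sq_lower {u : ℂ → ℝ} {O : Set ℂ} (hO : IsOpen O) (hu : ContDiffOn ℝ 2 u O) {z : ℂ}
    (hz : z ∈ O) : 2 * (u z * LL u z) ≤ LL (fun z => u z ^ 2) z := by
  have h1 : ContDiffOn ℝ 1 u O := hu.of_le (by norm_num)
  have hd : ∀ y ∈ O, DifferentiableAt ℝ u y := fun y hy => diffAt_of hO h1 hy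
  have e1 : dx (fun z => u z ^ 2) =ᶠ[𝓝 z] fun z => (2 * u z) * dx u z := by
    filter_upwards [hO.mem_nhds hz] with y hy
    rw [dx_sq (hd y hy)]; ring
  have e2 : dy (fun z => u z ^ 2) =ᶠ[𝓝 z] fun z => (2 * u z) * dy u z := by
    filter_upwards [hO.mem_nhds hz] with y hy
    rw [dy_sq (hd y hy)]; ring
  have c1 : dx (fun z => 2 * u z) z = 2 * dx u z := by
    rw [dx_mul (u := fun _ => 2) (differentiableAt_const _) (hd z hz)]; simp [dx]
  have c2 : dy (fun z => 2 * u z) z = 2 * dy u z := by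
    rw [dy_mul (u := fun _ => 2) (differentiableAt_const _) (hd z hz)]; simp [dy]
  have hd2 : DifferentiableAt ℝ (fun z => 2 * u z) z := (hd z hz).const_mul 2
  unfold LL
  rw [dx_congr e1, dy_congr e2, dx_mul (u := fun z => 2 * u z) hd2 (diffAt_of hO (C1_dx hO hu) hz),
    dy_mul (u := fun z => 2 * u z) hd2 (diffAt_of hO (C1_dy hO hu) hz), c1, c2]
  nlinarith [sq_nonneg (dx u z), sq_nonneg (dy u z)]

/-- local eigenfunction data -/
structure ED (w v V : ℂ → ℝ) (lam mu : ℝ) (p : ℂ) (b : ℝ) : Prop where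
  hw : ContDiffOn ℝ 2 w (ball p (Real.exp b))
  hpde : ∀ x ∈ ball p (Real.exp b), LL w x = -(mu * (lam * V x * Real.exp (v x)) * w x)
  hb : ∀ x ∈ ball p (Real.exp b), |w x| ≤ 1
  hmu : 0 ≤ mu

section EDsec
variable {w v V : ℂ → ℝ} {lam mu : ℝ} {p : ℂ} {b Vm Vp s0 Mt : ℝ}

lemma ED.W2 (e : ED w v V lam mu p b) : ContDiffOn ℝ 2 (cyl w p) (hp b) := cyl_contDiffOn e.hw
lemma ED.W1 (e : ED w v V lam mu p b) : ContDiffOn ℝ 1 (cyl w p) (hp b) :=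
  e.W2.of_le (by norm_num)
lemma ED.LLW (e : ED w v V lam mu p b) {z : ℂ} (hz : z ∈ hp b) :
    LL (cyl w p) z = - (mu * (ff v V lam p z * cyl w p z)) := by
  rw [LL_cyl e.hw hz, e.hpde _ (psi_mem hz), ff]; simp only [cyl]; ring
lemma ED.Wb (e : ED w v V lam mu p b) {z : ℂ} (hz : z ∈ hp b) : |cyl w p z| ≤ 1 :=
  e.hb _ (psi_mem hz)

lemma ED.g_deriv (e : ED w v V lam mu p b) (h : LD v V lam p b Vm Vp s0 Mt) (c : ℝ) {s : ℝ}
    (hs : s < b) : HasDerivAt (fun s => cint (dx (cyl w p)) s + c * mu * MM v V lam p s)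
      (- mu * cint (fun z => ff v V lam p z * (cyl w p z - c)) s) s := by
  refine ((flux_deriv e.hw hs).fun_add ((h.MM_deriv hs).const_mul (c * mu))).congr_deriv ?_
  have hW := e.W1.continuousOn
  have e1 : cint (LL (cyl w p)) s = - mu * cint (fun z => ff v V lam p z * cyl w p z) s := by
    rw [← cint_mul]
    refine cint_congr fun z hz => ?_
    rw [e.LLW (by simp [hp, hz, hs])]; ring
  have e2 : cint (fun z => ff v V lam p z * (cyl w p z - c)) s =
      cint (fun z => ff v V lam p z * cyl w p z) s - c * cint (ff v V lam p) s := by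
    rw [← cint_mul, ← cint_sub (G := fun z => ff v V lam p z * cyl w p z)
      (H := fun z => c * ff v V lam p z) (h.ffc.mul hW) (continuousOn_const.mul h.ffc) hs]
    exact cint_congr fun z _ => by ring
  rw [e1, e2]; ring

lemma ED.g_bd (e : ED w v V lam mu p b) (h : LD v V lam p b Vm Vp s0 Mt) {c θ s : ℝ}
    (hs : s < b) (hθ : ∀ z : ℂ, z.re = s → |cyl w p z - c| ≤ θ) :
    |cint (fun z => ff v V lam p z * (cyl w p z - c)) s| ≤ θ * cint (ff v V lam p) s := by
  have hc : ContinuousOn (fun z => ff v V lam p z * (cyl w p z - c)) (hp b) :=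
    h.ffc.mul (e.W1.continuousOn.sub continuousOn_const)
  have hc2 : ContinuousOn (fun z => θ * ff v V lam p z) (hp b) := continuousOn_const.mul h.ffc
  rw [abs_le, ← cint_mul, ← cint_neg]
  constructor
  · refine cint_mono hc2.neg hc hs fun z hz => ?_
    have h1 := abs_le.1 (hθ z hz)
    have h2 := h.ff_pos (z := z) (by simp [hp, hz, hs])
    nlinarith
  · refine cint_mono hc hc2 hs fun z hz => ?_
    have h1 := abs_le.1 (hθ z hz)
    have h2 := h.ff_pos (z := z) (by simp [hp, hz, hs])
    nlinarith

lemma ED.flux_est (e : ED w v V lam mu p b) (h : LD v V lam p b Vm Vp s0 Mt) {c θ σ σ' s : ℝ}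
    (hc : |c| ≤ 1) (hσ : σ < σ') (hσb : σ' ≤ b) (hθ : ∀ z ∈ hp σ', |cyl w p z - c| ≤ θ)
    (hs : σ ≤ s) (hsb : s < b) :
    |cint (dx (cyl w p)) s + c * mu * MM v V lam p s| ≤
      mu * (θ * MM v V lam p σ + 2 * (MM v V lam p s - MM v V lam p σ)) := by
  set g : ℝ → ℝ := fun s => cint (dx (cyl w p)) s + c * mu * MM v V lam p s with hg
  have hmu := e.hmu
  have hbot : Tendsto g atBot (𝓝 0) := by
    simpa using (flux_bot e.hw).add (h.MM_bot.const_mul (c * mu))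
  have h2 : ∀ z ∈ hp b, |cyl w p z - c| ≤ 2 := fun z hz =>
    (abs_sub _ _).trans (by linarith [e.Wb hz])
  have p1 : ∀ ε : ℝ, |ε| = 1 → 0 ≤ mu * θ * MM v V lam p σ + ε * g σ := by
    intro ε hε
    refine lim_le_of_deriv (b := σ') (l := 0)
      (f := fun s => mu * θ * MM v V lam p s + ε * g s)
      (f' := fun s => mu * θ * cint (ff v V lam p) s +
        ε * (- mu * cint (fun z => ff v V lam p z * (cyl w p z - c)) s))
      (fun s hs => ((h.MM_deriv (lt_of_lt_of_le hs hσb)).const_mul _).fun_add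
        ((e.g_deriv h c (lt_of_lt_of_le hs hσb)).const_mul _)) ?_ ?_ hσ
    · intro s hs
      have := e.g_bd h (lt_of_lt_of_le hs hσb) (fun z hz => hθ z (by simp [hp, hz, hs]))
      have h3 : |ε * cint (fun z => ff v V lam p z * (cyl w p z - c)) s| ≤
        θ * cint (ff v V lam p) s := by rw [abs_mul, hε, one_mul]; exact this
      nlinarith [(abs_le.1 h3).1, (abs_le.1 h3).2]
    · simpa using (h.MM_bot.const_mul (mu * θ)).add (hbot.const_mul ε)
  have p2 : ∀ ε : ℝ, |ε| = 1 → mu * 2 * MM v V lam p σ + ε * g σ ≤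
      mu * 2 * MM v V lam p s + ε * g s := by
    intro ε hε
    refine mono_of_deriv (b := b)
      (f := fun s => mu * 2 * MM v V lam p s + ε * g s)
      (f' := fun s => mu * 2 * cint (ff v V lam p) s +
        ε * (- mu * cint (fun z => ff v V lam p z * (cyl w p z - c)) s))
      (fun s hs => ((h.MM_deriv hs).const_mul _).fun_add
        ((e.g_deriv h c hs).const_mul _)) ?_ hs hsb
    · intro s hs
      have := e.g_bd h hs (fun z hz => h2 z (by simp [hp, hz, hs]))
      have h3 : |ε * cint (fun z => ff v V lam p z * (cyl w p z - c)) s| ≤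
        2 * cint (ff v V lam p) s := by rw [abs_mul, hε, one_mul]; exact this
      nlinarith [(abs_le.1 h3).1, (abs_le.1 h3).2]
  have a1 := p1 1 (by simp)
  have a2 := p1 (-1) (by simp)
  have b1 := p2 1 (by simp)
  have b2 := p2 (-1) (by simp)
  change |g s| ≤ _
  rw [abs_le]
  constructor <;> nlinarith

lemma ED.cintW_abs (e : ED w v V lam mu p b) {s : ℝ} (hs : s < b) : |cint (cyl w p) s| ≤ 2 * π := by
  simpa using cint_abs_le (G := cyl w p) (s := s) (c := 1) fun z hz => e.Wb (by simp [hp, hz, hs])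

/-- Lemma C: `μ (t - σ)` is bounded. -/
lemma ED.mu_bound (e : ED w v V lam mu p b) (h : LD v V lam p b Vm Vp s0 Mt) {c θ σ σ' t : ℝ}
    (hc : |c| ≤ 1) (hc0 : c ≠ 0) (hσ : σ < σ') (hσb : σ' ≤ b)
    (hθ : ∀ z ∈ hp σ', |cyl w p z - c| ≤ θ) (hst : σ ≤ t) (ht : t < b)
    (hM : 6 * π ≤ MM v V lam p σ)
    (hsm : θ * MM v V lam p σ + 2 * (MM v V lam p t - MM v V lam p σ) ≤ |c| * π) :
    mu * (t - σ) ≤ 1 / |c| := by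
  have hpi := pi_pos
  have hmu := e.hmu
  have hcp : 0 < |c| := abs_pos.2 hc0
  have hder : ∀ s ∈ Set.Icc σ t, 5 * π * |c| * mu ≤ -(c / |c|) * cint (dx (cyl w p)) s := by
    intro s hs
    have h1 := e.flux_est h hc hσ hσb hθ hs.1 (lt_of_le_of_lt hs.2 ht)
    have h2 := h.MM_mono hs.2 ht
    have h3 := h.MM_mono hs.1 (lt_of_le_of_lt hs.2 ht)
    have h4 : |cint (dx (cyl w p)) s + c * mu * MM v V lam p s| ≤ mu * (|c| * π) :=
      h1.trans (mul_le_mul_of_nonneg_left (by linarith) hmu)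
    have h5 : |(c / |c|) * (cint (dx (cyl w p)) s + c * mu * MM v V lam p s)| ≤ mu * (|c| * π) := by
      rw [abs_mul, abs_div, abs_abs, div_self hcp.ne', one_mul]; exact h4
    have h6 : (c / |c|) * (c * mu * MM v V lam p s) = |c| * (mu * MM v V lam p s) := by
      have : c * c = |c| * |c| := (abs_mul_abs_self c).symm
      field_simp
      rw [sq, sq]
      exact (abs_mul_abs_self c).symm ▸ rfl
    rw [mul_add, h6] at h5
    have h7 := (abs_le.1 h5).2
    have h8 : |c| * (mu * (6 * π)) ≤ |c| * (mu * MM v V lam p s) := by gcongr; linarith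
    linarith
  have hmon : 5 * π * |c| * mu * (t - σ) ≤
      -(c / |c|) * cint (cyl w p) t - -(c / |c|) * cint (cyl w p) σ := by
    have hmv := Convex.mul_sub_le_image_sub_of_le_deriv (D := Set.Icc σ t)
      (f := fun s => -(c / |c|) * cint (cyl w p) s) (convex_Icc σ t) (C := 5 * π * |c| * mu)
      (fun s hs => ((cint_deriv e.W1 (lt_of_le_of_lt hs.2 ht)).const_mul _).continuousAt.continuousWithinAt)
      (fun s hs => by
        rw [interior_Icc] at hs
        exact ((cint_deriv e.W1 (hs.2.trans ht)).const_mul _).differentiableAt.differentiableWithinAt)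
      (fun s hs => by
        rw [interior_Icc] at hs
        rw [((cint_deriv e.W1 (hs.2.trans ht)).const_mul _).deriv]
        exact hder s ⟨hs.1.le, hs.2.le⟩)
    exact hmv σ (Set.left_mem_Icc.2 hst) t (Set.right_mem_Icc.2 hst) hst
  have k : ∀ s < b, |-(c / |c|) * cint (cyl w p) s| ≤ 2 * π := by
    intro s hs
    rw [abs_mul, abs_neg, abs_div, abs_abs, div_self hcp.ne', one_mul]
    exact e.cintW_abs hs
  have k1 := (abs_le.1 (k t ht)).2
  have k2 := (abs_le.1 (k σ (lt_of_le_of_lt hst ht))).1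
  rw [le_div_iff₀ hcp]
  have : π * (5 * (mu * (t - σ) * |c|)) ≤ π * 4 := by linarith
  have := le_of_mul_le_mul_left this hpi
  linarith

/-- Lemma D: smallness in the neck. -/
lemma ED.neck (e : ED w v V lam mu p b) (h : LD v V lam p b Vm Vp s0 Mt) {θ σ σ' t ν κ α : ℝ}
    (hσ : σ + 1 < σ') (hσb : σ' ≤ b)
    (hθ : ∀ z ∈ hp σ', |cyl w p z| ≤ θ) (hst : σ + 6 ≤ t) (ht : t < b)
    (hν : MM v V lam p t - MM v V lam p σ ≤ ν) (hsm : ν < π / (8 * (Vp / Vm)))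
    (hκ : κ = 8 * (Vp / Vm) * ν / π)
    (hα : θ * MM v V lam p σ + 2 * (MM v V lam p t - MM v V lam p σ) ≤ α)
    {z : ℂ} (hz1 : σ + 3 ≤ z.re) (hz2 : z.re ≤ t - 3) :
    π * cyl w p z ^ 2 ≤ 2 * (32 * π ^ 5 * (mu * κ) ^ 2 + 2 * π * θ ^ 2 +
      2 * π * Real.exp (-(1 / (2 * π)) * (t - 2 - z.re)) +
      (2 * π * θ + mu * (t - σ) * α) ^ 2 / (2 * π)) + π / 8 * (2 * (mu * κ)) := by
  have hpi := pi_pos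
  have hmu := e.hmu
  have hΛ := h.lam1
  have hθ0 : 0 ≤ θ := (abs_nonneg _).trans (hθ (σ : ℂ) (by simp [hp]; linarith))
  have hWc := e.W1.continuousOn
  have hffκ : ∀ z : ℂ, σ + 1 ≤ z.re → z.re ≤ t - 1 → ff v V lam p z ≤ κ := by
    intro z h1 h2
    rw [hκ]
    refine h.eps (by linarith) ?_ hsm
    have e1 := h.MM_mono (s := z.re + 1) (t := t) (by linarith) (by linarith)
    have e2 := h.MM_mono (s := σ) (t := z.re - 1) (by linarith) (by linarith)
    linarith
  have hfW : ∀ z : ℂ, σ + 1 ≤ z.re → z.re ≤ t - 1 → |ff v V lam p z * cyl w p z| ≤ κ := by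
    intro z h1 h2
    have hz : z ∈ hp b := by simp only [hp, Set.mem_ofPred_eq]; linarith
    have h3 := hffκ z h1 h2
    have h4 := h.ff_pos hz
    rw [abs_mul, abs_of_pos h4]
    nlinarith [e.Wb hz, abs_nonneg (cyl w p z)]
  have hLL : ∀ z : ℂ, σ + 1 ≤ z.re → z.re ≤ t - 1 → |LL (cyl w p) z| ≤ mu * κ := by
    intro z h1 h2
    have hz : z ∈ hp b := by simp only [hp, Set.mem_ofPred_eq]; linarith
    rw [e.LLW hz, abs_neg, abs_mul, abs_of_nonneg hmu]
    exact mul_le_mul_of_nonneg_left (hfW z h1 h2) hmu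
  have hα0 : ∀ s ∈ Set.Icc σ t, |cint (dx (cyl w p)) s| ≤ mu * α := by
    intro s hs
    have h1 := e.flux_est h (c := 0) (θ := θ) (by simp) (by linarith : σ < σ') hσb
      (by simpa using hθ) hs.1 (by linarith [hs.2])
    simp only [zero_mul, add_zero] at h1
    refine h1.trans (mul_le_mul_of_nonneg_left ?_ hmu)
    linarith [h.MM_mono hs.2 ht]
  have hA : ∀ s ∈ Set.Icc σ t, |cint (cyl w p) s| ≤ 2 * π * θ + mu * (t - σ) * α := by
    intro s hs
    have h1 : |cint (cyl w p) σ| ≤ 2 * π * θ := cint_abs_le fun z hz => hθ z (by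
      simp only [hp, Set.mem_ofPred_eq, hz]; linarith)
    have h2 := (convex_Icc σ t).norm_image_sub_le_of_norm_hasDerivWithin_le
      (f := cint (cyl w p)) (f' := cint (dx (cyl w p))) (C := mu * α)
      (fun x hx => (cint_deriv e.W1 (by linarith [hx.2])).hasDerivWithinAt)
      (fun x hx => hα0 x hx) (Set.left_mem_Icc.2 (by linarith)) hs
    rw [Real.norm_eq_abs, Real.norm_eq_abs, abs_of_nonneg (by linarith [hs.1] : 0 ≤ s - σ)] at h2
    have h3 : 0 ≤ mu * α := (abs_nonneg _).trans (hα0 s hs)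
    have h4 : mu * α * (s - σ) ≤ mu * α * (t - σ) := mul_le_mul_of_nonneg_left (by linarith [hs.2]) h3
    have h5 : |cint (cyl w p) s| ≤ |cint (cyl w p) s - cint (cyl w p) σ| + |cint (cyl w p) σ| := by
      have := abs_add_le (cint (cyl w p) s - cint (cyl w p) σ) (cint (cyl w p) σ)
      simpa using this
    linarith
  have hEσ : EE (cyl w p) (σ + 1) ≤ 2 * π * θ ^ 2 := by
    refine (EE_le hWc (by linarith : σ + 1 < b) 0).trans ?_
    rw [← cint_const (θ ^ 2) (σ + 1)]
    refine cint_mono (b := b) ((hWc.sub continuousOn_const).pow 2) continuousOn_const (by linarith)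
      fun z hz => ?_
    rw [sub_zero]
    exact sq_le_sq' (by linarith [(abs_le.1 (hθ z (by simp only [hp, Set.mem_ofPred_eq, hz]; linarith))).1])
      (abs_le.1 (hθ z (by simp only [hp, Set.mem_ofPred_eq, hz]; linarith))).2
  have hEt : EE (cyl w p) (t - 1) ≤ 2 * π := by
    refine (EE_le hWc (by linarith : t - 1 < b) 0).trans ?_
    have := cint_const 1 (t - 1)
    rw [mul_one] at this
    rw [← this]
    refine cint_mono (b := b) ((hWc.sub continuousOn_const).pow 2) continuousOn_const (by linarith)
      fun z hz => ?_
    rw [sub_zero]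
    have := e.Wb (z := z) (by simp only [hp, Set.mem_ofPred_eq, hz]; linarith)
    have := abs_le.1 this
    nlinarith
  have hE : ∀ s ∈ Set.Icc (z.re - 1) (z.re + 1), EE (cyl w p) s ≤ 32 * π ^ 5 * (mu * κ) ^ 2 +
      2 * π * θ ^ 2 + 2 * π * Real.exp (-(1 / (2 * π)) * (t - 2 - z.re)) := by
    intro s hs
    have := comparison (E := EE (cyl w p)) (E1 := EE1 (cyl w p)) (E2 := EE2 (cyl w p))
      (a := σ + 1) (b := t - 1) (c := 1 / (2 * π)) (K := 8 * π ^ 3 * (mu * κ) ^ 2)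
      (fun s hs => EE_deriv e.W2 (by linarith [hs.2]))
      (fun s hs => EE1_deriv e.W2 (by linarith [hs.2]) (cyl_per w p))
      (fun s hs => EE2_lower2 e.W2 (by linarith [hs.2]) fun z hz => hLL z (by linarith [hs.1])
        (by linarith [hs.2])) (by positivity) (by positivity)
      (EE_nonneg hWc (by linarith)) (EE_nonneg hWc (by linarith))
      (s := s) ⟨by linarith [hs.1], by linarith [hs.2]⟩
    have e1 : 8 * π ^ 3 * (mu * κ) ^ 2 / (1 / (2 * π)) ^ 2 = 32 * π ^ 5 * (mu * κ) ^ 2 := by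
      field_simp; ring
    have hc0 : 0 < 1 / (2 * π) := by positivity
    have e2 : Real.exp (-(1 / (2 * π)) * (s - (σ + 1))) ≤ 1 :=
      Real.exp_le_one_iff.2 (by nlinarith [hs.1])
    have e3 : Real.exp (-(1 / (2 * π)) * (t - 1 - s)) ≤ Real.exp (-(1 / (2 * π)) * (t - 2 - z.re)) :=
      Real.exp_le_exp.2 (by nlinarith [hs.2])
    rw [e1] at this
    have e4 := mul_le_mul hEσ e2 (Real.exp_pos _).le (by positivity)
    have e5 := mul_le_mul hEt e3 (Real.exp_pos _).le (by positivity)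
    linarith
  refine strip_mv_sup (G := fun z => cyl w p z ^ 2) (b := b) (e.W2.pow 2) ?_ (fun z _ => sq_nonneg _)
    (by linarith) ?_ ?_
  · intro z; simp only [cyl_per w p z]
  · intro y hy
    rw [abs_lt] at hy
    have hyb : y ∈ hp b := by simp only [hp, Set.mem_ofPred_eq]; linarith
    have h1 := LL_sq_lower (hp_open b) e.W2 hyb
    have h2 := hLL y (by linarith) (by linarith)
    have h3 := e.Wb hyb
    have h4 : |cyl w p y * LL (cyl w p) y| ≤ mu * κ := by
      rw [abs_mul]; nlinarith [abs_nonneg (LL (cyl w p) y), abs_nonneg (cyl w p y)]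
    linarith [(abs_le.1 h4).1]
  · intro s hs
    have h1 : EE (cyl w p) s = cint (fun z => cyl w p z ^ 2) s - (cint (cyl w p) s) ^ 2 / (2 * π) := rfl
    have h2 := hE s hs
    have h3 := hA s ⟨by linarith [hs.1], by linarith [hs.2]⟩
    have h4 : (cint (cyl w p) s) ^ 2 / (2 * π) ≤ (2 * π * θ + mu * (t - σ) * α) ^ 2 / (2 * π) := by
      gcongr ?_ / _
      exact sq_le_sq' (by linarith [(abs_le.1 h3).1]) (abs_le.1 h3).2
    linarith

end EDsec

/-- regularised positive part -/
def gam (x : ℝ) : ℝ := ∫ t in (0:ℝ)..x, Real.smoothTransition t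

lemma gam_deriv (x : ℝ) : HasDerivAt gam (Real.smoothTransition x) x :=
  intervalIntegral.integral_hasDerivAt_right
    (Real.smoothTransition.continuous.intervalIntegrable _ _)
    (Real.smoothTransition.continuous.stronglyMeasurableAtFilter _ _)
    Real.smoothTransition.continuousAt

lemma gam_contDiff : ContDiff ℝ 2 gam := by
  have : ContDiff ℝ (1 + 1) gam := by
    rw [contDiff_succ_iff_deriv]
    refine ⟨fun x => (gam_deriv x).differentiableAt, by simp, ?_⟩
    have : deriv gam = Real.smoothTransition := funext fun x => (gam_deriv x).deriv
    rw [this]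
    exact Real.smoothTransition.contDiff (n := 1)
  simpa [one_add_one_eq_two] using this

lemma gam_zero {x : ℝ} (hx : x ≤ 0) : gam x = 0 := by
  unfold gam
  rw [intervalIntegral.integral_congr (g := fun _ => 0), intervalIntegral.integral_zero]
  intro t ht
  rw [Set.uIcc_of_ge hx] at ht
  exact Real.smoothTransition.zero_of_nonpos ht.2

lemma gam_nonneg (x : ℝ) : 0 ≤ gam x := by
  rcases le_total x 0 with h | h
  · rw [gam_zero h]
  · exact intervalIntegral.integral_nonneg h fun t _ => Real.smoothTransition.nonneg t

lemma gam_lower (x : ℝ) : x - 1 ≤ gam x := by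
  rcases le_total x 1 with h | h
  · linarith [gam_nonneg x]
  · have h1 := (convex_Icc (1:ℝ) x).mul_sub_le_image_sub_of_le_deriv (f := gam) (C := 1)
      gam_contDiff.continuous.continuousOn
      (gam_contDiff.differentiable (by norm_num)).differentiableOn
      (fun y hy => by
        rw [interior_Icc] at hy
        rw [(gam_deriv y).deriv, Real.smoothTransition.one_of_one_le hy.1.le])
      1 (Set.left_mem_Icc.2 h) x (Set.right_mem_Icc.2 h) h
    linarith [gam_nonneg 1]

lemma LL_congr {u w : ℂ → ℝ} {z : ℂ} (h : u =ᶠ[𝓝 z] w) : LL u z = LL w z := by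
  have h1 : dx u =ᶠ[𝓝 z] dx w := by
    filter_upwards [h.eventually_nhds] with y hy using dx_congr hy
  have h2 : dy u =ᶠ[𝓝 z] dy w := by
    filter_upwards [h.eventually_nhds] with y hy using dy_congr hy
  unfold LL
  rw [dx_congr h1, dy_congr h2]

lemma dx_comp {u : ℂ → ℝ} {g : ℝ → ℝ} {g' : ℝ} {z : ℂ} (hg : HasDerivAt g g' (u z))
    (hu : DifferentiableAt ℝ u z) : dx (fun z => g (u z)) z = g' * dx u z := by
  have := hg.comp_hasFDerivAt z hu.hasFDerivAt
  have h2 := this.fderiv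
  simp only [Function.comp_def] at h2
  simp [dx, h2]

lemma dy_comp {u : ℂ → ℝ} {g : ℝ → ℝ} {g' : ℝ} {z : ℂ} (hg : HasDerivAt g g' (u z))
    (hu : DifferentiableAt ℝ u z) : dy (fun z => g (u z)) z = g' * dy u z := by
  have := hg.comp_hasFDerivAt z hu.hasFDerivAt
  have h2 := this.fderiv
  simp only [Function.comp_def] at h2
  simp [dy, h2]

lemma LL_gam {u : ℂ → ℝ} {O : Set ℂ} (hO : IsOpen O) (hu : ContDiffOn ℝ 2 u O) {z : ℂ}
    (hz : z ∈ O) : Real.smoothTransition (u z) * LL u z ≤ LL (fun z => gam (u z)) z := by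
  have h1 : ContDiffOn ℝ 1 u O := hu.of_le (by norm_num)
  have hd : ∀ y ∈ O, DifferentiableAt ℝ u y := fun y hy => diffAt_of hO h1 hy
  have hst : ∀ x, HasDerivAt Real.smoothTransition (deriv Real.smoothTransition x) x := fun x =>
    ((Real.smoothTransition.contDiff (n := 1)).differentiable (by norm_num) x).hasDerivAt
  have hst0 : ∀ x, 0 ≤ deriv Real.smoothTransition x := fun x =>
    Real.smoothTransition.monotone.deriv_nonneg
  have e1 : dx (fun z => gam (u z)) =ᶠ[𝓝 z] fun z => Real.smoothTransition (u z) * dx u z := by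
    filter_upwards [hO.mem_nhds hz] with y hy using dx_comp (gam_deriv _) (hd y hy)
  have e2 : dy (fun z => gam (u z)) =ᶠ[𝓝 z] fun z => Real.smoothTransition (u z) * dy u z := by
    filter_upwards [hO.mem_nhds hz] with y hy using dy_comp (gam_deriv _) (hd y hy)
  have hd2 : DifferentiableAt ℝ (fun z => Real.smoothTransition (u z)) z :=
    (hst _).differentiableAt.comp z (hd z hz)
  unfold LL
  rw [dx_congr e1, dy_congr e2,
    dx_mul (u := fun z => Real.smoothTransition (u z)) hd2 (diffAt_of hO (C1_dx hO hu) hz),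
    dy_mul (u := fun z => Real.smoothTransition (u z)) hd2 (diffAt_of hO (C1_dy hO hu) hz),
    dx_comp (hst _) (hd z hz), dy_comp (hst _) (hd z hz)]
  have := hst0 (u z)
  nlinarith [mul_nonneg this (sq_nonneg (dx u z)), mul_nonneg this (sq_nonneg (dy u z))]

/-- bound for circle averages -/
lemma avg_bound {O : Set ℂ} (hO : IsOpen O) {p : ℂ} {D : ℝ} (hD : O ⊆ ball p D) {v ρ : ℂ → ℝ}
    (hv : ContDiffOn ℝ 2 v O) (hvc : ContinuousOn v (closure O)) (hbc : ∀ x ∈ frontier O, v x = 0)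
    (hLL : ∀ x ∈ O, LL v x = - ρ x) (hρ : ∀ x ∈ O, 0 ≤ ρ x) (hρi : IntegrableOn ρ O) {Mt : ℝ}
    (hMt : ∫ x in O, ρ x ≤ Mt) {s b : ℝ} (hsb : s < b) (hb : ball p (Real.exp b) ⊆ O)
    (hsD : Real.exp s ≤ D) :
    cint (cyl v p) s ≤ Mt * (Real.log D - s) + 4 * π := by
  classical
  have hpi := pi_pos
  have hD0 : 0 < D := (Real.exp_pos s).trans_le hsD
  set u : ℂ → ℝ := O.indicator (fun x => gam (v x - 1)) with hu
  have hv1 : ContDiffOn ℝ 2 (fun x => v x - 1) O := hv.sub contDiffOn_const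
  have hin : ∀ x ∈ O, u =ᶠ[𝓝 x] fun x => gam (v x - 1) := fun x hx => by
    filter_upwards [hO.mem_nhds hx] with y hy using Set.indicator_of_mem hy _
  have hout : ∀ x ∉ O, u =ᶠ[𝓝 x] fun _ => 0 := by
    intro x hx
    by_cases hxc : x ∈ closure O
    · have hfr : x ∈ frontier O := by rw [hO.frontier_eq]; exact ⟨hxc, hx⟩
      have h1 := (hvc x hxc).eventually_lt (continuousWithinAt_const (b := (1:ℝ))) (by
        rw [hbc x hfr]; norm_num)
      filter_upwards [eventually_nhdsWithin_iff.1 h1] with y hy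
      by_cases hyO : y ∈ O
      · rw [hu, Set.indicator_of_mem hyO]
        exact gam_zero (by linarith [hy (subset_closure hyO)])
      · exact Set.indicator_of_notMem hyO _
    · filter_upwards [isClosed_closure.isOpen_compl.mem_nhds hxc] with y hy
      exact Set.indicator_of_notMem (fun h => hy (subset_closure h)) _
  have huC : ContDiff ℝ 2 u := by
    rw [contDiff_iff_contDiffAt]
    intro x
    by_cases hx : x ∈ O
    · refine ContDiffAt.congr_of_eventuallyEq ?_ (hin x hx)
      exact gam_contDiff.contDiffAt.comp x (hv1.contDiffAt (hO.mem_nhds hx))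
    · exact contDiffAt_const.congr_of_eventuallyEq (hout x hx)
  have hLLu : ∀ x, -(O.indicator ρ x) ≤ LL u x := by
    intro x
    by_cases hx : x ∈ O
    · rw [LL_congr (hin x hx), Set.indicator_of_mem hx]
      refine le_trans ?_ (LL_gam hO hv1 hx)
      have e : LL (fun x => v x - 1) x = LL v x := by
        have d1 : dx (fun x => v x - 1) = dx v := funext fun y => by simp only [dx, fderiv_sub_const]
        have d2 : dy (fun x => v x - 1) = dy v := funext fun y => by simp only [dy, fderiv_sub_const]
        unfold LL; rw [d1, d2]
      rw [e, hLL x hx]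
      have h1 := Real.smoothTransition.le_one (v x - 1)
      have h2 := hρ x hx
      nlinarith
    · rw [LL_congr (hout x hx), Set.indicator_of_notMem hx]
      have d1 : dx (fun _ => 0) = fun _ => 0 := funext fun y => by simp [dx]
      have d2 : dy (fun _ => 0) = fun _ => 0 := funext fun y => by simp [dy]
      unfold LL; rw [d1, d2]; simp [dx, dy]
  have hflux : ∀ s, - Mt ≤ cint (dx (cyl u p)) s := by
    intro s
    rw [flux_eq (b := s + 1) huC.contDiffOn (by linarith)]
    have hi1 : IntegrableOn (LL u) (ball p (Real.exp s)) := by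
      have : Continuous (LL u) := by
        rw [← continuousOn_univ]; exact cont_LL isOpen_univ huC.contDiffOn
      exact (this.continuousOn.integrableOn_compact (isCompact_closedBall p (Real.exp s))).mono_set
        ball_subset_closedBall
    have hi2 : Integrable (O.indicator ρ) := hρi.integrable_indicator hO.measurableSet
    have h1 : ∫ x in ball p (Real.exp s), O.indicator ρ x ≤ Mt := by
      refine le_trans (setIntegral_le_integral hi2 ?_) ?_
      · exact Filter.Eventually.of_forall fun x => Set.indicator_nonneg hρ x
      · rw [integral_indicator hO.measurableSet]; exact hMt
    have h2 : ∫ x in ball p (Real.exp s), -(O.indicator ρ x) ≤ ∫ x in ball p (Real.exp s), LL u x :=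
      setIntegral_mono hi2.integrableOn.neg hi1 hLLu
    rw [integral_neg] at h2
    linarith
  have hu2 : ∀ B, ContDiffOn ℝ 1 (cyl u p) (hp B) := fun B =>
    (cyl_contDiffOn (b := B) huC.contDiffOn).of_le (by norm_num)
  have hu0 : cint (cyl u p) (Real.log D) = 0 := by
    have : cint (cyl u p) (Real.log D) = cint (fun _ => 0) (Real.log D) := by
      refine cint_congr fun z hz => ?_
      change O.indicator (fun x => gam (v x - 1)) (p + Complex.exp z) = 0
      refine Set.indicator_of_notMem (fun h => ?_) _
      have h1 := hD h
      rw [mem_ball, dist_eq_norm, add_sub_cancel_left, Complex.norm_exp, hz, Real.exp_log hD0] at h1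
      exact lt_irrefl _ h1
    rw [this, cint_const, mul_zero]
  have hsl : s ≤ Real.log D := (Real.le_log_iff_exp_le hD0).2 hsD
  have hm := mono_of_deriv (b := Real.log D + 1) (f := fun s => cint (cyl u p) s + Mt * s)
    (f' := fun s => cint (dx (cyl u p)) s + Mt * 1)
    (fun s hs => (cint_deriv (hu2 _) hs).fun_add ((hasDerivAt_id s).const_mul Mt))
    (fun s _ => by linarith [hflux s]) hsl (by linarith)
  simp only [hu0] at hm
  have hcv : ContinuousOn (cyl v p) (hp b) := cyl_continuousOn (hv.continuousOn.mono hb)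
  have hfin : cint (cyl v p) s ≤ cint (fun z => cyl u p z + 2) s := by
    refine cint_mono hcv ((hu2 b).continuousOn.add continuousOn_const) hsb fun z hz => ?_
    have hmem : p + Complex.exp z ∈ O := hb (psi_mem (by simp [hp, hz, hsb]))
    have : cyl u p z = gam (cyl v p z - 1) :=
      Set.indicator_of_mem hmem (fun x => gam (v x - 1))
    rw [this]
    linarith [gam_lower (cyl v p z - 1)]
  rw [cint_add (H := fun _ => 2) (hu2 b).continuousOn continuousOn_const hsb, cint_const] at hfin
  linarith

lemma LL_nonneg_of_min {u : ℂ → ℝ} {O : Set ℂ} (hO : IsOpen O) (hu : ContDiffOn ℝ 2 u O) {z : ℂ}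
    (hz : z ∈ O) (hm : IsLocalMin u z) : 0 ≤ LL u z := by
  have hu1 : ContDiffOn ℝ 1 u O := hu.of_le (by norm_num)
  have ez : ((z.re : ℂ) + z.im * Complex.I) = z := Complex.re_add_im z
  have c1 : ContinuousAt (fun s : ℝ => (s : ℂ) + z.im * Complex.I) z.re := by fun_prop
  have c2 : ContinuousAt (fun θ : ℝ => (z.re : ℂ) + θ * Complex.I) z.im := by fun_prop
  have m1 : ∀ᶠ s : ℝ in 𝓝 z.re, (s : ℂ) + z.im * Complex.I ∈ O :=
    c1.eventually (by simp only [ez]; exact hO.mem_nhds hz)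
  have m2 : ∀ᶠ θ : ℝ in 𝓝 z.im, (z.re : ℂ) + θ * Complex.I ∈ O :=
    c2.eventually (by simp only [ez]; exact hO.mem_nhds hz)
  have a1 : 0 ≤ dx (dx u) z := by
    have := no_neg_min (g := fun s : ℝ => u (s + z.im * Complex.I))
      (g1 := fun s : ℝ => dx u (s + z.im * Complex.I))
      (g2 := fun s : ℝ => dx (dx u) (s + z.im * Complex.I)) (x := z.re)
      (by filter_upwards [m1] with s hs using slice_hasDeriv_re (diffAt_of hO hu1 hs))
      (slice_hasDeriv_re (diffAt_of hO (C1_dx hO hu) (by rw [ez]; exact hz))) ?_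
    · simpa only [ez] using this
    · have h1 : IsMinFilter u (𝓝 ((z.re : ℂ) + z.im * Complex.I)) ((z.re : ℂ) + z.im * Complex.I) := by
        rw [ez]; exact hm
      exact c1.eventually h1
  have a2 : 0 ≤ dy (dy u) z := by
    have := no_neg_min (g := fun θ : ℝ => u (z.re + θ * Complex.I))
      (g1 := fun θ : ℝ => dy u (z.re + θ * Complex.I))
      (g2 := fun θ : ℝ => dy (dy u) (z.re + θ * Complex.I)) (x := z.im)
      (by filter_upwards [m2] with s hs using slice_hasDeriv_im (diffAt_of hO hu1 hs))
      (slice_hasDeriv_im (diffAt_of hO (C1_dy hO hu) (by rw [ez]; exact hz))) ?_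
    · simpa only [ez] using this
    · have h1 : IsMinFilter u (𝓝 ((z.re : ℂ) + z.im * Complex.I)) ((z.re : ℂ) + z.im * Complex.I) := by
        rw [ez]; exact hm
      exact c2.eventually h1
  unfold LL; linarith

lemma v_nonneg {O : Set ℂ} (hO : IsOpen O) (hbd : IsBounded O) {v ρ : ℂ → ℝ}
    (hv : ContDiffOn ℝ 2 v O) (hvc : ContinuousOn v (closure O)) (hbc : ∀ x ∈ frontier O, v x = 0)
    (hLL : ∀ x ∈ O, LL v x = - ρ x) (hρ : ∀ x ∈ O, 0 < ρ x) {x : ℂ} (hx : x ∈ O) : 0 ≤ v x := by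
  obtain ⟨y, hy, hmin⟩ := hbd.isCompact_closure.exists_isMinOn ⟨x, subset_closure hx⟩ hvc
  have h1 : v y ≤ v x := hmin (subset_closure hx)
  by_cases hyO : y ∈ O
  · have h2 := LL_nonneg_of_min hO hv hyO (hmin.isLocalMin
      (mem_of_superset (hO.mem_nhds hyO) subset_closure))
    rw [hLL y hyO] at h2
    linarith [hρ y hyO]
  · have : v y = 0 := hbc y (by rw [hO.frontier_eq]; exact ⟨hy, hyO⟩)
    linarith

/-- identification of `ℂ` with the plane -/
def eC : ℂ ≃ₗᵢ[ℝ] E2 := Complex.orthonormalBasisOneI.repr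

/-- transported function -/
def tc (f : E2 → ℝ) (z : ℂ) : ℝ := f (eC z)

lemma eC_one : eC 1 = EuclideanSpace.single 0 1 := by
  have := Complex.orthonormalBasisOneI.repr_self 0
  simpa [eC] using this

lemma eC_I : eC Complex.I = EuclideanSpace.single 1 1 := by
  have := Complex.orthonormalBasisOneI.repr_self 1
  simpa [eC] using this

lemma fderiv_tc (f : E2 → ℝ) (z h : ℂ) : fderiv ℝ (tc f) z h = fderiv ℝ f (eC z) (eC h) := by
  have := eC.toContinuousLinearEquiv.comp_right_fderiv (f := f) (x := z)
  have h2 : fderiv ℝ (tc f) z = (fderiv ℝ f (eC z)).comp (eC.toContinuousLinearEquiv : ℂ →L[ℝ] E2) :=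
    this
  rw [h2]; rfl

lemma LL_tc (f : E2 → ℝ) (z : ℂ) : LL (tc f) z = lap f (eC z) := by
  have h1 : dx (tc f) = tc (fun y => fderiv ℝ f y (EuclideanSpace.single 0 1)) := by
    funext z; simp only [dx, fderiv_tc, eC_one, tc]
  have h2 : dy (tc f) = tc (fun y => fderiv ℝ f y (EuclideanSpace.single 1 1)) := by
    funext z; simp only [dy, fderiv_tc, eC_I, tc]
  unfold LL lap
  rw [Fin.sum_univ_two, h1, h2]
  simp only [dx, dy, fderiv_tc, eC_one, eC_I]

lemma tc_contDiffOn {n : WithTop ℕ∞} {f : E2 → ℝ} {A : Set E2} (hf : ContDiffOn ℝ n f A) :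
    ContDiffOn ℝ n (tc f) (eC ⁻¹' A) :=
  hf.comp eC.toContinuousLinearEquiv.contDiff.contDiffOn fun _ h => h

lemma tc_continuousOn {f : E2 → ℝ} {A : Set E2} (hf : ContinuousOn f A) :
    ContinuousOn (tc f) (eC ⁻¹' A) :=
  hf.comp eC.continuous.continuousOn fun _ h => h

lemma eC_ball (x : E2) (r : ℝ) : eC ⁻¹' (ball x r) = ball (eC.symm x) r := by
  ext z
  simp only [Set.mem_preimage, mem_ball]
  rw [← eC.dist_map z (eC.symm x), eC.apply_symm_apply]

lemma eC_closure (A : Set E2) : eC ⁻¹' (closure A) = closure (eC ⁻¹' A) :=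
  eC.toHomeomorph.preimage_closure A

lemma eC_frontier (A : Set E2) : eC ⁻¹' (frontier A) = frontier (eC ⁻¹' A) :=
  eC.toHomeomorph.preimage_frontier A

lemma eC_int (g : E2 → ℝ) (A : Set E2) : ∫ z in eC ⁻¹' A, g (eC z) = ∫ x in A, g x :=
  (Complex.orthonormalBasisOneI.measurePreserving_repr).setIntegral_preimage_emb
    eC.toHomeomorph.measurableEmbedding g A

section SetC
variable {m : ℕ}

/-- density -/
def rho (S : Setting m) (k : ℕ) (x : ℂ) : ℝ :=
  S.lam k * tc S.V x * Real.exp (tc (S.v k) x)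

/-- domain in `ℂ` -/
def Om (S : Setting m) : Set ℂ := eC ⁻¹' S.Ω

/-- centers -/
def pc (S : Setting m) (j : Fin m) (k : ℕ) : ℂ := eC.symm (S.xpt j k)

/-- log of scale -/
def sz (S : Setting m) (j : Fin m) (k : ℕ) : ℝ := Real.log (S.delta j k)

/-- local mass function -/
def mS (S : Setting m) (j : Fin m) (k : ℕ) (s : ℝ) : ℝ :=
  MM (tc (S.v k)) (tc S.V) (S.lam k) (pc S j k) s

variable (S : Setting m)

lemma Om_open : IsOpen (Om S) := S.hopen.preimage eC.continuous

lemma Om_bdd : IsBounded (Om S) := by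
  obtain ⟨r, hr⟩ := S.hbd.subset_ball 0
  refine (isBounded_ball (x := eC.symm 0) (r := r)).subset ?_
  rw [← eC_ball]
  exact Set.preimage_mono hr

lemma xpt_mem (j : Fin m) (k : ℕ) : S.xpt j k ∈ S.Ω := by
  refine S.hR2 j ?_
  have h1 := S.hxpt_mem j k
  have h2 := S.hR
  rw [mem_ball] at h1
  rw [mem_closedBall]; linarith

lemma xball (j : Fin m) (k : ℕ) : ball (S.xpt j k) S.R ⊆ ball (S.xstar j) (2 * S.R) := by
  intro x hx
  have h1 := S.hxpt_mem j k
  rw [mem_ball] at *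
  linarith [dist_triangle x (S.xpt j k) (S.xstar j)]

lemma pball (j : Fin m) (k : ℕ) : ball (pc S j k) S.R ⊆ Om S := by
  rw [pc, ← eC_ball]
  exact Set.preimage_mono ((xball S j k).trans (ball_subset_closedBall.trans (S.hR2 j)))

lemma pc_mem (j : Fin m) (k : ℕ) : pc S j k ∈ Om S := pball S j k (mem_ball_self S.hR)

lemma V_bounds : ∃ Vm Vp : ℝ, 0 < Vm ∧ 0 < Vp ∧ ∀ x ∈ closure S.Ω, Vm ≤ S.V x ∧ S.V x ≤ Vp := by
  have hc := S.hbd.isCompact_closure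
  have hne : (closure S.Ω).Nonempty := S.hconn.nonempty.closure
  obtain ⟨a, ha, hmin⟩ := hc.exists_isMinOn hne S.hVreg.continuousOn
  obtain ⟨c, hc', hmax⟩ := hc.exists_isMaxOn hne S.hVreg.continuousOn
  exact ⟨S.V a, S.V c, S.hVpos a ha, S.hVpos c hc', fun x hx => ⟨hmin hx, hmax hx⟩⟩

lemma V_reg : ContDiffOn ℝ 1 (tc S.V) (Om S) := tc_contDiffOn (S.hVreg.mono subset_closure)
lemma vk_reg (k : ℕ) : ContDiffOn ℝ 2 (tc (S.v k)) (Om S) := tc_contDiffOn (S.hv_reg k)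
lemma V_pos {x : ℂ} (hx : x ∈ Om S) : 0 < tc S.V x := S.hVpos _ (subset_closure hx)

lemma rho_pos (k : ℕ) {x : ℂ} (hx : x ∈ Om S) : 0 < rho S k x := by
  have := V_pos S hx
  have := S.hlam_pos k
  unfold rho; positivity

lemma rho_int (k : ℕ) : IntegrableOn (rho S k) (Om S) := by
  have hc : ContinuousOn (rho S k) (closure (Om S)) := by
    have h1 := tc_continuousOn S.hVreg.continuousOn
    have h2 := tc_continuousOn (S.hv_cont k)
    rw [eC_closure] at h1 h2
    exact (continuousOn_const.mul h1).mul h2.rexp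
  exact (hc.integrableOn_compact (Om_bdd S).isCompact_closure).mono_set subset_closure

lemma rho_total (k : ℕ) : ∫ x in Om S, rho S k x =
    ∫ x in S.Ω, S.lam k * S.V x * Real.exp (S.v k x) :=
  eC_int (fun x => S.lam k * S.V x * Real.exp (S.v k x)) S.Ω

lemma vk_LL (k : ℕ) {x : ℂ} (hx : x ∈ Om S) : LL (tc (S.v k)) x = - rho S k x := by
  rw [LL_tc]
  have := S.hPDE k (eC x) hx
  simp only [rho, tc]; linarith

lemma vk_nonneg (k : ℕ) {x : ℂ} (hx : x ∈ Om S) : 0 ≤ tc (S.v k) x := by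
  refine v_nonneg (Om_open S) (Om_bdd S) (vk_reg S k) ?_ ?_ (fun x hx => vk_LL S k hx)
    (fun x hx => rho_pos S k hx) hx
  · rw [Om, ← eC_closure]; exact tc_continuousOn (S.hv_cont k)
  · rw [Om, ← eC_frontier]; exact fun x hx => S.hBC k _ hx

lemma sq_arg_pos (j : Fin m) (k : ℕ) :
    0 < S.lam k * S.V (S.xpt j k) * Real.exp (S.v k (S.xpt j k)) := by
  have h1 := S.hlam_pos k
  have h2 := S.hVpos _ (subset_closure (xpt_mem S j k))
  positivity

lemma delta_pos (j : Fin m) (k : ℕ) : 0 < S.delta j k :=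
  inv_pos.2 (Real.sqrt_pos.2 (sq_arg_pos S j k))

lemma exp_sz (j : Fin m) (k : ℕ) : Real.exp (sz S j k) = S.delta j k := Real.exp_log (delta_pos S j k)

lemma tc_pc (f : E2 → ℝ) (j : Fin m) (k : ℕ) : tc f (pc S j k) = f (S.xpt j k) := by
  simp [tc, pc]

lemma sz_rel (j : Fin m) (k : ℕ) :
    S.lam k * tc S.V (pc S j k) * Real.exp (tc (S.v k) (pc S j k)) * Real.exp (2 * sz S j k) = 1 := by
  have h := sq_arg_pos S j k
  have e : Real.exp (2 * sz S j k) = S.delta j k ^ 2 := by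
    rw [← exp_sz, ← Real.exp_nat_mul]; norm_num
  rw [e, tc_pc, tc_pc, Setting.delta, inv_pow, Real.sq_sqrt h.le]
  exact mul_inv_cancel₀ h.ne'

lemma sz_log (j : Fin m) (k : ℕ) :
    Real.log (S.lam k) + Real.log (tc S.V (pc S j k)) + tc (S.v k) (pc S j k) + 2 * sz S j k = 0 := by
  have h1 := S.hlam_pos k
  have h2 := V_pos S (pc_mem S j k)
  have := congrArg Real.log (sz_rel S j k)
  rw [Real.log_mul (by positivity) (by positivity), Real.log_mul (by positivity) (by positivity),
    Real.log_mul (by positivity) (by positivity), Real.log_exp, Real.log_exp, Real.log_one] at this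
  exact this

lemma LD_S {Vm Vp Mt : ℝ} (hVm : 0 < Vm) (hV : ∀ x ∈ closure S.Ω, Vm ≤ S.V x ∧ S.V x ≤ Vp) {k : ℕ}
    (hMt : ∫ x in Om S, rho S k x ≤ Mt) (j : Fin m) :
    LD (tc (S.v k)) (tc S.V) (S.lam k) (pc S j k) (Real.log S.R) Vm Vp (sz S j k) Mt := by
  have hR : Real.exp (Real.log S.R) = S.R := Real.exp_log S.hR
  refine ⟨?_, ?_, hVm, ?_, ?_, S.hlam_pos k, ?_, ?_, sz_rel S j k, ?_⟩
  · rw [hR]; exact (vk_reg S k).mono (pball S j k)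
  · rw [hR]; exact (V_reg S).mono (pball S j k)
  · rw [hR]; exact fun x hx => (hV _ (subset_closure (pball S j k hx))).1
  · rw [hR]; exact fun x hx => (hV _ (subset_closure (pball S j k hx))).2
  · rw [hR]; exact fun x hx => vk_LL S k (pball S j k hx)
  · rw [hR]
    intro x hx
    rw [pc, ← eC_ball] at hx
    rw [tc_pc]
    exact S.hxpt_max j k _ hx
  · intro s hs
    have hsub : ball (pc S j k) (Real.exp s) ⊆ Om S :=
      (ball_subset_ball (by rw [← hR]; exact Real.exp_le_exp.2 hs.le)).trans (pball S j k)
    refine le_trans ?_ hMt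
    refine setIntegral_mono_set (rho_int S k) ?_ hsub.eventuallyLE
    filter_upwards [ae_restrict_mem (Om_open S).measurableSet] with x hx using (rho_pos S k hx).le

end SetC

section SetD
variable {m : ℕ}

/-- collected constants -/
structure Ctx (S : Setting m) (Vm Vp Mt D : ℝ) : Prop where
  hVm : 0 < Vm
  hVp : 0 < Vp
  hV : ∀ x ∈ closure S.Ω, Vm ≤ S.V x ∧ S.V x ≤ Vp
  hMt : 0 < Mt
  hD : ∀ j k, Om S ⊆ ball (pc S j k) D
  hRD : S.R ≤ D
  hev : ∀ᶠ k in atTop, ∫ x in Om S, rho S k x ≤ Mt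

lemma ctx_exists (S : Setting m) : ∃ Vm Vp Mt D, Ctx S Vm Vp Mt D := by
  obtain ⟨Vm, Vp, h1, h2, h3⟩ := V_bounds S
  obtain ⟨r, hr⟩ := (Om_bdd S).subset_ball 0
  refine ⟨Vm, Vp, 8 * π * m + 1, 2 * |r| + S.R, h1, h2, h3, by positivity, ?_, ?_, ?_⟩
  · intro j k x hx
    have a1 := hr hx
    have a2 := hr (pc_mem S j k)
    rw [mem_ball] at *
    have := dist_triangle_right x (pc S j k) 0
    have := le_abs_self r
    have := S.hR
    linarith
  · have := abs_nonneg r; linarith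
  · have := S.hmass.eventually_le_const (show 8 * π * m < 8 * π * m + 1 by linarith)
    simpa only [rho_total] using this

variable {S : Setting m} {Vm Vp Mt D : ℝ}

lemma Ctx.vp_upper (X : Ctx S Vm Vp Mt D) {k : ℕ} (hk : ∫ x in Om S, rho S k x ≤ Mt) (j : Fin m)
    {s : ℝ} (hs : s < Real.log S.R) :
    2 * π * tc (S.v k) (pc S j k) ≤ π / 2 * (Vp / Vm) + Mt * max (s - sz S j k) 0
      + Mt * (Real.log D - s) + 4 * π := by
  have hR : Real.exp (Real.log S.R) = S.R := Real.exp_log S.hR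
  have h1 := (LD_S S X.hVm X.hV hk j).A_lower2 hs
  have h2 := avg_bound (Om_open S) (X.hD j k) (vk_reg S k)
    (by rw [Om, ← eC_closure]; exact tc_continuousOn (S.hv_cont k))
    (by rw [Om, ← eC_frontier]; exact fun x hx => S.hBC k _ hx) (fun x hx => vk_LL S k hx)
    (fun x hx => (rho_pos S k hx).le) (rho_int S k) hk hs (by rw [hR]; exact pball S j k)
    (le_trans (by rw [← hR]; exact Real.exp_le_exp.2 hs.le) X.hRD)
  linarith

lemma Ctx.sz_tendsto (X : Ctx S Vm Vp Mt D) (j : Fin m) : Tendsto (sz S j) atTop atBot := by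
  rw [tendsto_atBot]
  intro B
  set s := min B (Real.log S.R - 1) with hs
  have hsb : s < Real.log S.R := lt_of_le_of_lt (min_le_right _ _) (by linarith)
  filter_upwards [X.hev, (S.hxpt_blow j).eventually_gt_atTop
    ((π / 2 * (Vp / Vm) + Mt * (Real.log D - s) + 4 * π) / (2 * π))] with k hk hv
  by_contra hc
  push Not at hc
  have h1 := X.vp_upper hk j hsb
  have h2 : s - sz S j k ≤ 0 := by have := min_le_left B (Real.log S.R - 1); linarith
  rw [max_eq_right h2, tc_pc] at h1
  rw [div_lt_iff₀ (by positivity)] at hv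
  linarith

lemma Ctx.grad (X : Ctx S Vm Vp Mt D) (j : Fin m) {ε : ℝ} (hε : 0 < ε) : ∃ s1 ≤ Real.log S.R,
    ∀ k, ∀ z ∈ hp s1, |dx (cyl (tc S.V) (pc S j k)) z| ≤ ε * cyl (tc S.V) (pc S j k) z := by
  have hR : Real.exp (Real.log S.R) = S.R := Real.exp_log S.hR
  have hcont : ContinuousOn (fderiv ℝ (tc S.V)) (Om S) :=
    (V_reg S).continuousOn_fderiv_of_isOpen (Om_open S) le_rfl
  have hK : eC ⁻¹' (closedBall (S.xstar j) (2 * S.R)) ⊆ Om S := Set.preimage_mono (S.hR2 j)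
  have hKc : IsCompact (eC ⁻¹' (closedBall (S.xstar j) (2 * S.R))) :=
    eC.toHomeomorph.isCompact_preimage.2 (isCompact_closedBall _ _)
  obtain ⟨G, hG⟩ := hKc.exists_bound_of_continuousOn (hcont.mono hK)
  have hG0 : 0 < |G| + 1 := by positivity
  have hq : 0 < ε * Vm / (|G| + 1) := by have := X.hVm; positivity
  refine ⟨min (Real.log S.R) (Real.log (ε * Vm / (|G| + 1))), min_le_left _ _, fun k z hz => ?_⟩
  have hz1 : z ∈ hp (Real.log S.R) := by
    simp only [hp, Set.mem_ofPred_eq] at hz ⊢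
    exact lt_of_lt_of_le hz (min_le_left _ _)
  have hz2 : Real.exp z.re ≤ ε * Vm / (|G| + 1) := by
    simp only [hp, Set.mem_ofPred_eq] at hz
    rw [← Real.exp_log hq]
    exact Real.exp_le_exp.2 (le_of_lt (lt_of_lt_of_le hz (min_le_right _ _)))
  have hm1 := psi_mem (p := pc S j k) hz1
  rw [hR] at hm1
  have hO := pball S j k hm1
  have hmK : pc S j k + Complex.exp z ∈ eC ⁻¹' (closedBall (S.xstar j) (2 * S.R)) := by
    rw [pc, ← eC_ball] at hm1
    exact ball_subset_closedBall (xball S j k hm1)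
  have hg := hG _ hmK
  rw [dx, fderiv_cyl (diffAt_of (Om_open S) (V_reg S) hO), mul_one]
  have h1 := (fderiv ℝ (tc S.V) (pc S j k + Complex.exp z)).le_opNorm (Complex.exp z)
  rw [Real.norm_eq_abs, Complex.norm_exp] at h1
  have hVl := (X.hV _ (subset_closure hO)).1
  have h2 : ‖fderiv ℝ (tc S.V) (pc S j k + Complex.exp z)‖ * Real.exp z.re
      ≤ (|G| + 1) * (ε * Vm / (|G| + 1)) := by
    refine mul_le_mul ?_ hz2 (Real.exp_pos _).le hG0.le
    linarith [le_abs_self G]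
  rw [mul_div_cancel₀ _ hG0.ne'] at h2
  have h3 : ε * Vm ≤ ε * cyl (tc S.V) (pc S j k) z := mul_le_mul_of_nonneg_left hVl hε.le
  linarith

lemma Ctx.mass_lower (X : Ctx S Vm Vp Mt D) {ε : ℝ} (hε : 0 < ε) : ∃ S0 : ℝ, 0 < S0 ∧
    ∀ᶠ k in atTop, ∀ j, 8 * π - ε ≤ mS S j k (sz S j k + S0) := by
  obtain ⟨S0, h0, H⟩ := lemA X.hVm X.hVp X.hMt hε
  refine ⟨S0, h0, ?_⟩
  rw [eventually_all]
  intro j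
  obtain ⟨s1, hs1, hg⟩ := X.grad j (ε := ε / (8 * π)) (by positivity)
  filter_upwards [X.hev, (X.sz_tendsto j).eventually_le_atBot (Real.log S.R - S0 - 2),
    (X.sz_tendsto j).eventually_lt_atBot (s1 - S0)] with k hk h1 h2
  exact H _ _ _ _ _ _ s1 (LD_S S X.hVm X.hV hk j) (by linarith) hs1 (by linarith) (hg k)

/-- outer radius -/
def tt (S : Setting m) : ℝ := Real.log (S.R / 2)

lemma exp_tt (S : Setting m) : Real.exp (tt S) = S.R / 2 := Real.exp_log (by have := S.hR; linarith)

lemma tt_lt (S : Setting m) : tt S < Real.log S.R :=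
  Real.log_lt_log (by have := S.hR; linarith) (by have := S.hR; linarith)

lemma sum_mS_le : ∀ᶠ k in atTop, ∑ i, mS S i k (tt S) ≤ ∫ x in Om S, rho S k x := by
  have hev : ∀ᶠ k in atTop, ∀ i, dist (S.xpt i k) (S.xstar i) < S.R / 2 := by
    rw [eventually_all]
    intro i
    exact (S.hxpt_lim i).eventually (ball_mem_nhds _ (by have := S.hR; linarith))
  filter_upwards [hev] with k hk
  have hsub : ∀ i, ball (pc S i k) (Real.exp (tt S)) ⊆ Om S := fun i =>
    (ball_subset_ball (by rw [exp_tt]; have := S.hR; linarith)).trans (pball S i k)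
  have hdis : Pairwise (Function.onFun Disjoint fun i => ball (pc S i k) (Real.exp (tt S))) := by
    intro i j hij
    have := (S.hRdisj i j hij).preimage eC
    rw [eC_ball, eC_ball] at this
    have hs : ∀ i, ball (pc S i k) (Real.exp (tt S)) ⊆ ball (eC.symm (S.xstar i)) S.R := by
      intro i
      rw [exp_tt, pc, ← eC_ball, ← eC_ball]
      refine Set.preimage_mono fun x hx => ?_
      have := hk i
      rw [mem_ball] at *
      linarith [dist_triangle x (S.xpt i k) (S.xstar i)]
    exact this.mono (hs i) (hs j)
  have e := integral_iUnion_fintype (μ := volume) (f := rho S k)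
    (fun i => measurableSet_ball) hdis
    (fun i => (rho_int S k).mono_set (hsub i))
  have e2 : ∑ i, mS S i k (tt S) = ∫ x in ⋃ i, ball (pc S i k) (Real.exp (tt S)), rho S k x := by
    rw [e]; rfl
  rw [e2]
  refine setIntegral_mono_set (rho_int S k) ?_ (Set.iUnion_subset hsub).eventuallyLE
  filter_upwards [ae_restrict_mem (Om_open S).measurableSet] with x hx using (rho_pos S k hx).le

lemma Ctx.mass_mono (X : Ctx S Vm Vp Mt D) {k : ℕ} (hk : ∫ x in Om S, rho S k x ≤ Mt) (j : Fin m)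
    {s t : ℝ} (hst : s ≤ t) (ht : t < Real.log S.R) : mS S j k s ≤ mS S j k t :=
  (LD_S S X.hVm X.hV hk j).MM_mono hst ht

lemma Ctx.mass_upper (X : Ctx S Vm Vp Mt D) {ε : ℝ} (hε : 0 < ε) :
    ∀ᶠ k in atTop, ∀ j, mS S j k (tt S) ≤ 8 * π + ε := by
  have hm : (0 : ℝ) < m := by exact_mod_cast S.hm
  have hε' : 0 < ε / m := by positivity
  obtain ⟨S0, h0, H⟩ := X.mass_lower hε'
  have hs : ∀ᶠ k in atTop, ∀ j, sz S j k ≤ tt S - S0 := by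
    rw [eventually_all]; exact fun j => (X.sz_tendsto j).eventually_le_atBot _
  have htot := S.hmass.eventually_le_const (show 8 * π * m < 8 * π * m + ε / m by linarith)
  filter_upwards [X.hev, H, hs, htot, sum_mS_le (S := S)] with k hk h1 h2 h3 h4 j
  rw [← rho_total] at h3
  have h5 : ∀ i, 8 * π - ε / m ≤ mS S i k (tt S) := fun i =>
    (h1 i).trans (X.mass_mono hk i (by linarith [h2 i]) (tt_lt S))
  have h6 : mS S j k (tt S) + (m - 1) * (8 * π - ε / m) ≤ ∑ i, mS S i k (tt S) := by
    rw [← Finset.add_sum_erase _ _ (Finset.mem_univ j)]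
    have := Finset.card_nsmul_le_sum (Finset.univ.erase j) (fun i => mS S i k (tt S))
      (8 * π - ε / m) (fun i _ => h5 i)
    rw [Finset.card_erase_of_mem (Finset.mem_univ j), Finset.card_univ, Fintype.card_fin,
      nsmul_eq_mul, Nat.cast_sub S.hm] at this
    push_cast at this
    linarith
  have e : ε = m * (ε / m) := by field_simp
  nlinarith [mul_pos hm hε']

lemma Ctx.T_lower (X : Ctx S Vm Vp Mt D) (j : Fin m) : ∃ C : ℝ, ∀ᶠ k in atTop,
    - sz S j k ≤ - Real.log (S.lam k) + C := by
  obtain ⟨S0, h0, H⟩ := X.mass_lower (ε := 2 * π) (by positivity)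
  refine ⟨- Real.log Vm - 3 * tt S + 3 * S0, ?_⟩
  filter_upwards [X.hev, H, (X.sz_tendsto j).eventually_le_atBot (tt S - S0)] with k hk h1 h2
  have L := LD_S S X.hVm X.hV hk j
  set σ := sz S j k + S0
  have hst : σ ≤ tt S := by simp only [σ]; linarith
  have hd : ∀ s < Real.log S.R, HasDerivAt (cint (cyl (tc (S.v k)) (pc S j k))) (- mS S j k s) s :=
    fun s hs => L.A_deriv hs
  have hA := Convex.image_sub_le_mul_sub_of_deriv_le (convex_Icc σ (tt S))
    (f := cint (cyl (tc (S.v k)) (pc S j k)))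
    (fun s hs => (hd s (lt_of_le_of_lt hs.2 (tt_lt S))).continuousAt.continuousWithinAt)
    (fun s hs => (hd s (lt_of_le_of_lt (interior_subset hs).2 (tt_lt S))).differentiableAt.differentiableWithinAt)
    (C := - (6 * π)) (fun s hs => by
      have hs' := interior_subset hs
      have hs2 := lt_of_le_of_lt hs'.2 (tt_lt S)
      rw [(hd s hs2).deriv]
      linarith [h1 j, X.mass_mono hk j hs'.1 hs2]) σ ⟨le_rfl, hst⟩ (tt S) ⟨hst, le_rfl⟩ hst
  have hR : Real.exp (Real.log S.R) = S.R := Real.exp_log S.hR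
  have hA0 : 0 ≤ cint (cyl (tc (S.v k)) (pc S j k)) (tt S) := by
    refine cint_nonneg fun z hz => vk_nonneg S k (pball S j k ?_)
    have := psi_mem (p := pc S j k) (z := z) (b := Real.log S.R)
      (by simp only [hp, Set.mem_ofPred_eq, hz]; exact tt_lt S)
    rwa [hR] at this
  have hA1 : cint (cyl (tc (S.v k)) (pc S j k)) σ ≤ 2 * π * tc (S.v k) (pc S j k) := by
    rw [← cint_const]
    refine cint_mono (b := Real.log S.R) (cyl_contDiffOn L.hv).continuousOn continuousOn_const
      (lt_of_le_of_lt hst (tt_lt S)) fun z hz => ?_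
    have := L.G_nonneg (z := z)
      (by simp only [hp, Set.mem_ofPred_eq, hz]; exact lt_of_le_of_lt hst (tt_lt S))
    linarith
  have hlog := sz_log S j k
  have hVl : Real.log Vm ≤ Real.log (tc S.V (pc S j k)) :=
    Real.log_le_log X.hVm (X.hV _ (subset_closure (pc_mem S j k))).1
  have h3 : 3 * (tt S - σ) ≤ tc (S.v k) (pc S j k) := by
    have : 2 * π * (3 * (tt S - σ)) ≤ 2 * π * tc (S.v k) (pc S j k) := by linarith
    exact le_of_mul_le_mul_left this (by positivity)
  simp only [σ] at h3
  linarith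

lemma Ctx.T_upper (X : Ctx S Vm Vp Mt D) (j : Fin m) : ∃ C : ℝ, ∀ᶠ k in atTop,
    - Real.log (S.lam k) ≤ Mt / (2 * π) * (- sz S j k) + C := by
  refine ⟨(π / 2 * (Vp / Vm) + Mt * tt S + Mt * (Real.log D - tt S) + 4 * π) / (2 * π)
    + Real.log Vp, ?_⟩
  filter_upwards [X.hev, (X.sz_tendsto j).eventually_le_atBot (tt S),
    (X.sz_tendsto j).eventually_le_atBot 0] with k hk h1 h2
  have h3 := X.vp_upper hk j (tt_lt S)
  rw [max_eq_left (by linarith)] at h3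
  have hlog := sz_log S j k
  have hVl : Real.log (tc S.V (pc S j k)) ≤ Real.log Vp :=
    Real.log_le_log (V_pos S (pc_mem S j k)) (X.hV _ (subset_closure (pc_mem S j k))).2
  have h4 : tc (S.v k) (pc S j k) ≤ (π / 2 * (Vp / Vm) + Mt * (tt S - sz S j k)
      + Mt * (Real.log D - tt S) + 4 * π) / (2 * π) := by
    rw [le_div_iff₀ (by positivity)]; linarith
  have h5 : (π / 2 * (Vp / Vm) + Mt * (tt S - sz S j k)
      + Mt * (Real.log D - tt S) + 4 * π) / (2 * π) = Mt / (2 * π) * (- sz S j k) +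
      (π / 2 * (Vp / Vm) + Mt * tt S + Mt * (Real.log D - tt S) + 4 * π) / (2 * π) := by
    field_simp; ring
  linarith

lemma Ctx.T_comp (X : Ctx S Vm Vp Mt D) (i j : Fin m) : ∃ K : ℝ, 0 < K ∧ ∀ᶠ k in atTop,
    - sz S j k ≤ K * (- sz S i k) := by
  obtain ⟨C1, h1⟩ := X.T_lower j
  obtain ⟨C2, h2⟩ := X.T_upper i
  have := X.hMt
  refine ⟨Mt / (2 * π) + |C1 + C2|, by positivity, ?_⟩
  filter_upwards [h1, h2, (X.sz_tendsto i).eventually_le_atBot (-1)] with k a1 a2 a3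
  nlinarith [le_abs_self (C1 + C2), abs_nonneg (C1 + C2)]

end SetD

section SetE
variable {m : ℕ} {S : Setting m} {Vm Vp Mt D : ℝ}

lemma mu_pos (W : EigenData S) (k : ℕ) {n : ℕ} (hn : 1 ≤ n) : 0 < W.mu n k := by
  rcases eq_or_lt_of_le hn with h | h
  · rw [← h]; exact W.hpos k
  · have h2 : 2 ≤ n := h
    induction n, h2 using Nat.le_induction with
    | base => exact (W.hpos k).trans (W.hlt k)
    | succ n h2 ih => exact (ih (by omega) (by omega)).trans_le (W.hmono k n h2)

lemma ED_S (W : EigenData S) {n : ℕ} (hn : 1 ≤ n) (k : ℕ) (j : Fin m) :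
    ED (tc (W.w n k)) (tc (S.v k)) (tc S.V) (S.lam k) (W.mu n k) (pc S j k) (Real.log S.R) := by
  have hR : Real.exp (Real.log S.R) = S.R := Real.exp_log S.hR
  refine ⟨?_, ?_, ?_, (mu_pos W k hn).le⟩
  · rw [hR]; exact (tc_contDiffOn (W.hw_reg n k)).mono (pball S j k)
  · rw [hR]
    intro x hx
    rw [LL_tc]
    have := W.hPDE n k (eC x) (pball S j k hx)
    simp only [tc]
    linarith
  · rw [hR]
    exact fun x hx => W.hbound n k _ (subset_closure (pball S j k hx))

lemma lim_at {W : EigenData S} {φ : ℕ → ℕ} {n : ℕ} {c : Fin m → ℝ} (h : IsLimitVec S W φ n c)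
    (j : Fin m) : Tendsto (fun k => W.w n (φ k) (S.xpt j (φ k))) atTop (𝓝 (c j)) := by
  have := (tendstoLocallyUniformlyOn_univ.2 (h.2 j)).tendsto_at (Set.mem_univ (0 : E2))
  simpa using this

lemma c_le {W : EigenData S} {φ : ℕ → ℕ} {n : ℕ} {c : Fin m → ℝ} (h : IsLimitVec S W φ n c)
    (j : Fin m) : |c j| ≤ 1 :=
  le_of_tendsto (lim_at h j).abs (Eventually.of_forall fun _ =>
    W.hbound n _ _ (subset_closure (xpt_mem S j _)))

lemma unif {W : EigenData S} {φ : ℕ → ℕ} {n : ℕ} {c : Fin m → ℝ} (h : IsLimitVec S W φ n c)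
    (j : Fin m) (L : ℝ) {θ : ℝ} (hθ : 0 < θ) : ∀ᶠ k in atTop, ∀ z ∈ hp (sz S j (φ k) + L),
      |cyl (tc (W.w n (φ k))) (pc S j (φ k)) z - c j| ≤ θ := by
  have h1 := tendstoLocallyUniformly_iff_forall_isCompact.1 (h.2 j) (closedBall 0 (Real.exp L))
    (isCompact_closedBall _ _)
  rw [Metric.tendstoUniformlyOn_iff] at h1
  filter_upwards [h1 θ hθ] with k hk z hz
  have hδ := delta_pos S j (φ k)
  set δ := S.delta j (φ k) with hδe
  have hn : ‖δ⁻¹ • eC (Complex.exp z)‖ ≤ Real.exp L := by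
    rw [norm_smul, eC.norm_map, Complex.norm_exp, Real.norm_eq_abs, abs_of_pos (inv_pos.2 hδ)]
    simp only [hp, Set.mem_ofPred_eq] at hz
    rw [inv_mul_le_iff₀ hδ, hδe, ← exp_sz, ← Real.exp_add]
    exact Real.exp_le_exp.2 hz.le
  have h2 := hk (δ⁻¹ • eC (Complex.exp z)) (by rwa [mem_closedBall_zero_iff])
  rw [smul_inv_smul₀ hδ.ne', dist_comm, Real.dist_eq] at h2
  have e : cyl (tc (W.w n (φ k))) (pc S j (φ k)) z
      = W.w n (φ k) (eC (Complex.exp z) + S.xpt j (φ k)) := by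
    simp only [cyl, tc, pc, map_add, LinearIsometryEquiv.apply_symm_apply, add_comm]
  rw [e]; exact h2.le

lemma Ctx.neck_mass (X : Ctx S Vm Vp Mt D) {ε : ℝ} (hε : 0 < ε) : ∃ S0 : ℝ, 0 < S0 ∧
    ∀ᶠ k in atTop, ∀ j, 8 * π - ε ≤ mS S j k (sz S j k + S0) ∧
      mS S j k (tt S) - mS S j k (sz S j k + S0) ≤ 2 * ε := by
  obtain ⟨S0, h0, H⟩ := X.mass_lower hε
  refine ⟨S0, h0, ?_⟩
  filter_upwards [H, X.mass_upper hε] with k h1 h2 j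
  exact ⟨h1 j, by linarith [h1 j, h2 j]⟩

lemma Ctx.mu_T (X : Ctx S Vm Vp Mt D) {W : EigenData S} {φ : ℕ → ℕ} (hφ : StrictMono φ) {n : ℕ}
    (hn : 1 ≤ n) {c : Fin m → ℝ} (h : IsLimitVec S W φ n c) (j : Fin m) : ∃ Q : ℝ, 0 < Q ∧
    ∀ᶠ k in atTop, W.mu n (φ k) ≤ Q ∧ W.mu n (φ k) * (tt S - sz S j (φ k)) ≤ Q := by
  obtain ⟨i, hi⟩ : ∃ i, c i ≠ 0 := by
    by_contra hc; push Not at hc; exact h.1 (funext hc)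
  have hci : 0 < |c i| := abs_pos.2 hi
  have hci1 := c_le h i
  have hMt := X.hMt
  obtain ⟨K, hK, hcomp⟩ := X.T_comp i j
  have hε : 0 < |c i| * π / 8 := by positivity
  obtain ⟨S0, h0, hneck⟩ := X.neck_mass hε
  have hθ : 0 < |c i| * π / (2 * Mt) := by positivity
  have hu := unif h i (S0 + 4) hθ
  have hφt := hφ.tendsto_atTop
  have hszi := (X.sz_tendsto i).comp hφt
  refine ⟨(1 + |tt S| + K) * (2 / |c i|), by positivity, ?_⟩
  filter_upwards [hφt.eventually X.hev, hφt.eventually hcomp, hφt.eventually hneck, hu,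
    hszi.eventually_le_atBot (-1), hszi.eventually_le_atBot (tt S - S0 - 4),
    hszi.eventually_le_atBot (2 * (tt S - S0))] with k hk a1 a2 a3 a4 a5 a6
  simp only [Function.comp] at a4 a5 a6
  have L := LD_S S X.hVm X.hV hk i
  have e := ED_S W hn (φ k) i
  have hμ := mu_pos W (φ k) hn
  have htl := tt_lt S
  have hMσ := L.MM_le (s := sz S i (φ k) + S0) (by linarith)
  have hb : W.mu n (φ k) * (tt S - (sz S i (φ k) + S0)) ≤ 1 / |c i| := by
    refine e.mu_bound L hci1 hi (σ' := sz S i (φ k) + (S0 + 4)) (by linarith) (by linarith) a3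
      (by linarith) htl ?_ ?_
    · have := (a2 i).1
      change 6 * π ≤ mS S i (φ k) (sz S i (φ k) + S0)
      nlinarith [Real.pi_pos]
    · have h1 := (a2 i).2
      simp only [mS] at h1
      have h2 : |c i| * π / (2 * Mt) * MM (tc (S.v (φ k))) (tc S.V) (S.lam (φ k)) (pc S i (φ k))
          (sz S i (φ k) + S0) ≤ |c i| * π / (2 * Mt) * Mt := mul_le_mul_of_nonneg_left hMσ hθ.le
      have h3 : |c i| * π / (2 * Mt) * Mt = |c i| * π / 2 := by field_simp
      linarith
  have hb2 : W.mu n (φ k) * (- sz S i (φ k)) ≤ 2 / |c i| := by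
    have : 2 / |c i| = 2 * (1 / |c i|) := by ring
    nlinarith
  have hb3 : W.mu n (φ k) ≤ 2 / |c i| := by nlinarith
  have hq : 0 < 2 / |c i| := by positivity
  refine ⟨?_, ?_⟩
  · nlinarith [abs_nonneg (tt S)]
  · have h1 : W.mu n (φ k) * tt S ≤ |tt S| * (2 / |c i|) := by
      calc W.mu n (φ k) * tt S ≤ W.mu n (φ k) * |tt S| :=
            mul_le_mul_of_nonneg_left (le_abs_self _) hμ.le
        _ ≤ 2 / |c i| * |tt S| := mul_le_mul_of_nonneg_right hb3 (abs_nonneg _)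
        _ = _ := by ring
    have h2 : W.mu n (φ k) * (- sz S j (φ k)) ≤ K * (2 / |c i|) := by
      calc W.mu n (φ k) * (- sz S j (φ k)) ≤ W.mu n (φ k) * (K * (- sz S i (φ k))) :=
            mul_le_mul_of_nonneg_left a1 hμ.le
        _ = K * (W.mu n (φ k) * (- sz S i (φ k))) := by ring
        _ ≤ _ := mul_le_mul_of_nonneg_left hb2 hK.le
    nlinarith

lemma params (Q Λ Mt : ℝ) {C : ℝ} (hΛ : 0 < Λ) (hC : 0 < C) : ∃ ε : ℝ, 0 < ε ∧ ε < C ∧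
    2 * ε < π / (8 * Λ) ∧
    2 * (32 * π ^ 5 * (Q * (8 * Λ * (2 * ε) / π)) ^ 2 + 2 * π * ε ^ 2 + 2 * π * ε +
      (2 * π * ε + Q * (ε * Mt + 4 * ε)) ^ 2 / (2 * π)) + π / 8 * (2 * (Q * (8 * Λ * (2 * ε) / π)))
      < π * C ^ 2 := by
  have hc : Continuous fun ε : ℝ => 2 * (32 * π ^ 5 * (Q * (8 * Λ * (2 * ε) / π)) ^ 2 +
      2 * π * ε ^ 2 + 2 * π * ε +
      (2 * π * ε + Q * (ε * Mt + 4 * ε)) ^ 2 / (2 * π)) +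
      π / 8 * (2 * (Q * (8 * Λ * (2 * ε) / π))) := by fun_prop
  have h0 := hc.tendsto 0
  have h1 : ∀ᶠ ε in 𝓝 (0 : ℝ), _ < π * C ^ 2 := h0.eventually_lt_const (by simp; positivity)
  have h2 : ∀ᶠ ε in 𝓝 (0 : ℝ), ε < C := eventually_lt_nhds hC
  have h3 : ∀ᶠ ε in 𝓝 (0 : ℝ), ε < π / (8 * Λ) / 2 := eventually_lt_nhds (by positivity)
  obtain ⟨ε, ⟨⟨a1, a2⟩, a3⟩, a4⟩ := ((((h1.and h2).and h3).filter_mono nhdsWithin_le_nhds).and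
    (self_mem_nhdsWithin : Set.Ioi (0 : ℝ) ∈ 𝓝[>] 0)).exists
  exact ⟨ε, a4, a2, by linarith, a1⟩

set_option maxHeartbeats 2000000 in
lemma no_conc (X : Ctx S Vm Vp Mt D) {W : EigenData S} {φ : ℕ → ℕ} (hφ : StrictMono φ) {n : ℕ}
    (hn : 1 ≤ n) {c : Fin m → ℝ} (h : IsLimitVec S W φ n c) {j : Fin m} (hj : c j = 0)
    {C : ℝ} (hC : 0 < C) {z : ℕ → E2} (hz : Tendsto z atTop (𝓝 (S.xstar j))) :
    ∀ᶠ k in atTop, |W.w n (φ k) (z k)| < C := by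
  obtain ⟨Q, hQ, hmu⟩ := X.mu_T hφ hn h j
  have hΛ : 0 < Vp / Vm := div_pos X.hVp X.hVm
  have hMt := X.hMt
  obtain ⟨ε, hε, hεC, hν, hfin⟩ := params Q (Vp / Vm) Mt hΛ hC
  obtain ⟨S0, h0, hneck⟩ := X.neck_mass hε
  have hu := unif h j (S0 + 4) hε
  have hφt := hφ.tendsto_atTop
  have hsz := (X.sz_tendsto j).comp hφt
  have hcen := (lim_at h j).abs.eventually_lt_const (show |c j| < C by rw [hj, abs_zero]; exact hC)
  have hdist : Tendsto (fun k => dist (z k) (S.xpt j (φ k))) atTop (𝓝 0) := by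
    have := hz.dist ((S.hxpt_lim j).comp hφt)
    simpa using this
  -- the radius below which the exponential term is small
  set B := min (tt S - 3) (tt S - 2 + 2 * π * Real.log ε) with hB
  filter_upwards [hφt.eventually X.hev, hmu, hφt.eventually hneck, hu,
    hsz.eventually_le_atBot (tt S - S0 - 6), hdist.eventually_lt_const (Real.exp_pos B), hcen]
    with k hk a1 a2 a3 a4 a5 a6
  simp only [Function.comp] at a4
  obtain ⟨a1a, a1b⟩ := a1
  have htl := tt_lt S
  have L := LD_S S X.hVm X.hV hk j
  have e := ED_S W hn (φ k) j
  have hμ := mu_pos W (φ k) hn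
  simp only [hj, sub_zero] at a3
  set p := pc S j (φ k) with hp'
  set y := eC.symm (z k) with hy
  have hw : W.w n (φ k) (z k) = tc (W.w n (φ k)) y := by simp [tc, hy]
  rw [hw]
  by_cases hyp : y = p
  · rw [hyp, hp', tc_pc]; linarith
  have hyp' : y - p ≠ 0 := sub_ne_zero.2 hyp
  set ζ := Complex.log (y - p) with hζ
  have hexp : p + Complex.exp ζ = y := by rw [hζ, Complex.exp_log hyp']; ring
  have hcy : tc (W.w n (φ k)) y = cyl (tc (W.w n (φ k))) p ζ := by rw [cyl, hexp]
  rw [hcy]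
  by_cases hcase : ζ.re < sz S j (φ k) + (S0 + 4)
  · exact lt_of_le_of_lt (a3 ζ (by simpa only [hp, Set.mem_ofPred_eq] using hcase)) hεC
  push Not at hcase
  have hre : ζ.re ≤ B := by
    rw [hζ, Complex.log_re]
    have : ‖y - p‖ = dist (z k) (S.xpt j (φ k)) := by
      rw [← dist_eq_norm, hy, hp', pc, eC.symm.dist_map]
    rw [← this] at a5
    rw [← Real.log_exp B]
    exact Real.log_le_log (norm_pos_iff.2 hyp') a5.le
  have hB1 : B ≤ tt S - 3 := min_le_left _ _
  have hB2 : B ≤ tt S - 2 + 2 * π * Real.log ε := min_le_right _ _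
  have hMσ := L.MM_le (s := sz S j (φ k) + S0) (by linarith)
  have hM0 := L.MM_nonneg (s := sz S j (φ k) + S0) (by linarith)
  have hn2 := (a2 j).2
  simp only [mS] at hn2
  have key := e.neck L (θ := ε) (σ := sz S j (φ k) + S0) (σ' := sz S j (φ k) + (S0 + 4))
    (t := tt S) (ν := 2 * ε) (α := ε * Mt + 4 * ε) (by linarith) (by linarith) a3 (by linarith) htl
    hn2 hν rfl (by nlinarith) (z := ζ) (by linarith) (by linarith)
  have hex : Real.exp (-(1 / (2 * π)) * (tt S - 2 - ζ.re)) ≤ ε := by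
    rw [← Real.exp_log hε]
    refine Real.exp_le_exp.2 ?_
    have : Real.log ε = -(1 / (2 * π)) * (-(2 * π * Real.log ε)) := by field_simp
    rw [this]
    refine mul_le_mul_of_nonpos_left ?_ (by have := Real.pi_pos; simp; positivity)
    linarith
  have hκ0 : 0 ≤ 8 * (Vp / Vm) * (2 * ε) / π := by positivity
  have hκ : W.mu n (φ k) * (8 * (Vp / Vm) * (2 * ε) / π) ≤ Q * (8 * (Vp / Vm) * (2 * ε) / π) :=
    mul_le_mul_of_nonneg_right a1a hκ0
  have hκ2 : (W.mu n (φ k) * (8 * (Vp / Vm) * (2 * ε) / π)) ^ 2 ≤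
      (Q * (8 * (Vp / Vm) * (2 * ε) / π)) ^ 2 :=
    pow_le_pow_left₀ (mul_nonneg hμ.le hκ0) hκ 2
  have hτ0 : 0 ≤ W.mu n (φ k) * (tt S - (sz S j (φ k) + S0)) := mul_nonneg hμ.le (by linarith)
  have hτ : W.mu n (φ k) * (tt S - (sz S j (φ k) + S0)) ≤ Q := by nlinarith
  have hα0 : 0 ≤ ε * Mt + 4 * ε := by positivity
  have hlast : (2 * π * ε + W.mu n (φ k) * (tt S - (sz S j (φ k) + S0)) * (ε * Mt + 4 * ε)) ^ 2
      / (2 * π) ≤ (2 * π * ε + Q * (ε * Mt + 4 * ε)) ^ 2 / (2 * π) := by gcongr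
  have h1 : 32 * π ^ 5 * (W.mu n (φ k) * (8 * (Vp / Vm) * (2 * ε) / π)) ^ 2 ≤
      32 * π ^ 5 * (Q * (8 * (Vp / Vm) * (2 * ε) / π)) ^ 2 := by gcongr
  have h2 : 2 * π * Real.exp (-(1 / (2 * π)) * (tt S - 2 - ζ.re)) ≤ 2 * π * ε := by gcongr
  have h3 : π / 8 * (2 * (W.mu n (φ k) * (8 * (Vp / Vm) * (2 * ε) / π))) ≤
      π / 8 * (2 * (Q * (8 * (Vp / Vm) * (2 * ε) / π))) := by gcongr
  have h4 : π * cyl (tc (W.w n (φ k))) p ζ ^ 2 < π * C ^ 2 := by linarith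
  have h5 := lt_of_mul_lt_mul_left h4 Real.pi_pos.le
  exact abs_lt_of_sq_lt_sq h5 hC.le

lemma main_equiv {W : EigenData S} {φ : ℕ → ℕ} (hφ : StrictMono φ) {n : ℕ}
    (hn : 1 ≤ n) {c : Fin m → ℝ} (h : IsLimitVec S W φ n c) (j : Fin m) :
    ConcentratesAt S (fun k => W.w n (φ k)) (S.xstar j) ↔ c j ≠ 0 := by
  constructor
  · rintro ⟨C, hC, z, -, hz, hev⟩ hj
    obtain ⟨Vm, Vp, Mt, D, X⟩ := ctx_exists S
    obtain ⟨k, h1, h2⟩ := (hev.and (no_conc X hφ hn h hj hC hz)).exists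
    exact absurd h1 (not_le.2 h2)
  · intro hj
    have hc : 0 < |c j| := abs_pos.2 hj
    refine ⟨|c j| / 2, by positivity, fun k => S.xpt j (φ k), fun k => xpt_mem S j _,
      (S.hxpt_lim j).comp hφ.tendsto_atTop, ?_⟩
    exact (lim_at h j).abs.eventually_const_le (by linarith)

end SetE

/-- `wⁿ_k` concentrates at `x*_j` if and only if `cⁿ_j ≠ 0`. -/
theorem statement19 {m : ℕ} (S : Setting m) (W : EigenData S)
    (φ : ℕ → ℕ) (hφ : StrictMono φ) (c : ℕ → Fin m → ℝ)
    (hc : ∀ n, 1 ≤ n → n ≤ m → IsLimitVec S W φ n (c n)) :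
    ∀ n, 1 ≤ n → n ≤ m → ∀ j : Fin m,
      (ConcentratesAt S (fun k => W.w n (φ k)) (S.xstar j) ↔ c n j ≠ 0) := by
  exact fun n h1 h2 j => main_equiv hφ h1 (hc n h1 h2) j
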